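/- arXiv:1009.2521 — 2 statements merged into one kernel-verified Lean document; each statement's English description precedes it below -/
import Mathlib

section
/- Let P be a simple polygon in the plane with vertices v_0, …, v_{n-1} in counterclockwise order (indices mod n), with no three distinct vertices collinear. Let i be an index and j = i + k (mod n) with 2 ≤ k ≤ n − 1, and suppose v_i is visible to v_j. Let t* be the largest t ∈ {1, …, k − 1} such that v_{i+t} is visible to v_i, and set v' = v_{i+t*} (the last vertex of the chain ch(v_{i+1}, v_{j-1}) visible to v_i). Then v' is visible to v_j. -/
/-- A point in the Euclidean plane. -/
abbrev Plane := ℝ × ℝ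

/-- A simple polygon with `n` vertices `v 0, …, v (n-1)` in counterclockwise order
(indices mod `n`), given as a compact region `P` of the plane that is the closure of its
interior, whose frontier is the union of the closed edge segments `[v i, v (i+1)]`,
such that consecutive edges meet exactly in their common endpoint and non-consecutive
edges are disjoint; moreover no three distinct vertices are collinear. -/
structure SimplePolygon (n : ℕ) where
  three_le : 3 ≤ n
  v : ZMod n → Plane
  inj : Function.Injective v
  P : Set Plane
  compact : IsCompact P
  regular : P = closure (interior P)
  frontier_eq : frontier P = ⋃ i : ZMod n, segment ℝ (v i) (v (i + 1))
  edges_consecutive : ∀ i : ZMod n,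
    segment ℝ (v i) (v (i + 1)) ∩ segment ℝ (v (i + 1)) (v (i + 1 + 1)) = {v (i + 1)}
  edges_disjoint : ∀ i j : ZMod n, i ≠ j → j ≠ i + 1 → i ≠ j + 1 →
    Disjoint (segment ℝ (v i) (v (i + 1))) (segment ℝ (v j) (v (j + 1)))
  no_three_collinear : ∀ a b c : ZMod n, a ≠ b → a ≠ c → b ≠ c →
    ¬ Collinear ℝ ({v a, v b, v c} : Set Plane)

/-- `a` is visible to `b` in `P`: the closed segment `[a, b]` is contained in `P`. -/
def Visible (P : Set Plane) (a b : Plane) : Prop := segment ℝ a b ⊆ P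

/-- The determinant of two vectors of the plane. -/
def planeDet (u w : Plane) : ℝ := u.1 * w.2 - u.2 * w.1

/-- The directions `u`, `v`, `w` occur in this counterclockwise cyclic order around the origin. -/
def CCW (u v w : Plane) : Prop :=
  (0 < planeDet u v ∧ 0 < planeDet v w) ∨ (0 < planeDet v w ∧ 0 < planeDet w u) ∨
    (0 < planeDet w u ∧ 0 < planeDet u v)

section Directions

lemma planeDet_add_right (u v w : Plane) :
    planeDet u (v + w) = planeDet u v + planeDet u w := by
  simp only [planeDet, Prod.fst_add, Prod.snd_add]; ring

lemma planeDet_smul_right (t : ℝ) (u v : Plane) : planeDet u (t • v) = t * planeDet u v := by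
  simp only [planeDet, Prod.smul_fst, Prod.smul_snd, smul_eq_mul]; ring

lemma planeDet_swap (u v : Plane) : planeDet u v = -planeDet v u := by
  simp only [planeDet]; ring

lemma planeDet_self (u : Plane) : planeDet u u = 0 := by
  simp only [planeDet]; ring

lemma planeDet_plucker (a b c d : Plane) :
    planeDet a b * planeDet c d + planeDet a c * planeDet d b + planeDet a d * planeDet b c =
      0 := by
  simp only [planeDet]; ring

/-- Coordinates of a vector with respect to a basis of the plane, by Cramer's rule. -/
lemma exists_coords {u w : Plane} (h : planeDet u w ≠ 0) (x : Plane) :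
    ∃ α β : ℝ, x = α • u + β • w := by
  refine ⟨planeDet x w / planeDet u w, planeDet u x / planeDet u w, ?_⟩
  ext <;> simp only [Prod.fst_add, Prod.snd_add, Prod.smul_fst, Prod.smul_snd, smul_eq_mul] <;>
    field_simp <;> simp only [planeDet] <;> ring

lemma CCW.rotate {u v w : Plane} (h : CCW u v w) : CCW v w u := by
  unfold CCW at *; tauto

lemma CCW.asymm {u v w : Plane} (h : CCW u v w) : ¬ CCW u w v := by
  unfold CCW at *
  rw [planeDet_swap u w, planeDet_swap w v, planeDet_swap v u]
  rintro (⟨h1, h2⟩ | ⟨h1, h2⟩ | ⟨h1, h2⟩) <;>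
    rcases h with ⟨h3, h4⟩ | ⟨h3, h4⟩ | ⟨h3, h4⟩ <;> linarith

lemma CCW.total {u v w : Plane} (huv : planeDet u v ≠ 0) (hvw : planeDet v w ≠ 0)
    (hwu : planeDet w u ≠ 0) : CCW u v w ∨ CCW u w v := by
  unfold CCW
  rw [planeDet_swap u w, planeDet_swap w v, planeDet_swap v u]
  simp only [Left.neg_pos_iff]
  rcases lt_or_gt_of_ne huv with h1 | h1 <;> rcases lt_or_gt_of_ne hvw with h2 | h2 <;>
    rcases lt_or_gt_of_ne hwu with h3 | h3 <;> tauto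

lemma CCW.trans {a b c d : Plane} (h1 : CCW a b c) (h2 : CCW a c d) : CCW a b d := by
  have hp := planeDet_plucker a b c d
  unfold CCW at *
  rw [planeDet_swap c a] at h1
  rw [planeDet_swap d a] at h2 ⊢
  rw [planeDet_swap d b] at hp
  generalize planeDet a b = ab at *
  generalize planeDet a c = ac at *
  generalize planeDet a d = ad at *
  generalize planeDet b c = bc at *
  generalize planeDet b d = bd at *
  generalize planeDet c d = cd at *
  simp only [Left.neg_pos_iff] at *
  have key : ∀ x y : ℝ, 0 < x → 0 < y → 0 < x * y := fun x y => mul_pos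
  by_contra hcon
  push Not at hcon
  obtain ⟨k1, k2, k3⟩ := hcon
  rcases h1 with ⟨h1, h1'⟩ | ⟨h1, h1'⟩ | ⟨h1, h1'⟩ <;>
    rcases h2 with ⟨h2, h2'⟩ | ⟨h2, h2'⟩ | ⟨h2, h2'⟩ <;>
    first
    | linarith
    | (rcases lt_or_ge 0 ab with q1 | q1 <;> rcases lt_or_ge 0 bd with q2 | q2 <;>
        rcases lt_or_ge ad 0 with q3 | q3 <;>
        first
        | linarith [k1 q1]
        | linarith [k2 q2]
        | linarith [k3 q3]
        | nlinarith)

lemma CCW.smul {u v w : Plane} (h : CCW u v w) {t : ℝ} (ht : 0 < t) : CCW u (t • v) w := by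
  unfold CCW at *
  rw [planeDet_smul_right, planeDet_swap (t • v), planeDet_smul_right, planeDet_swap w v,
    mul_neg, neg_neg]
  simpa only [mul_pos_iff_of_pos_left ht] using h

/-- An affine line has dense complement. -/
lemma dense_planeDet_ne_zero {N : Plane} (hN : N ≠ 0) (g : Plane) :
    Dense {x : Plane | planeDet N (x - g) ≠ 0} := by
  intro x
  by_cases hx : planeDet N (x - g) = 0
  swap
  · exact subset_closure hx
  have hlim : Filter.Tendsto (fun t : ℝ => x + t • ((-N.2, N.1) : Plane)) (nhdsWithin 0 (Set.Ioi 0))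
      (nhds x) := by
    have : Filter.Tendsto (fun t : ℝ => x + t • ((-N.2, N.1) : Plane)) (nhds 0)
        (nhds (x + (0 : ℝ) • ((-N.2, N.1) : Plane))) :=
      (Continuous.tendsto (by fun_prop) 0)
    rw [zero_smul, add_zero] at this
    exact this.mono_left nhdsWithin_le_nhds
  refine mem_closure_of_tendsto hlim ?_
  filter_upwards [self_mem_nhdsWithin] with t (ht : 0 < t)
  have hN' : 0 < N.1 ^ 2 + N.2 ^ 2 := by
    by_contra hc
    apply hN
    have h1 : N.1 = 0 := by nlinarith [sq_nonneg N.1, sq_nonneg N.2]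
    have h2 : N.2 = 0 := by nlinarith [sq_nonneg N.1, sq_nonneg N.2]
    exact Prod.ext h1 h2
  have : planeDet N (x + t • ((-N.2, N.1) : Plane) - g) =
      planeDet N (x - g) + t * (N.1 ^ 2 + N.2 ^ 2) := by
    simp only [planeDet, Prod.fst_add, Prod.snd_add, Prod.fst_sub, Prod.snd_sub, Prod.smul_mk,
      smul_eq_mul]
    ring
  rw [this, hx]
  positivity

lemma continuous_planeDet_sub (N g : Plane) : Continuous fun x : Plane => planeDet N (x - g) := by
  unfold planeDet; fun_prop

lemma convex_planeDet_pos (N g : Plane) : Convex ℝ {x : Plane | 0 < planeDet N (x - g)} := by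
  intro x hx y hy s t hs ht hst
  simp only [Set.mem_ofPred_eq] at *
  have : planeDet N (s • x + t • y - g) = s * planeDet N (x - g) + t * planeDet N (y - g) := by
    obtain rfl : t = 1 - s := by linarith
    simp only [planeDet, Prod.fst_add, Prod.snd_add, Prod.fst_sub, Prod.snd_sub, Prod.smul_fst,
      Prod.smul_snd, smul_eq_mul]
    ring
  rw [this]
  rcases hs.eq_or_lt with rfl | hs
  · obtain rfl : t = 1 := by linarith
    linarith
  · nlinarith [mul_pos hs hx, mul_nonneg ht hy.le]

/-- A circular sector is connected. -/
lemma isPreconnected_ccw_ball (a Y Z : Plane) (h : planeDet Y Z ≠ 0) {δ : ℝ} (hδ : 0 < δ) :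
    IsPreconnected {x | x ∈ Metric.ball a δ ∧ CCW Y (x - a) Z} := by
  have hb := convex_ball a δ
  have hswap : ∀ x : Plane, planeDet (x - a) Z = planeDet (-Z) (x - a) := fun x => by
    simp only [planeDet, Prod.fst_sub, Prod.snd_sub, Prod.fst_neg, Prod.snd_neg]; ring
  rcases lt_or_gt_of_ne h with h | h
  · have hZY : 0 < planeDet Z Y := by rw [planeDet_swap]; linarith
    have heq : {x | x ∈ Metric.ball a δ ∧ CCW Y (x - a) Z} =
        (Metric.ball a δ ∩ {x | 0 < planeDet Y (x - a)}) ∪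
        (Metric.ball a δ ∩ {x | 0 < planeDet (-Z) (x - a)}) := by
      ext x
      simp only [CCW, hswap, Set.mem_ofPred_eq, Set.mem_union, Set.mem_inter_iff]
      tauto
    rw [heq]
    obtain ⟨ε, hε, hεb⟩ : ∃ ε : ℝ, 0 < ε ∧ a + ε • (-(Y + Z)) ∈ Metric.ball a δ := by
      have hlim : Filter.Tendsto (fun t : ℝ => a + t • (-(Y + Z))) (nhds 0)
          (nhds (a + (0 : ℝ) • (-(Y + Z)))) := Continuous.tendsto (by fun_prop) 0
      rw [zero_smul, add_zero] at hlim
      have := (hlim.mono_left (nhdsWithin_le_nhds (s := Set.Ioi 0))).eventually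
        (Metric.ball_mem_nhds a hδ)
      obtain ⟨ε, h1, h2⟩ := (this.and self_mem_nhdsWithin).exists
      exact ⟨ε, h2, h1⟩
    refine IsPreconnected.union (a + ε • (-(Y + Z))) ⟨hεb, ?_⟩ ⟨hεb, ?_⟩
      (hb.inter (convex_planeDet_pos _ _)).isPreconnected
      (hb.inter (convex_planeDet_pos _ _)).isPreconnected
    · have : planeDet Y (a + ε • (-(Y + Z)) - a) = ε * (-planeDet Y Z) := by
        simp only [planeDet, Prod.fst_add, Prod.snd_add, Prod.fst_sub, Prod.snd_sub, Prod.smul_fst,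
          Prod.smul_snd, smul_eq_mul, Prod.fst_neg, Prod.snd_neg]
        ring
      simp only [Set.mem_ofPred_eq]
      rw [this]
      exact mul_pos hε (by linarith)
    · have : planeDet (-Z) (a + ε • (-(Y + Z)) - a) = ε * (-planeDet Y Z) := by
        simp only [planeDet, Prod.fst_add, Prod.snd_add, Prod.fst_sub, Prod.snd_sub, Prod.smul_fst,
          Prod.smul_snd, smul_eq_mul, Prod.fst_neg, Prod.snd_neg]
        ring
      simp only [Set.mem_ofPred_eq]
      rw [this]
      exact mul_pos hε (by linarith)
  · have hZY : ¬ 0 < planeDet Z Y := by rw [planeDet_swap]; linarith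
    have heq : {x | x ∈ Metric.ball a δ ∧ CCW Y (x - a) Z} =
        Metric.ball a δ ∩ ({x | 0 < planeDet Y (x - a)} ∩ {x | 0 < planeDet (-Z) (x - a)}) := by
      ext x
      simp only [CCW, hswap, Set.mem_ofPred_eq, Set.mem_inter_iff]
      tauto
    rw [heq]
    exact (hb.inter ((convex_planeDet_pos _ _).inter (convex_planeDet_pos _ _))).isPreconnected

end Directions

section Winding

open Complex Filter Topology

/-- The point of the complex plane with given real and imaginary part. -/
def planeToComplex (p : Plane) : ℂ := ⟨p.1, p.2⟩

/-- The angle in `(-π, π]` from the direction `u` to the direction `w`. -/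
noncomputable def dirAngle (u w : Plane) : ℝ := arg (planeToComplex w / planeToComplex u)

lemma planeToComplex_ne_zero {p : Plane} (h : p ≠ 0) : planeToComplex p ≠ 0 := by
  intro hc
  apply h
  have h1 := congrArg Complex.re hc
  have h2 := congrArg Complex.im hc
  exact Prod.ext h1 h2

lemma planeToComplex_smul (t : ℝ) (p : Plane) :
    planeToComplex (t • p) = t * planeToComplex p := by
  apply Complex.ext <;> simp [planeToComplex]

lemma continuous_planeToComplex : Continuous planeToComplex :=
  Complex.equivRealProdCLM.symm.continuous

lemma dirAngle_smul_left {t : ℝ} (ht : 0 < t) (u w : Plane) :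
    dirAngle (t • u) w = dirAngle u w := by
  unfold dirAngle
  rw [planeToComplex_smul, ← arg_real_mul _ ht]
  congr 1
  have : (t : ℂ) ≠ 0 := by exact_mod_cast ht.ne'
  field_simp

lemma dirAngle_smul_right {t : ℝ} (ht : 0 < t) (u w : Plane) :
    dirAngle u (t • w) = dirAngle u w := by
  unfold dirAngle
  rw [planeToComplex_smul, mul_div_assoc, arg_real_mul _ ht]

lemma im_planeToComplex_div (u w : Plane) :
    (planeToComplex w / planeToComplex u).im =
      planeDet u w / Complex.normSq (planeToComplex u) := by
  rw [Complex.div_im, ← sub_div]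
  congr 1
  simp only [planeToComplex, planeDet]
  ring

lemma dirAngle_trichotomy {u w : Plane} (h : planeDet u w ≠ 0) :
    (0 < planeDet u w ∧ 0 < dirAngle u w ∧ dirAngle u w < Real.pi) ∨
      (planeDet u w < 0 ∧ dirAngle u w < 0 ∧ -Real.pi < dirAngle u w) := by
  have hu : u ≠ 0 := by rintro rfl; simp [planeDet] at h
  have hn : 0 < Complex.normSq (planeToComplex u) :=
    Complex.normSq_pos.2 (planeToComplex_ne_zero hu)
  have him := im_planeToComplex_div u w
  rcases lt_or_gt_of_ne h with h | h
  · right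
    refine ⟨h, ?_, neg_pi_lt_arg _⟩
    rw [dirAngle, arg_neg_iff, him]
    exact div_neg_of_neg_of_pos h hn
  · left
    have him' : 0 < (planeToComplex w / planeToComplex u).im := by
      rw [him]; exact div_pos h hn
    refine ⟨h, ?_, ?_⟩
    · refine lt_of_le_of_ne (arg_nonneg_iff.2 him'.le) fun hc => ?_
      have := (arg_eq_zero_iff.1 hc.symm).2
      exact him'.ne' this
    · rw [dirAngle, arg_lt_pi_iff]
      exact Or.inr him'.ne'

lemma coe_dirAngle {u w : Plane} (hu : u ≠ 0) (hw : w ≠ 0) :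
    (dirAngle u w : Real.Angle) =
      (arg (planeToComplex w) : Real.Angle) - (arg (planeToComplex u) : Real.Angle) :=
  arg_div_coe_angle (planeToComplex_ne_zero hw) (planeToComplex_ne_zero hu)

/-- The sign of the sum of angles detects the cyclic order. -/
lemma ccw_iff_dirAngle {Y u Z : Plane} (h1 : planeDet Y u ≠ 0) (h2 : planeDet u Z ≠ 0)
    (h3 : planeDet Z Y ≠ 0) :
    CCW Y u Z ↔ 0 < dirAngle (-u) Y + dirAngle Z (-u) := by
  have e1 : planeDet (-u) Y = planeDet Y u := by
    simp only [planeDet, Prod.fst_neg, Prod.snd_neg]; ring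
  have e2 : planeDet Z (-u) = planeDet u Z := by
    simp only [planeDet, Prod.fst_neg, Prod.snd_neg]; ring
  have hY : Y ≠ 0 := by rintro rfl; simp [planeDet] at h1
  have hZ : Z ≠ 0 := by rintro rfl; simp [planeDet] at h3
  have hu : -u ≠ 0 := by
    rw [neg_ne_zero]; rintro rfl; simp [planeDet] at h1
  have hsum : ((dirAngle (-u) Y + dirAngle Z (-u) : ℝ) : Real.Angle) = (dirAngle Z Y : ℝ) := by
    rw [Real.Angle.coe_add, coe_dirAngle hu hY, coe_dirAngle hZ hu, coe_dirAngle hZ hY]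
    abel
  obtain ⟨k, hk⟩ := Real.Angle.angle_eq_iff_two_pi_dvd_sub.1 hsum
  have t1 := dirAngle_trichotomy (e1.trans_ne h1)
  have t2 := dirAngle_trichotomy (e2.trans_ne h2)
  have t3 := dirAngle_trichotomy h3
  rw [e1] at t1
  rw [e2] at t2
  have hpi := Real.pi_pos
  have hk1 : k < 2 := by
    have : (k : ℝ) < 2 := by
      by_contra hc
      push Not at hc
      have : 2 * Real.pi * 2 ≤ 2 * Real.pi * k := by gcongr
      rcases t1 with t1 | t1 <;> rcases t2 with t2 | t2 <;> rcases t3 with t3 | t3 <;> linarith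
    exact_mod_cast this
  have hk2 : -2 < k := by
    have : (-2 : ℝ) < k := by
      by_contra hc
      push Not at hc
      have : 2 * Real.pi * k ≤ 2 * Real.pi * (-2) := by gcongr
      rcases t1 with t1 | t1 <;> rcases t2 with t2 | t2 <;> rcases t3 with t3 | t3 <;> linarith
    exact_mod_cast this
  unfold CCW
  have hk3 : k = -1 ∨ k = 0 ∨ k = 1 := by omega
  constructor
  · rintro (⟨g1, g2⟩ | ⟨g1, g2⟩ | ⟨g1, g2⟩) <;>
      rcases t1 with t1 | t1 <;> rcases t2 with t2 | t2 <;> rcases t3 with t3 | t3 <;>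
      rcases hk3 with rfl | rfl | rfl <;> push_cast at hk <;> linarith
  · intro g
    rcases t1 with t1 | t1 <;> rcases t2 with t2 | t2 <;> rcases t3 with t3 | t3 <;>
      first
      | exact Or.inl ⟨t1.1, t2.1⟩
      | exact Or.inr (Or.inl ⟨t2.1, t3.1⟩)
      | exact Or.inr (Or.inr ⟨t3.1, t1.1⟩)
      | (exfalso; rcases hk3 with rfl | rfl | rfl <;> push_cast at hk <;> linarith)

lemma continuousAt_dirAngle {u w : Plane} (h : u ≠ 0)
    (hs : ∀ r : ℝ, 0 ≤ r → w ≠ -(r • u)) :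
    ContinuousAt (fun x : Plane × Plane => dirAngle x.1 x.2) (u, w) := by
  unfold dirAngle
  have hu := planeToComplex_ne_zero h
  have hslit : planeToComplex w / planeToComplex u ∈ slitPlane := by
    rw [mem_slitPlane_iff_not_le_zero]
    intro hle
    rw [Complex.le_def] at hle
    set q := planeToComplex w / planeToComplex u with hq
    have hqr : q = ((q.re : ℝ) : ℂ) := Complex.ext rfl (by simpa using hle.2)
    have hqre : q.re ≤ 0 := by simpa using hle.1
    refine hs (-q.re) (by linarith) ?_
    have hw : planeToComplex w = (q.re : ℂ) * planeToComplex u := by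
      rw [← hqr, hq, div_mul_cancel₀ _ hu]
    have h1 := congrArg Complex.re hw
    have h2 := congrArg Complex.im hw
    simp only [planeToComplex, Complex.mul_re, Complex.mul_im, Complex.ofReal_re,
      Complex.ofReal_im] at h1 h2
    ext
    · simp; linarith
    · simp; linarith
  have hc : ContinuousAt (fun x : Plane × Plane => planeToComplex x.2 / planeToComplex x.1)
      (u, w) :=
    ContinuousAt.div (continuous_planeToComplex.comp continuous_snd).continuousAt
      (continuous_planeToComplex.comp continuous_fst).continuousAt hu
  exact ContinuousAt.comp (f := fun x : Plane × Plane => planeToComplex x.2 / planeToComplex x.1)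
    (continuousAt_arg hslit) hc

lemma continuousAt_viewAngle {u w p : Plane} (h : p ∉ segment ℝ u w) :
    ContinuousAt (fun p : Plane => dirAngle (u - p) (w - p)) p := by
  have hu : u - p ≠ 0 := by
    intro hc
    rw [sub_eq_zero.1 hc] at h
    exact h (left_mem_segment ℝ p w)
  have := continuousAt_dirAngle (w := w - p) hu (by
    intro r hr hc
    apply h
    have h1 : 0 < 1 + r := by linarith
    refine ⟨r / (1 + r), 1 / (1 + r), by positivity, by positivity, by field_simp; ring, ?_⟩
    have e1 := congrArg Prod.fst hc
    have e2 := congrArg Prod.snd hc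
    simp only [Prod.fst_sub, Prod.snd_sub, Prod.fst_neg, Prod.snd_neg, Prod.smul_fst,
      Prod.smul_snd, smul_eq_mul] at e1 e2
    ext
    · simp only [Prod.fst_add, Prod.smul_fst, smul_eq_mul]
      field_simp; linarith
    · simp only [Prod.snd_add, Prod.smul_snd, smul_eq_mul]
      field_simp; linarith)
  exact ContinuousAt.comp (f := fun p : Plane => (u - p, w - p)) this (by fun_prop)

/-- The total angle under which the closed polygonal line `a, q 0, …, q M, a` is seen
from `p`. -/
noncomputable def totalAngle (a : Plane) (q : ℕ → Plane) (M : ℕ) (p : Plane) : ℝ :=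
  dirAngle (a - p) (q 0 - p) +
    ∑ m ∈ Finset.range M, dirAngle (q m - p) (q (m + 1) - p) + dirAngle (q M - p) (a - p)

/-- The total angle is constant along segments that avoid the closed polygonal line. -/
lemma totalAngle_eq_of_segment {a : Plane} {q : ℕ → Plane} {M : ℕ} {p₁ p₂ : Plane}
    (h0 : Disjoint (segment ℝ p₁ p₂) (segment ℝ a (q 0)))
    (hm : ∀ m < M, Disjoint (segment ℝ p₁ p₂) (segment ℝ (q m) (q (m + 1))))
    (hM : Disjoint (segment ℝ p₁ p₂) (segment ℝ (q M) a)) :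
    totalAngle a q M p₁ = totalAngle a q M p₂ := by
  have hq : ∀ p ∈ segment ℝ p₁ p₂, ∀ m ≤ M, q m - p ≠ 0 := by
    intro p hp m hmM hc
    rw [sub_eq_zero] at hc
    rcases hmM.lt_or_eq with hlt | rfl
    · exact Set.disjoint_left.1 (hm m hlt) hp (hc ▸ left_mem_segment ℝ _ _)
    · exact Set.disjoint_left.1 hM hp (hc ▸ left_mem_segment ℝ _ _)
  have ha : ∀ p ∈ segment ℝ p₁ p₂, a - p ≠ 0 := by
    intro p hp hc
    rw [sub_eq_zero] at hc
    exact Set.disjoint_left.1 h0 hp (hc ▸ left_mem_segment ℝ _ _)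
  have hzero : ∀ p ∈ segment ℝ p₁ p₂, ∃ k : ℤ, totalAngle a q M p = 2 * Real.pi * k := by
    intro p hp
    have hpart : ∀ N ≤ M, ((∑ m ∈ Finset.range N, dirAngle (q m - p) (q (m + 1) - p) : ℝ) :
        Real.Angle) = (arg (planeToComplex (q N - p)) : Real.Angle) -
          (arg (planeToComplex (q 0 - p)) : Real.Angle) := by
      intro N
      induction N with
      | zero => intro _; simp
      | succ N ih =>
        intro hN
        rw [Finset.sum_range_succ, Real.Angle.coe_add, ih (by omega),
          coe_dirAngle (hq p hp N (by omega)) (hq p hp (N + 1) hN)]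
        abel
    have : (totalAngle a q M p : Real.Angle) = ((0 : ℝ) : Real.Angle) := by
      unfold totalAngle
      rw [Real.Angle.coe_add, Real.Angle.coe_add, hpart M le_rfl,
        coe_dirAngle (ha p hp) (hq p hp 0 (by omega)), coe_dirAngle (hq p hp M le_rfl) (ha p hp),
        Real.Angle.coe_zero]
      abel
    obtain ⟨k, hk⟩ := Real.Angle.angle_eq_iff_two_pi_dvd_sub.1 this
    exact ⟨k, by simpa using hk⟩
  have hcont : ContinuousOn (totalAngle a q M) (segment ℝ p₁ p₂) := by
    intro p hp
    apply ContinuousAt.continuousWithinAt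
    unfold totalAngle
    refine ((continuousAt_viewAngle (Set.disjoint_left.1 h0 hp)).add ?_).add
      (continuousAt_viewAngle (Set.disjoint_left.1 hM hp))
    refine tendsto_finsetSum _ fun m hmm => ?_
    exact continuousAt_viewAngle (Set.disjoint_left.1 (hm m (Finset.mem_range.1 hmm)) hp)
  have hpi := Real.pi_pos
  have hconn : IsPreconnected (segment ℝ p₁ p₂) := (convex_segment p₁ p₂).isPreconnected
  have := IsPreconnected.constant_of_mapsTo (T := Set.range ((↑) : ℤ → ℝ)) hconn
    Int.isClosedEmbedding_coe_real.isInducing.isDiscrete_range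
    (hcont.div_const (2 * Real.pi)) (by
      intro p hp
      obtain ⟨k, hk⟩ := hzero p hp
      refine ⟨k, ?_⟩
      simp only
      rw [hk]
      field_simp) (left_mem_segment ℝ p₁ p₂) (right_mem_segment ℝ p₁ p₂)
  field_simp at this
  exact this

/-- The limit of the total angle when approaching the vertex `a` from the direction `d`. -/
lemma tendsto_totalAngle {a d : Plane} {q : ℕ → Plane} {M : ℕ}
    (hm : ∀ m < M, a ∉ segment ℝ (q m) (q (m + 1)))
    (h0 : planeDet (q 0 - a) d ≠ 0) (hM : planeDet d (q M - a) ≠ 0) :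
    Tendsto (fun t : ℝ => totalAngle a q M (a + t • d)) (𝓝[>] 0)
      (𝓝 (dirAngle (-d) (q 0 - a) +
        ∑ m ∈ Finset.range M, dirAngle (q m - a) (q (m + 1) - a) + dirAngle (q M - a) (-d))) := by
  have hd : -d ≠ 0 := by
    rw [neg_ne_zero]; rintro rfl; simp [planeDet] at h0
  have hqM : q M - a ≠ 0 := by
    intro hc; rw [hc] at hM; simp [planeDet] at hM
  have hlin : ∀ x : Plane, Tendsto (fun t : ℝ => x - (a + t • d)) (𝓝[>] 0) (𝓝 (x - a)) := by
    intro x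
    have : Tendsto (fun t : ℝ => x - (a + t • d)) (𝓝 0) (𝓝 (x - (a + (0 : ℝ) • d))) :=
      Continuous.tendsto (by fun_prop) 0
    rw [zero_smul, add_zero] at this
    exact this.mono_left nhdsWithin_le_nhds
  have hneg : ∀ t : ℝ, a - (a + t • d) = t • (-d) := fun t => by rw [smul_neg]; abel
  unfold totalAngle
  refine (Tendsto.add ?_ ?_).add ?_
  · have hc := continuousAt_dirAngle (w := q 0 - a) hd (by
      intro r _ hc
      rw [hc] at h0
      apply h0
      simp only [planeDet, Prod.fst_neg, Prod.snd_neg, Prod.smul_fst, Prod.smul_snd, smul_eq_mul]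
      ring)
    have := hc.tendsto.comp ((tendsto_const_nhds (x := -d)).prodMk_nhds (hlin (q 0)))
    refine this.congr' ?_
    filter_upwards [self_mem_nhdsWithin] with t (ht : 0 < t)
    simp only [Function.comp]
    rw [hneg, dirAngle_smul_left ht]
  · refine tendsto_finsetSum _ fun m hmm => ?_
    have hc := (continuousAt_viewAngle (hm m (Finset.mem_range.1 hmm))).tendsto
    refine hc.comp ?_
    have : Tendsto (fun t : ℝ => a + t • d) (𝓝 0) (𝓝 (a + (0 : ℝ) • d)) :=
      Continuous.tendsto (by fun_prop) 0
    rw [zero_smul, add_zero] at this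
    exact this.mono_left nhdsWithin_le_nhds
  · have hc := continuousAt_dirAngle (w := -d) hqM (by
      intro r _ hc
      apply hM
      rw [neg_inj.1 hc]
      simp only [planeDet, Prod.smul_fst, Prod.smul_snd, smul_eq_mul]
      ring)
    have := hc.tendsto.comp ((hlin (q M)).prodMk_nhds (tendsto_const_nhds (x := -d)))
    refine this.congr' ?_
    filter_upwards [self_mem_nhdsWithin] with t (ht : 0 < t)
    simp only [Function.comp]
    rw [hneg, dirAngle_smul_right ht]

end Winding

/-- A simple polygon in general position, with its vertices listed along the natural numbers
`0, …, n` so that the last one is equal to the first one. -/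
structure CyclicPolygon (n : ℕ) where
  three_le : 3 ≤ n
  u : ℕ → Plane
  P : Set Plane
  compact : IsCompact P
  regular : P = closure (interior P)
  closing : u n = u 0
  mem_frontier_iff : ∀ x, x ∈ frontier P ↔ ∃ m < n, x ∈ segment ℝ (u m) (u (m + 1))
  det_ne_zero : ∀ l m k, l < n → m < n → k < n → l ≠ m → l ≠ k → m ≠ k →
    planeDet (u m - u l) (u k - u l) ≠ 0
  meet : ∀ e f, e < f → f < n → ∀ x ∈ segment ℝ (u e) (u (e + 1)),
    x ∈ segment ℝ (u f) (u (f + 1)) → (f = e + 1 ∧ x = u f) ∨ (e = 0 ∧ f + 1 = n ∧ x = u 0)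

lemma exists_smul_of_mem_segment {p q x : Plane} (h : x ∈ segment ℝ p q) :
    ∃ s : ℝ, 0 ≤ s ∧ s ≤ 1 ∧ x = p + s • (q - p) := by
  rw [segment_eq_image'] at h
  obtain ⟨s, ⟨h0, h1⟩, rfl⟩ := h
  exact ⟨s, h0, h1, rfl⟩

lemma mem_segment_of_smul {p q : Plane} {s : ℝ} (h0 : 0 ≤ s) (h1 : s ≤ 1) :
    p + s • (q - p) ∈ segment ℝ p q := by
  rw [segment_eq_image']
  exact ⟨s, ⟨h0, h1⟩, rfl⟩

namespace CyclicPolygon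

variable {n : ℕ} (N : CyclicPolygon n)

/-- The edge from vertex `f` to vertex `f + 1`. -/
def edge (f : ℕ) : Set Plane := segment ℝ (N.u f) (N.u (f + 1))

/-- The vector from vertex `0` to vertex `m`. -/
def dir (m : ℕ) : Plane := N.u m - N.u 0

/-- The points close to vertex `0` in direction `d` are interior points of the polygon. -/
def Inward (d : Plane) : Prop :=
  ∃ δ > (0 : ℝ), ∀ t : ℝ, 0 < t → t < δ → N.u 0 + t • d ∈ interior N.P

lemma isClosed : IsClosed N.P := N.compact.isClosed

lemma edge_subset_frontier {f : ℕ} (hf : f < n) : N.edge f ⊆ frontier N.P :=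
  fun x hx => (N.mem_frontier_iff x).2 ⟨f, hf, hx⟩

lemma edge_subset {f : ℕ} (hf : f < n) : N.edge f ⊆ N.P :=
  (N.edge_subset_frontier hf).trans N.isClosed.frontier_subset

lemma not_mem_frontier_of_interior {x : Plane} (h : x ∈ interior N.P) : x ∉ frontier N.P := by
  rw [N.isClosed.frontier_eq]
  exact fun h' => h'.2 h

lemma vertex_mem {m : ℕ} (hm : m < n) : N.u m ∈ N.P :=
  N.edge_subset hm (left_mem_segment ℝ _ _)

lemma zero_lt (N : CyclicPolygon n) : 0 < n := by
  have := N.three_le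
  omega

lemma u_add_dir (m : ℕ) : N.u 0 + N.dir m = N.u m := by simp [dir]

lemma dir_det_ne_zero {m k : ℕ} (hm : 1 ≤ m) (hmn : m < n) (hk : 1 ≤ k) (hkn : k < n)
    (hmk : m ≠ k) : planeDet (N.dir m) (N.dir k) ≠ 0 :=
  N.det_ne_zero 0 m k N.zero_lt hmn hkn (by omega) (by omega) hmk

lemma exists_succ_index {f : ℕ} (hf : f < n) :
    ∃ g < n, N.u (f + 1) = N.u g ∧ g ≠ f ∧ (g = f + 1 ∨ (g = 0 ∧ f + 1 = n)) := by
  have := N.three_le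
  rcases Nat.lt_or_ge (f + 1) n with h | h
  · exact ⟨f + 1, h, rfl, by omega, Or.inl rfl⟩
  · have h' : f + 1 = n := by omega
    exact ⟨0, by omega, by rw [h', N.closing], by omega, Or.inr ⟨rfl, h'⟩⟩

lemma index_of_vertex_mem_edge {m f : ℕ} (hm : m < n) (hf : f < n) (h : N.u m ∈ N.edge f) :
    m = f ∨ m = f + 1 ∨ (m = 0 ∧ f + 1 = n) := by
  obtain ⟨g, hg, hug, hgf, hg'⟩ := N.exists_succ_index hf
  by_contra hc
  push Not at hc
  obtain ⟨s, _, _, hs⟩ := exists_smul_of_mem_segment h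
  have hmg : m ≠ g := by
    rintro rfl
    rcases hg' with h' | h'
    · exact hc.2.1 h'
    · exact hc.2.2 h'.1 h'.2
  apply N.det_ne_zero m f g hm hf hg hc.1 hmg hgf.symm
  rw [hug] at hs
  rw [hs]
  simp only [planeDet, Prod.fst_add, Prod.snd_add, Prod.fst_sub, Prod.snd_sub, Prod.smul_fst,
    Prod.smul_snd, smul_eq_mul]
  ring

lemma eq_vertex_of_mem_edges {e f : ℕ} (he : e < n) (hf : f < n) (hef : e ≠ f) {x : Plane}
    (hxe : x ∈ N.edge e) (hxf : x ∈ N.edge f) : x = N.u f ∨ x = N.u (f + 1) := by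
  rcases Nat.lt_or_gt_of_ne hef with h | h
  · rcases N.meet e f h hf x hxe hxf with ⟨_, h2⟩ | ⟨_, h2, h3⟩
    · exact Or.inl h2
    · right; rw [h3, h2, N.closing]
  · rcases N.meet f e h he x hxf hxe with ⟨h1, h2⟩ | ⟨h1, _, h3⟩
    · right; rw [h2, h1]
    · left; rw [h3, h1]

lemma subset_interior_of_disjoint_frontier {S : Set Plane} (hS : IsPreconnected S)
    (hd : ∀ x ∈ S, x ∉ frontier N.P) {x : Plane} (hxS : x ∈ S) (hxP : x ∈ N.P) :
    S ⊆ interior N.P := by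
  have hint : ∀ y ∈ S, y ∈ N.P → y ∈ interior N.P := by
    intro y hy hyP
    by_contra hc
    apply hd y hy
    rw [N.isClosed.frontier_eq]
    exact ⟨hyP, hc⟩
  refine hS.subset_left_of_subset_union isOpen_interior N.isClosed.isOpen_compl
    (disjoint_compl_right.mono_left interior_subset) ?_ ⟨x, hxS, hint x hxS hxP⟩
  intro y hy
  by_cases hyP : y ∈ N.P
  · exact Or.inl (hint y hy hyP)
  · exact Or.inr hyP

lemma exists_ball_avoiding (y : Plane) :
    ∃ δ > (0 : ℝ), ∀ x ∈ Metric.ball y δ, ∀ f < n, y ∉ N.edge f → x ∉ N.edge f := by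
  have hcl : ∀ f, IsClosed (N.edge f) := fun f => by
    unfold edge
    rw [segment_eq_image']
    exact (isCompact_Icc.image (by fun_prop)).isClosed
  have : ∀ᶠ x in nhds y, ∀ f ∈ Finset.range n, y ∉ N.edge f → x ∉ N.edge f := by
    rw [Filter.eventually_all_finset]
    intro f _
    by_cases hy : y ∈ N.edge f
    · exact Filter.Eventually.of_forall fun x h => absurd hy h
    · filter_upwards [(hcl f).isOpen_compl.mem_nhds hy] with x hx _
      exact hx
  obtain ⟨δ, hδ, h⟩ := Metric.eventually_nhds_iff_ball.1 this
  exact ⟨δ, hδ, fun x hx f hf => h x hx f (Finset.mem_range.2 hf)⟩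

lemma eventually_mem_ball (a d : Plane) {δ : ℝ} (hδ : 0 < δ) :
    ∃ ε > (0 : ℝ), ∀ t : ℝ, |t| < ε → a + t • d ∈ Metric.ball a δ := by
  have hlim : Filter.Tendsto (fun t : ℝ => a + t • d) (nhds 0) (nhds (a + (0 : ℝ) • d)) :=
    Continuous.tendsto (by fun_prop) 0
  rw [zero_smul, add_zero] at hlim
  obtain ⟨ε, hε, h⟩ := Metric.eventually_nhds_iff.1
    (hlim.eventually (Metric.ball_mem_nhds a hδ))
  exact ⟨ε, hε, fun t ht => h (by simpa using ht)⟩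

/-- A segment crossing an edge transversally leaves the polygon. -/
lemma not_crossing {f : ℕ} (hf : f < n) {y W : Plane} (hy : y ∈ N.edge f) (hyf : y ≠ N.u f)
    (hyf' : y ≠ N.u (f + 1)) (hW : planeDet (N.u (f + 1) - N.u f) W ≠ 0) {ε : ℝ} (hε : 0 < ε)
    (hP : ∀ t : ℝ, |t| < ε → y + t • W ∈ N.P) : False := by
  obtain ⟨δ, hδ, hball⟩ := N.exists_ball_avoiding y
  set E := N.u (f + 1) - N.u f with hE
  have hfr : ∀ x ∈ Metric.ball y δ, x ∈ frontier N.P → planeDet E (x - y) = 0 := by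
    intro x hx hxf
    obtain ⟨e, he, hxe⟩ := (N.mem_frontier_iff x).1 hxf
    have : e = f := by
      by_contra hne
      refine hball x hx e he (fun hye => ?_) hxe
      rcases N.eq_vertex_of_mem_edges he hf hne hye hy with h | h
      · exact hyf h
      · exact hyf' h
    subst this
    obtain ⟨s, _, _, rfl⟩ := exists_smul_of_mem_segment hxe
    obtain ⟨r, _, _, rfl⟩ := exists_smul_of_mem_segment hy
    simp only [hE, planeDet, Prod.fst_add, Prod.snd_add, Prod.fst_sub, Prod.snd_sub, Prod.smul_fst,
      Prod.smul_snd, smul_eq_mul]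
    ring
  have hE0 : E ≠ 0 := by intro h; rw [h] at hW; simp [planeDet] at hW
  obtain ⟨η, hη, hηb⟩ := eventually_mem_ball y W hδ
  have hside : ∀ F : Plane, planeDet F W ≠ 0 → (∀ x : Plane, planeDet E x = 0 → planeDet F x = 0) →
      Metric.ball y δ ∩ {x | 0 < planeDet F (x - y)} ⊆ interior N.P := by
    intro F hF hEF
    set t := (min ε η / 2) * SignType.sign (planeDet F W) with ht
    have hm : 0 < min ε η / 2 := by positivity
    have habs : |t| = min ε η / 2 := by
      rcases lt_or_gt_of_ne hF with h | h
      · rw [ht, sign_neg h]; simp only [SignType.coe_neg, SignType.coe_one, mul_neg, mul_one,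
          abs_neg]; exact abs_of_pos hm
      · rw [ht, sign_pos h]; simp only [SignType.coe_one, mul_one]; exact abs_of_pos hm
    have hlt : min ε η / 2 < min ε η := by linarith
    refine N.subset_interior_of_disjoint_frontier (x := y + t • W)
      ((convex_ball y δ).inter (convex_planeDet_pos F y)).isPreconnected ?_ ⟨?_, ?_⟩ ?_
    · rintro x ⟨hx1, hx2⟩ hx3
      exact (ne_of_gt hx2) (hEF _ (hfr x hx1 hx3))
    · exact hηb t (by rw [habs]; exact hlt.trans_le (min_le_right _ _))
    · rw [Set.mem_ofPred_eq, add_sub_cancel_left, planeDet_smul_right, ht, mul_assoc]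
      refine mul_pos hm ?_
      rcases lt_or_gt_of_ne hF with h | h
      · rw [sign_neg h]; simpa using h
      · rw [sign_pos h]; simpa using h
    · exact hP t (by rw [habs]; exact hlt.trans_le (min_le_left _ _))
  have hneg : ∀ x : Plane, planeDet (-E) x = -planeDet E x := fun x => by
    simp only [planeDet, Prod.fst_neg, Prod.snd_neg]; ring
  have h1 := hside E hW fun x hx => hx
  have h2 := hside (-E) (by rw [hneg]; exact neg_ne_zero.2 hW) fun x hx => by
    rw [hneg, hx, neg_zero]
  have hsub : Metric.ball y δ ∩ {x : Plane | planeDet E (x - y) ≠ 0} ⊆ N.P := by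
    rintro x ⟨hx1, hx2⟩
    rcases lt_or_gt_of_ne hx2 with h | h
    · exact interior_subset (h2 ⟨hx1, by rw [Set.mem_ofPred_eq, hneg]; linarith⟩)
    · exact interior_subset (h1 ⟨hx1, h⟩)
  have hall : Metric.ball y δ ⊆ N.P :=
    ((dense_planeDet_ne_zero hE0 y).open_subset_closure_inter Metric.isOpen_ball).trans
      (N.isClosed.closure_subset_iff.2 hsub)
  have hyint : y ∈ interior N.P :=
    interior_maximal hall Metric.isOpen_ball (Metric.mem_ball_self hδ)
  exact N.not_mem_frontier_of_interior hyint (N.edge_subset_frontier hf hy)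

/-- An open segment from vertex `0` to a visible vertex meets no edge that avoids vertex `0`. -/
lemma open_segment_avoids_edge {w f : ℕ} (hw : 1 ≤ w) (hwn : w < n)
    (hvis : Visible N.P (N.u 0) (N.u w)) (hf : 1 ≤ f) (hfn : f + 1 < n) {t : ℝ} (ht0 : 0 < t)
    (ht1 : t < 1) : N.u 0 + t • N.dir w ∉ N.edge f := by
  intro hy
  have hn := N.three_le
  set y := N.u 0 + t • N.dir w with hydef
  have hdir : N.dir w ≠ 0 := by
    obtain ⟨k, hk1, hkn, hkw⟩ : ∃ k, 1 ≤ k ∧ k < n ∧ k ≠ w := by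
      by_cases h : w = 1
      · exact ⟨2, by omega, by omega, by omega⟩
      · exact ⟨1, by omega, by omega, by omega⟩
    intro h
    have := N.dir_det_ne_zero hw hwn hk1 hkn hkw.symm
    rw [h] at this
    simp [planeDet] at this
  have hkey : ∀ m, 1 ≤ m → m < n → y ≠ N.u m := by
    intro m hm hmn hc
    by_cases hmw : m = w
    · subst hmw
      rw [hydef, ← N.u_add_dir m, add_right_inj] at hc
      have : (t - 1) • N.dir m = 0 := by rw [sub_smul, hc, one_smul, sub_self]
      rcases smul_eq_zero.1 this with h | h
      · linarith
      · exact hdir h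
    · apply N.dir_det_ne_zero hw hwn hm hmn (Ne.symm hmw)
      have : N.dir m = t • N.dir w := by rw [dir, ← hc, hydef, add_sub_cancel_left]
      rw [this, planeDet_smul_right, planeDet_self, mul_zero]
  have hmemP : ∀ s : ℝ, 0 ≤ s → s ≤ 1 → N.u 0 + s • N.dir w ∈ N.P := fun s h0 h1 =>
    hvis (mem_segment_of_smul h0 h1)
  obtain ⟨s, hs0, hs1, hs⟩ := exists_smul_of_mem_segment hy
  have hrel : (1 - s) * planeDet (N.dir w) (N.dir f) + s * planeDet (N.dir w) (N.dir (f + 1)) =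
      0 := by
    have : planeDet (N.dir w) (y - N.u 0) = 0 := by
      rw [hydef, add_sub_cancel_left, planeDet_smul_right, planeDet_self, mul_zero]
    rw [hs] at this
    rw [← this]
    simp only [dir, planeDet, Prod.fst_add, Prod.snd_add, Prod.fst_sub, Prod.snd_sub, Prod.smul_fst,
      Prod.smul_snd, smul_eq_mul]
    ring
  have hs0' : s ≠ 0 := by
    rintro rfl
    apply hkey f hf (by omega)
    rw [hs]; simp
  have hs1' : 1 - s ≠ 0 := by
    intro h
    obtain rfl : s = 1 := by linarith
    apply hkey (f + 1) (by omega) hfn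
    rw [hs]; simp
  have hslope : planeDet (N.u (f + 1) - N.u f) (N.dir w) ≠ 0 := by
    have e : planeDet (N.u (f + 1) - N.u f) (N.dir w) =
        planeDet (N.dir w) (N.dir f) - planeDet (N.dir w) (N.dir (f + 1)) := by
      simp only [dir, planeDet, Prod.fst_sub, Prod.snd_sub]
      ring
    rw [e]
    intro h
    have e2 : planeDet (N.dir w) (N.dir f) = 0 := by linear_combination hrel + s * h
    have e3 : planeDet (N.dir w) (N.dir (f + 1)) = 0 := by linear_combination e2 - h
    by_cases hwf : w = f
    · exact N.dir_det_ne_zero hw hwn (by omega) hfn (by omega) e3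
    · exact N.dir_det_ne_zero hw hwn hf (by omega) hwf e2
  refine N.not_crossing (by omega) hy (hkey f hf (by omega)) (hkey (f + 1) (by omega) hfn) hslope
    (ε := min t (1 - t)) (lt_min ht0 (by linarith)) ?_
  intro r hr
  rw [abs_lt] at hr
  have h1 := min_le_left t (1 - t)
  have h2 := min_le_right t (1 - t)
  rw [hydef, add_assoc, ← add_smul]
  exact hmemP _ (by linarith) (by linarith)

lemma index_of_inward_mem_edge {d : Plane} (hd : N.Inward d) {t : ℝ} (ht : 0 < t) {f : ℕ}
    (hf : f < n) (h : N.u 0 + t • d ∈ N.edge f) : 1 ≤ f ∧ f + 1 < n := by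
  obtain ⟨δ, hδ, hint⟩ := hd
  have hcon : N.u 0 ∉ N.edge f := by
    intro h0
    set r := min (δ / 2) t with hr
    have hr0 : 0 < r := lt_min (by linarith) ht
    have hrδ : r < δ := (min_le_left _ _).trans_lt (by linarith)
    have hrt : r / t ≤ 1 := (div_le_one ht).2 (min_le_right _ _)
    refine N.not_mem_frontier_of_interior (hint r hr0 hrδ) (N.edge_subset_frontier hf ?_)
    have hconv : Convex ℝ (N.edge f) := convex_segment _ _
    have := hconv h0 h (a := 1 - r / t) (b := r / t) (by linarith) (by positivity) (by ring)
    convert this using 1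
    have : r / t * t = r := by field_simp
    rw [smul_add, smul_smul, this]
    module
  constructor
  · by_contra hc
    obtain rfl : f = 0 := by omega
    exact hcon (left_mem_segment ℝ _ _)
  · by_contra hc
    have : f + 1 = n := by omega
    apply hcon
    rw [edge, this, N.closing]
    exact right_mem_segment ℝ _ _

/-- If a segment from vertex `0` starts in the interior and does not stay in the polygon, then
it crosses an edge avoiding vertex `0`. -/
lemma exists_blocking_edge {d : Plane} (hd : N.Inward d)
    (h : ¬ Visible N.P (N.u 0) (N.u 0 + d)) :
    ∃ t : ℝ, 0 < t ∧ t < 1 ∧ ∃ f, 1 ≤ f ∧ f + 1 < n ∧ N.u 0 + t • d ∈ N.edge f := by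
  by_contra hc
  push Not at hc
  apply h
  set S := (fun t : ℝ => N.u 0 + t • d) '' Set.Ioo 0 1 with hS
  have hfr : ∀ x ∈ S, x ∉ frontier N.P := by
    rintro _ ⟨t, ⟨ht0, ht1⟩, rfl⟩ hx
    obtain ⟨f, hf, hxf⟩ := (N.mem_frontier_iff _).1 hx
    obtain ⟨h1, h2⟩ := N.index_of_inward_mem_edge hd ht0 hf hxf
    exact hc t ht0 ht1 f h1 h2 hxf
  have hconn : IsPreconnected S := isPreconnected_Ioo.image _ (by fun_prop)
  obtain ⟨δ, hδ, hint⟩ := hd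
  have hr : 0 < min δ 1 / 2 := by positivity
  have h1 := min_le_left δ 1
  have h2 := min_le_right δ 1
  have hsub := N.subset_interior_of_disjoint_frontier hconn hfr
    (x := N.u 0 + (min δ 1 / 2) • d) ⟨min δ 1 / 2, ⟨hr, by linarith⟩, rfl⟩
    (interior_subset (hint _ hr (by linarith)))
  have hcl : (fun t : ℝ => N.u 0 + t • d) '' closure (Set.Ioo 0 1) ⊆ closure S :=
    image_closure_subset_closure_image (by fun_prop)
  rw [closure_Ioo (by norm_num)] at hcl
  intro x hx
  obtain ⟨s, hs0, hs1, rfl⟩ := exists_smul_of_mem_segment hx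
  rw [add_sub_cancel_left]
  exact N.isClosed.closure_subset_iff.2 (hsub.trans interior_subset) (hcl ⟨s, ⟨hs0, hs1⟩, rfl⟩)

/-- One of the two sectors at vertex `0` consists of inward directions, the other one
of outward directions. -/
lemma sector_dichotomy :
    ((∀ d, CCW (N.dir 1) d (N.dir (n - 1)) → N.Inward d) ∧
      ∀ d, CCW (N.dir (n - 1)) d (N.dir 1) → ∃ δ > (0 : ℝ), ∀ t : ℝ, 0 < t → t < δ →
        N.u 0 + t • d ∉ N.P) ∨
    ((∀ d, CCW (N.dir (n - 1)) d (N.dir 1) → N.Inward d) ∧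
      ∀ d, CCW (N.dir 1) d (N.dir (n - 1)) → ∃ δ > (0 : ℝ), ∀ t : ℝ, 0 < t → t < δ →
        N.u 0 + t • d ∉ N.P) := by
  have hn := N.three_le
  obtain ⟨δ, hδ, hball⟩ := N.exists_ball_avoiding (N.u 0)
  set Y := N.dir 1 with hY
  set Z := N.dir (n - 1) with hZ
  have hYZ : planeDet Y Z ≠ 0 :=
    N.dir_det_ne_zero le_rfl (by omega) (by omega) (by omega) (by omega)
  have hZY : planeDet Z Y ≠ 0 := by rw [planeDet_swap]; exact neg_ne_zero.2 hYZ
  have hfr : ∀ x ∈ Metric.ball (N.u 0) δ, x ∈ frontier N.P →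
      ∃ s : ℝ, 0 ≤ s ∧ (x - N.u 0 = s • Y ∨ x - N.u 0 = s • Z) := by
    intro x hx hxf
    obtain ⟨e, he, hxe⟩ := (N.mem_frontier_iff x).1 hxf
    have h0e : N.u 0 ∈ N.edge e := by
      by_contra hc
      exact hball x hx e he hc hxe
    rcases N.index_of_vertex_mem_edge N.zero_lt he h0e with h | h | ⟨_, h⟩
    · subst h
      obtain ⟨s, hs0, _, rfl⟩ := exists_smul_of_mem_segment hxe
      exact ⟨s, hs0, Or.inl (by simp [hY, dir])⟩
    · omega
    · rw [h, N.closing, segment_symm] at hxe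
      obtain ⟨s, hs0, _, rfl⟩ := exists_smul_of_mem_segment hxe
      obtain rfl : e = n - 1 := by omega
      exact ⟨s, hs0, Or.inr (by simp [hZ, dir])⟩
  have hnot : ∀ (A B : Plane) (s : ℝ), 0 ≤ s → ¬ CCW A (s • A) B := by
    intro A B s hs h
    have e1 : planeDet A (s • A) = 0 := by rw [planeDet_smul_right, planeDet_self, mul_zero]
    have e2 : planeDet (s • A) B = -s * planeDet B A := by
      rw [planeDet_swap, planeDet_smul_right, neg_mul]
    unfold CCW at h
    rw [e1, e2] at h
    rcases h with h | h | h
    · linarith [h.1]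
    · nlinarith [h.1, h.2, mul_nonneg hs h.2.le]
    · linarith [h.2]
  have hnot' : ∀ (A B : Plane) (s : ℝ), 0 ≤ s → ¬ CCW A (s • B) B := by
    intro A B s hs h
    have e1 : planeDet (s • B) B = 0 := by
      rw [planeDet_swap, planeDet_smul_right, planeDet_self, mul_zero, neg_zero]
    have e2 : planeDet A (s • B) = -s * planeDet B A := by
      rw [planeDet_smul_right, planeDet_swap A B]; ring
    unfold CCW at h
    rw [e1, e2] at h
    rcases h with h | h | h
    · linarith [h.2]
    · linarith [h.1]
    · nlinarith [h.1, h.2, mul_nonneg hs h.1.le]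
  have hs1 := isPreconnected_ccw_ball (N.u 0) Y Z hYZ hδ
  have hs2 := isPreconnected_ccw_ball (N.u 0) Z Y hZY hδ
  set S1 := {x | x ∈ Metric.ball (N.u 0) δ ∧ CCW Y (x - N.u 0) Z} with hS1
  set S2 := {x | x ∈ Metric.ball (N.u 0) δ ∧ CCW Z (x - N.u 0) Y} with hS2
  have hd1 : ∀ x ∈ S1, x ∉ frontier N.P := by
    rintro x ⟨hx1, hx2⟩ hx3
    obtain ⟨s, hs, h | h⟩ := hfr x hx1 hx3
    · exact hnot Y Z s hs (h ▸ hx2)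
    · exact hnot' Y Z s hs (h ▸ hx2)
  have hd2 : ∀ x ∈ S2, x ∉ frontier N.P := by
    rintro x ⟨hx1, hx2⟩ hx3
    obtain ⟨s, hs, h | h⟩ := hfr x hx1 hx3
    · exact hnot' Z Y s hs (h ▸ hx2)
    · exact hnot Z Y s hs (h ▸ hx2)
  set G : Set Plane := {x | planeDet Y (x - N.u 0) ≠ 0} ∩ {x | planeDet Z (x - N.u 0) ≠ 0} with hG
  have hGdense : Dense G := by
    refine (dense_planeDet_ne_zero ?_ _).inter_of_isOpen_left (dense_planeDet_ne_zero ?_ _)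
      (isOpen_ne_fun (continuous_planeDet_sub _ _) continuous_const)
    · intro h; rw [h] at hYZ; simp [planeDet] at hYZ
    · intro h; rw [h] at hYZ; simp [planeDet] at hYZ
  have hcover : ∀ x ∈ Metric.ball (N.u 0) δ, x ∈ G → x ∈ S1 ∨ x ∈ S2 := by
    rintro x hx ⟨h1, h2⟩
    have h2' : planeDet (x - N.u 0) Z ≠ 0 := by rw [planeDet_swap]; exact neg_ne_zero.2 h2
    rcases CCW.total h1 h2' hZY with h | h
    · exact Or.inl ⟨hx, h⟩
    · exact Or.inr ⟨hx, h.rotate⟩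
  have hray : ∀ (A B d : Plane), CCW A d B → ∃ ε > (0 : ℝ), ∀ t : ℝ, 0 < t → t < ε →
      N.u 0 + t • d ∈ Metric.ball (N.u 0) δ ∧ CCW A (N.u 0 + t • d - N.u 0) B := by
    intro A B d h
    obtain ⟨ε, hε, hb⟩ := eventually_mem_ball (N.u 0) d hδ
    refine ⟨ε, hε, fun t h0 ht => ⟨hb t (by rwa [abs_of_pos h0]), ?_⟩⟩
    rw [add_sub_cancel_left]
    exact h.smul h0
  have hin : ∀ S : Set Plane, IsPreconnected S → (∀ x ∈ S, x ∉ frontier N.P) →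
      S ⊆ interior N.P ∨ ∀ x ∈ S, x ∉ N.P := by
    intro S hS hd
    by_cases h : ∃ x ∈ S, x ∈ N.P
    · obtain ⟨x, hx, hxP⟩ := h
      exact Or.inl (N.subset_interior_of_disjoint_frontier hS hd hx hxP)
    · push Not at h
      exact Or.inr h
  have h0fr : N.u 0 ∈ frontier N.P :=
    N.edge_subset_frontier N.zero_lt (left_mem_segment ℝ _ _)
  rcases hin S1 hs1 hd1 with g1 | g1 <;> rcases hin S2 hs2 hd2 with g2 | g2
  · exfalso
    have hall : Metric.ball (N.u 0) δ ⊆ N.P := by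
      refine (hGdense.open_subset_closure_inter Metric.isOpen_ball).trans
        (N.isClosed.closure_subset_iff.2 ?_)
      rintro x ⟨hx1, hx2⟩
      rcases hcover x hx1 hx2 with h | h
      · exact interior_subset (g1 h)
      · exact interior_subset (g2 h)
    exact N.not_mem_frontier_of_interior
      (interior_maximal hall Metric.isOpen_ball (Metric.mem_ball_self hδ)) h0fr
  · left
    refine ⟨fun d hd => ?_, fun d hd => ?_⟩
    · obtain ⟨ε, hε, h⟩ := hray Y Z d hd
      exact ⟨ε, hε, fun t h0 h1 => g1 (h t h0 h1)⟩
    · obtain ⟨ε, hε, h⟩ := hray Z Y d hd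
      exact ⟨ε, hε, fun t h0 h1 => g2 _ (h t h0 h1)⟩
  · right
    refine ⟨fun d hd => ?_, fun d hd => ?_⟩
    · obtain ⟨ε, hε, h⟩ := hray Z Y d hd
      exact ⟨ε, hε, fun t h0 h1 => g2 (h t h0 h1)⟩
    · obtain ⟨ε, hε, h⟩ := hray Y Z d hd
      exact ⟨ε, hε, fun t h0 h1 => g1 _ (h t h0 h1)⟩
  · exfalso
    have h0 : N.u 0 ∈ closure (interior N.P) := by
      rw [← N.regular]
      exact N.vertex_mem N.zero_lt
    obtain ⟨x, hx1, hx2⟩ := mem_closure_iff.1 h0 _ Metric.isOpen_ball (Metric.mem_ball_self hδ)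
    obtain ⟨z, ⟨hz1, hz2⟩, hz3⟩ := hGdense.inter_open_nonempty _
      (Metric.isOpen_ball.inter isOpen_interior) ⟨x, hx1, hx2⟩
    rcases hcover z hz1 hz3 with h | h
    · exact g1 z h (interior_subset hz2)
    · exact g2 z h (interior_subset hz2)

lemma visible_one : Visible N.P (N.u 0) (N.u 1) :=
  N.edge_subset N.zero_lt

lemma ne_smul_dir {s m : ℕ} (hs : 1 ≤ s) (hsn : s < n) (hm : 1 ≤ m) (hmn : m < n) (hsm : s ≠ m)
    {r r' : ℝ} (hr : r ≠ 0) : N.u 0 + r • N.dir s ≠ N.u 0 + r' • N.dir m := by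
  intro h
  have h1 : planeDet (r' • N.dir m) (N.dir m) = 0 := by
    rw [planeDet_swap, planeDet_smul_right, planeDet_self, mul_zero, neg_zero]
  rw [← add_left_cancel h, planeDet_swap, planeDet_smul_right, neg_eq_zero, mul_eq_zero] at h1
  exact N.dir_det_ne_zero hm hmn hs hsn hsm.symm (h1.resolve_left hr)

/-- The half-open segment from vertex `0` to a visible vertex `s` meets neither the segments
from vertex `0` to later vertices nor the later edges. -/
lemma half_open_segment_avoids {s t : ℕ} (hs : 1 ≤ s) (hst : s < t) (htn : t + 1 < n)
    (hvs : Visible N.P (N.u 0) (N.u s)) {r : ℝ} (hr0 : 0 < r) (hr1 : r ≤ 1) :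
    N.u 0 + r • N.dir s ∉ segment ℝ (N.u 0) (N.u t) ∧
      ∀ f, t ≤ f → f < n → N.u 0 + r • N.dir s ∉ N.edge f := by
  constructor
  · intro h
    obtain ⟨r', _, _, h⟩ := exists_smul_of_mem_segment h
    exact N.ne_smul_dir hs (by omega) (by omega) (by omega) hst.ne hr0.ne' h
  · intro f htf hfn h
    rcases Nat.lt_or_ge (f + 1) n with hf | hf
    · rcases hr1.lt_or_eq with hr1 | rfl
      · exact N.open_segment_avoids_edge hs (by omega) hvs (by omega) hf hr0 hr1 h
      · rw [one_smul, N.u_add_dir] at h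
        have := N.index_of_vertex_mem_edge (by omega) hfn h
        omega
    · have hf' : f + 1 = n := by omega
      rw [edge, hf', N.closing, segment_symm] at h
      obtain ⟨r', _, _, h⟩ := exists_smul_of_mem_segment h
      exact N.ne_smul_dir hs (by omega) (by omega) hfn (by omega) hr0.ne' h

lemma edge_disjoint_segment {m t : ℕ} (hm : 1 ≤ m) (hmt : m + 1 < t) (htn : t < n)
    (hvt : Visible N.P (N.u 0) (N.u t)) : Disjoint (N.edge m) (segment ℝ (N.u 0) (N.u t)) := by
  refine Set.disjoint_left.2 fun x hx hx' => ?_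
  obtain ⟨r, hr0, hr1, rfl⟩ := exists_smul_of_mem_segment hx'
  rcases hr0.eq_or_lt with rfl | hr0
  · rw [zero_smul, add_zero] at hx
    have := N.index_of_vertex_mem_edge (by omega) (by omega) hx
    omega
  rcases hr1.lt_or_eq with hr1 | rfl
  · exact N.open_segment_avoids_edge (by omega) htn hvt hm (by omega) hr0 hr1 hx
  · rw [one_smul, add_sub_cancel] at hx
    have := N.index_of_vertex_mem_edge (by omega) (by omega) hx
    omega

lemma edge_disjoint_edge {m f : ℕ} (hm : 1 ≤ m) (hmf : m + 1 < f) (hf : f < n) :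
    Disjoint (N.edge m) (N.edge f) := by
  refine Set.disjoint_left.2 fun x hx hx' => ?_
  have := N.meet m f (by omega) hf x hx hx'
  omega

/-- The closed polygonal line through the vertices `0, t, t + 1, …, n - 1` is seen under the
same total angle from all points close to vertex `0` in the direction of a visible
earlier vertex. -/
lemma totalAngle_eq {s t : ℕ} (hs : 1 ≤ s) (hst : s < t) (htn : t + 1 < n)
    (hvs : Visible N.P (N.u 0) (N.u s)) (hvt : Visible N.P (N.u 0) (N.u t)) {r : ℝ}
    (hr0 : 0 < r) (hr1 : r ≤ 1) :
    totalAngle (N.u 0) (fun m => N.u (t + m)) (n - 1 - t) (N.u 0 + r • N.dir s) =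
      totalAngle (N.u 0) (fun m => N.u (t + m)) (n - 1 - t) (N.u 1) := by
  have hlast : segment ℝ (N.u (t + (n - 1 - t))) (N.u 0) = N.edge (n - 1) := by
    rw [edge, Nat.sub_add_cancel (by omega), N.closing]
    congr 2
    omega
  have key : ∀ p₁ p₂, Disjoint (segment ℝ p₁ p₂) (segment ℝ (N.u 0) (N.u t)) →
      (∀ f, t ≤ f → f < n → Disjoint (segment ℝ p₁ p₂) (N.edge f)) →
      totalAngle (N.u 0) (fun m => N.u (t + m)) (n - 1 - t) p₁ =
        totalAngle (N.u 0) (fun m => N.u (t + m)) (n - 1 - t) p₂ := by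
    intro p₁ p₂ h1 h2
    refine totalAngle_eq_of_segment (by simpa using h1) (fun m hm => ?_) ?_
    · exact h2 (t + m) (by omega) (by omega)
    · rw [hlast]
      exact h2 _ (by omega) (by omega)
  have hvertex : totalAngle (N.u 0) (fun m => N.u (t + m)) (n - 1 - t) (N.u s) =
      totalAngle (N.u 0) (fun m => N.u (t + m)) (n - 1 - t) (N.u 1) := by
    clear hvs
    induction s, hs using Nat.le_induction with
    | base => rfl
    | succ m hm ih =>
      rw [← ih (by omega)]
      symm
      exact key _ _ (N.edge_disjoint_segment hm hst (by omega) hvt)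
        fun f htf hf => N.edge_disjoint_edge hm (by omega) hf
  rw [← hvertex]
  have hmem : ∀ x ∈ segment ℝ (N.u 0 + r • N.dir s) (N.u s),
      ∃ r' : ℝ, 0 < r' ∧ r' ≤ 1 ∧ x = N.u 0 + r' • N.dir s := by
    intro x hx
    obtain ⟨θ, h0, h1, rfl⟩ := exists_smul_of_mem_segment hx
    refine ⟨r + θ * (1 - r), by nlinarith, by nlinarith, ?_⟩
    rw [← N.u_add_dir s]
    module
  refine key _ _ (Set.disjoint_left.2 fun x hx => ?_)
    fun f htf hf => Set.disjoint_left.2 fun x hx => ?_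
  · obtain ⟨r', h0, h1, rfl⟩ := hmem x hx
    exact (N.half_open_segment_avoids hs hst htn hvs h0 h1).1
  · obtain ⟨r', h0, h1, rfl⟩ := hmem x hx
    exact (N.half_open_segment_avoids hs hst htn hvs h0 h1).2 f htf hf

/-- The segments from vertex `0` to visible vertices occur in the order of these vertices. -/
lemma ccw_dir_iff {s t : ℕ} (hs : 1 ≤ s) (hst : s < t) (htn : t + 1 < n)
    (hvs : Visible N.P (N.u 0) (N.u s)) (hvt : Visible N.P (N.u 0) (N.u t)) :
    CCW (N.dir t) (N.dir s) (N.dir (n - 1)) ↔ CCW (N.dir t) (N.dir 1) (N.dir (n - 1)) := by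
  have hlim : ∀ m, 1 ≤ m → m < t → Visible N.P (N.u 0) (N.u m) →
      Filter.Tendsto (fun _ : ℝ => totalAngle (N.u 0) (fun m => N.u (t + m)) (n - 1 - t) (N.u 1))
        (nhdsWithin 0 (Set.Ioi 0)) (nhds (dirAngle (-N.dir m) (N.dir t) +
          ∑ l ∈ Finset.range (n - 1 - t),
            dirAngle (N.u (t + l) - N.u 0) (N.u (t + l + 1) - N.u 0) +
              dirAngle (N.dir (n - 1)) (-N.dir m))) := by
    intro m hm hmt hv
    have hlast : N.u (t + (n - 1 - t)) - N.u 0 = N.dir (n - 1) := by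
      rw [dir]; congr 2; omega
    have := tendsto_totalAngle (a := N.u 0) (d := N.dir m) (q := fun m => N.u (t + m))
      (M := n - 1 - t) (fun l hl h => by
        have := N.index_of_vertex_mem_edge (m := 0) (f := t + l) (by omega) (by omega) h
        omega) (N.dir_det_ne_zero (by omega) (by omega) hm (by omega) (by omega)) (by
        simp only [hlast]
        exact N.dir_det_ne_zero hm (by omega) (by omega) (by omega) (by omega))
    simp only [hlast] at this
    refine this.congr' ?_
    filter_upwards [Ioc_mem_nhdsGT (zero_lt_one (α := ℝ))] with r hr
    exact N.totalAngle_eq hm hmt htn hv hvt hr.1 hr.2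
  have heq := tendsto_nhds_unique (hlim s hs hst hvs) (hlim 1 le_rfl (by omega) N.visible_one)
  have hiff : ∀ m, 1 ≤ m → m < t → (CCW (N.dir t) (N.dir m) (N.dir (n - 1)) ↔
      0 < dirAngle (-N.dir m) (N.dir t) + dirAngle (N.dir (n - 1)) (-N.dir m)) :=
    fun m hm hmt => ccw_iff_dirAngle
      (N.dir_det_ne_zero (by omega) (by omega) hm (by omega) (by omega))
      (N.dir_det_ne_zero hm (by omega) (by omega) (by omega) (by omega))
      (N.dir_det_ne_zero (by omega) (by omega) (by omega) (by omega) (by omega))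
  rw [hiff s hs hst, hiff 1 le_rfl (by omega)]
  have : dirAngle (-N.dir s) (N.dir t) + dirAngle (N.dir (n - 1)) (-N.dir s) =
      dirAngle (-N.dir 1) (N.dir t) + dirAngle (N.dir (n - 1)) (-N.dir 1) := by
    linarith
  rw [this]

end CyclicPolygon

/-- An abstract cyclic order on directions, which is total on directions in general position. -/
structure IsCyclicOrder (R : Plane → Plane → Plane → Prop) : Prop where
  rotate : ∀ {u v w}, R u v w → R v w u
  asymm : ∀ {u v w}, R u v w → ¬ R u w v
  trans : ∀ {a b c d}, R a b c → R a c d → R a b d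
  total : ∀ {u v w}, planeDet u v ≠ 0 → planeDet v w ≠ 0 → planeDet w u ≠ 0 → R u v w ∨ R u w v

lemma isCyclicOrder_ccw : IsCyclicOrder CCW :=
  ⟨CCW.rotate, CCW.asymm, CCW.trans, CCW.total⟩

lemma IsCyclicOrder.reverse {R : Plane → Plane → Plane → Prop} (h : IsCyclicOrder R) :
    IsCyclicOrder fun u v w => R w v u where
  rotate := fun h1 => h.rotate (h.rotate h1)
  asymm := fun h1 => h.asymm (h.rotate h1)
  trans := fun h1 h2 => h.rotate (h.trans (h.rotate (h.rotate h2)) (h.rotate (h.rotate h1)))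
  total := fun h1 h2 h3 => (h.total h1 h2 h3).symm.imp h.rotate h.rotate

namespace CyclicPolygon

variable {n : ℕ} (N : CyclicPolygon n)

/-- A cyclic order for which the polygon lies, near vertex `0`, in the sector from
vertex `1` to vertex `n - 1`. -/
structure IsOrientation (R : Plane → Plane → Plane → Prop) : Prop extends IsCyclicOrder R where
  inward : ∀ d, R (N.dir 1) d (N.dir (n - 1)) → N.Inward d
  outward : ∀ d, R (N.dir (n - 1)) d (N.dir 1) → ∃ δ > (0 : ℝ), ∀ t : ℝ, 0 < t → t < δ →
    N.u 0 + t • d ∉ N.P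
  order : ∀ s t, 1 ≤ s → s < t → t + 1 < n → Visible N.P (N.u 0) (N.u s) →
    Visible N.P (N.u 0) (N.u t) → R (N.dir t) (N.dir s) (N.dir (n - 1)) →
    R (N.dir t) (N.dir 1) (N.dir (n - 1))

lemma isOrientation_or :
    N.IsOrientation CCW ∨ N.IsOrientation fun u v w => CCW w v u := by
  rcases N.sector_dichotomy with ⟨h1, h2⟩ | ⟨h1, h2⟩
  · exact Or.inl ⟨isCyclicOrder_ccw, h1, h2, fun s t h3 h4 h5 h6 h7 =>
      (N.ccw_dir_iff h3 h4 h5 h6 h7).1⟩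
  · refine Or.inr ⟨isCyclicOrder_ccw.reverse, h1, h2, fun s t h3 h4 h5 h6 h7 h8 => ?_⟩
    have h9 : ¬ CCW (N.dir t) (N.dir 1) (N.dir (n - 1)) := by
      rw [← N.ccw_dir_iff h3 h4 h5 h6 h7]
      exact fun h => h.asymm h8.rotate.rotate
    refine ((CCW.total ?_ ?_ ?_).resolve_left h9).rotate <;>
      exact N.dir_det_ne_zero (by omega) (by omega) (by omega) (by omega) (by omega)

namespace IsOrientation

variable {N} {R : Plane → Plane → Plane → Prop}

lemma dir_order (h : N.IsOrientation R) {s t : ℕ} (hs : 1 ≤ s) (hst : s < t) (htn : t + 1 < n)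
    (hvs : Visible N.P (N.u 0) (N.u s)) (hvt : Visible N.P (N.u 0) (N.u t)) :
    R (N.dir s) (N.dir t) (N.dir (n - 1)) := by
  have h1 : ¬ R (N.dir (n - 1)) (N.dir t) (N.dir 1) := by
    intro hc
    obtain ⟨δ, hδ, hd⟩ := h.outward _ hc
    have hr : 0 < min δ 1 / 2 := by positivity
    have h1 := min_le_left δ 1
    have h2 := min_le_right δ 1
    exact hd _ hr (by linarith) (hvt (mem_segment_of_smul hr.le (by linarith)))
  have h2 : ¬ R (N.dir t) (N.dir s) (N.dir (n - 1)) := fun hc =>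
    h1 (h.rotate (h.rotate (h.order s t hs hst htn hvs hvt hc)))
  refine h.rotate (h.rotate ((h.total ?_ ?_ ?_).resolve_left h2)) <;>
    exact N.dir_det_ne_zero (by omega) (by omega) (by omega) (by omega) (by omega)

lemma order_last (h : N.IsOrientation R) {c b : ℕ} (hc : 1 ≤ c) (hcb : c < b) (hbn : b < n)
    (hvc : Visible N.P (N.u 0) (N.u c)) (hvb : Visible N.P (N.u 0) (N.u b)) {d : Plane}
    (hd : R (N.dir c) d (N.dir b)) : R (N.dir c) d (N.dir (n - 1)) := by
  rcases Nat.lt_or_ge (b + 1) n with hb | hb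
  · exact h.trans hd (h.dir_order hc hcb hb hvc hvb)
  · obtain rfl : b = n - 1 := by omega
    exact hd

lemma inward_of_between (h : N.IsOrientation R) {c b : ℕ} (hc : 1 ≤ c) (hcb : c < b) (hbn : b < n)
    (hvc : Visible N.P (N.u 0) (N.u c)) (hvb : Visible N.P (N.u 0) (N.u b)) {d : Plane}
    (hd : R (N.dir c) d (N.dir b)) : N.Inward d := by
  apply h.inward
  have h1 := h.order_last hc hcb hbn hvc hvb hd
  rcases hc.eq_or_lt with rfl | hc
  · exact h1
  · have h2 := h.dir_order le_rfl hc (by omega) N.visible_one hvc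
    exact h.rotate (h.trans (h.rotate (h.rotate h2)) (h.rotate (h.rotate h1)))

lemma not_visible_of_between (h : N.IsOrientation R) {c b : ℕ} (hc : 1 ≤ c) (hcb : c < b)
    (hbn : b < n) (hvc : Visible N.P (N.u 0) (N.u c)) (hvb : Visible N.P (N.u 0) (N.u b))
    (hmax : ∀ m, c < m → m < b → ¬ Visible N.P (N.u 0) (N.u m)) {w : ℕ} (hw : 1 ≤ w) (hwn : w < n)
    (hd : R (N.dir c) (N.dir w) (N.dir b)) : ¬ Visible N.P (N.u 0) (N.u w) := by
  intro hvw
  rcases lt_trichotomy w c with hwc | rfl | hwc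
  · exact h.asymm (h.dir_order hw hwc (by omega) hvw hvc)
      (h.rotate (h.order_last hc hcb hbn hvc hvb hd))
  · exact h.asymm hd (h.rotate hd)
  rcases lt_trichotomy w b with hwb | rfl | hwb
  · exact hmax w hwc hwb hvw
  · exact h.asymm hd hd
  have h1 := h.dir_order hc hcb (by omega) hvc hvb
  rcases Nat.lt_or_ge (w + 1) n with hw' | hw'
  · exact h.asymm (h.rotate h1)
      (h.trans (h.rotate (h.rotate hd)) (h.dir_order (by omega) hwb hw' hvb hvw))
  · obtain rfl : w = n - 1 := by omega
    exact h.asymm h1 hd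

end IsOrientation

lemma add_smul_sub_mem_edge {f : ℕ} {x y : Plane} (hx : x ∈ N.edge f) (hy : y ∈ N.edge f) {r : ℝ}
    (h0 : 0 ≤ r) (h1 : r ≤ 1) : x + r • (y - x) ∈ N.edge f :=
  (convex_segment _ _).segment_subset hx hy (mem_segment_of_smul h0 h1)

/-- An edge that avoids vertex `0` cannot leave the triangle between two visible vertices
through a side at vertex `0`. -/
lemma edge_avoids_side {b f : ℕ} (hb : 1 ≤ b) (hbn : b < n) (hvb : Visible N.P (N.u 0) (N.u b))
    (hf : 1 ≤ f) (hfn : f + 1 < n) {C : Plane} {α β α' β' : ℝ}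
    (hz : N.u 0 + (α • C + β • N.dir b) ∈ N.edge f)
    (hp : N.u 0 + (α' • C + β' • N.dir b) ∈ N.edge f) (hα : 0 < α) (hα' : α' ≤ 0)
    (h1 : α + β < 1) (h2 : α' + β' ≤ α + β) (h3 : 0 ≤ α * β' - β * α') : False := by
  have hd : 0 < α - α' := by linarith
  have hr1 : α / (α - α') ≤ 1 := by rw [div_le_one hd]; linarith
  have hr0 : 0 < α / (α - α') := by positivity
  have hy := N.add_smul_sub_mem_edge hz hp hr0.le hr1
  set γ := (α * β' - β * α') / (α - α') with hγ
  have hy' : N.u 0 + (α • C + β • N.dir b) + (α / (α - α')) •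
      (N.u 0 + (α' • C + β' • N.dir b) - (N.u 0 + (α • C + β • N.dir b))) =
      N.u 0 + γ • N.dir b := by
    have e1 : γ = β + (α / (α - α')) * (β' - β) := by rw [hγ]; field_simp; ring
    have e2 : (0 : ℝ) = α + (α / (α - α')) * (α' - α) := by field_simp; ring
    have e3 : N.u 0 + γ • N.dir b = N.u 0 + ((0 : ℝ) • C + γ • N.dir b) := by module
    rw [e3, e1, e2]
    module
  rw [hy'] at hy
  have hγ0 : 0 ≤ γ := by positivity
  have hγ1 : γ < 1 := by
    rw [hγ, div_lt_one hd]
    nlinarith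
  rcases hγ0.eq_or_lt with h | h
  · rw [← h, zero_smul, add_zero] at hy
    have := N.index_of_vertex_mem_edge N.zero_lt (by omega) hy
    omega
  · exact N.open_segment_avoids_edge hb hbn hvb hf hfn h hγ1 hy

/-- An edge blocking the view inside the triangle between two visible vertices has an
endpoint in this triangle that is at least as close to vertex `0`. -/
lemma exists_vertex_in_triangle {c b f : ℕ} (hc : 1 ≤ c) (hcn : c < n) (hb : 1 ≤ b) (hbn : b < n)
    (hvc : Visible N.P (N.u 0) (N.u c)) (hvb : Visible N.P (N.u 0) (N.u b))
    (hdet : planeDet (N.dir c) (N.dir b) ≠ 0) (hf : 1 ≤ f) (hfn : f + 1 < n) {α β : ℝ} (hα : 0 < α)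
    (hβ : 0 < β) (h1 : α + β < 1) (hz : N.u 0 + (α • N.dir c + β • N.dir b) ∈ N.edge f) :
    ∃ m, 1 ≤ m ∧ m < n ∧ ∃ α' β' : ℝ, 0 < α' ∧ 0 < β' ∧ α' + β' ≤ α + β ∧
      N.dir m = α' • N.dir c + β' • N.dir b := by
  have hend : ∀ m, 1 ≤ m → m < n → N.u m ∈ N.edge f → ∀ α' β' : ℝ,
      N.dir m = α' • N.dir c + β' • N.dir b → α' + β' ≤ α + β → 0 < α' ∧ 0 < β' := by
    intro m hm hmn hmf α' β' hm' hsum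
    rw [← N.u_add_dir m, hm'] at hmf
    by_contra hcon
    rcases le_or_gt 0 (α * β' - β * α') with h3 | h3
    · have hα' : α' ≤ 0 := by
        by_contra h
        push Not at h
        refine hcon ⟨h, ?_⟩
        by_contra h'
        push Not at h'
        nlinarith [mul_pos hβ h, mul_nonneg hα.le (neg_nonneg.2 h')]
      exact N.edge_avoids_side hb hbn hvb hf hfn hz hmf hα hα' h1 hsum h3
    · have hβ' : β' ≤ 0 := by
        by_contra h
        push Not at h
        refine hcon ⟨?_, h⟩
        by_contra h'
        push Not at h'
        nlinarith [mul_pos hα h, mul_nonneg hβ.le (neg_nonneg.2 h')]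
      rw [add_comm (α • _)] at hz
      rw [add_comm (α' • _)] at hmf
      exact N.edge_avoids_side hc hcn hvc hf hfn hz hmf hβ hβ' (by linarith) (by linarith)
        (by linarith)
  obtain ⟨α₀, β₀, h0⟩ := exists_coords hdet (N.dir f)
  obtain ⟨α₁, β₁, h1'⟩ := exists_coords hdet (N.dir (f + 1))
  obtain ⟨s, hs0, hs1, hs⟩ := exists_smul_of_mem_segment hz
  have hlin : (α + β) = (1 - s) * (α₀ + β₀) + s * (α₁ + β₁) := by
    have e : α • N.dir c + β • N.dir b =
        (1 - s) • (α₀ • N.dir c + β₀ • N.dir b) + s • (α₁ • N.dir c + β₁ • N.dir b) := by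
      rw [← h0, ← h1', ← add_right_inj (N.u 0), hs, dir, dir]
      module
    have e' : (α - ((1 - s) * α₀ + s * α₁)) • N.dir c =
        (((1 - s) * β₀ + s * β₁) - β) • N.dir b := by
      rw [← sub_eq_zero] at e ⊢
      rw [← e]
      module
    have e1 : α - ((1 - s) * α₀ + s * α₁) = 0 := by
      have := congrArg (planeDet (N.dir b)) e'
      rw [planeDet_smul_right, planeDet_smul_right, planeDet_self, mul_zero, mul_eq_zero] at this
      refine this.resolve_right ?_
      rw [planeDet_swap]
      exact neg_ne_zero.2 hdet
    have e2 : ((1 - s) * β₀ + s * β₁) - β = 0 := by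
      have := congrArg (planeDet (N.dir c)) e'
      rw [planeDet_smul_right, planeDet_smul_right, planeDet_self, mul_zero, eq_comm,
        mul_eq_zero] at this
      exact this.resolve_right hdet
    linarith
  rcases le_total (α₀ + β₀) (α₁ + β₁) with h | h
  · have hle : α₀ + β₀ ≤ α + β := by nlinarith
    obtain ⟨g1, g2⟩ := hend f hf (by omega) (left_mem_segment ℝ _ _) α₀ β₀ h0 hle
    exact ⟨f, hf, by omega, α₀, β₀, g1, g2, hle, h0⟩
  · have hle : α₁ + β₁ ≤ α + β := by nlinarith
    obtain ⟨g1, g2⟩ := hend (f + 1) (by omega) hfn (right_mem_segment ℝ _ _) α₁ β₁ h1' hle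
    exact ⟨f + 1, by omega, hfn, α₁, β₁, g1, g2, hle, h1'⟩

lemma ccw_of_pos {C B : Plane} (h : 0 < planeDet C B) {α β : ℝ} (hα : 0 < α) (hβ : 0 < β) :
    CCW C (α • C + β • B) B := by
  left
  constructor
  · rw [planeDet_add_right, planeDet_smul_right, planeDet_smul_right, planeDet_self]
    nlinarith [mul_pos hβ h]
  · rw [planeDet_swap, planeDet_add_right, planeDet_smul_right, planeDet_smul_right,
      planeDet_self, planeDet_swap]
    nlinarith [mul_pos hα h]

/-- If all directions between two visible vertices `c`, `b` spanning a convex angle are inward,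
and no vertex in these directions is visible, then the triangle `0, c, b` contains no further
vertices, and `c` is visible to `b`. -/
lemma segment_subset_of_convex {c b : ℕ} (hc : 1 ≤ c) (hcn : c < n) (hb : 1 ≤ b) (hbn : b < n)
    (hvc : Visible N.P (N.u 0) (N.u c)) (hvb : Visible N.P (N.u 0) (N.u b))
    (hin : ∀ d, CCW (N.dir c) d (N.dir b) → N.Inward d)
    (hnv : ∀ m, 1 ≤ m → m < n → CCW (N.dir c) (N.dir m) (N.dir b) → ¬ Visible N.P (N.u 0) (N.u m))
    (hdet : 0 < planeDet (N.dir c) (N.dir b)) : segment ℝ (N.u c) (N.u b) ⊆ N.P := by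
  have hempty : ∀ m, 1 ≤ m → m < n → ∀ α β : ℝ, 0 < α → 0 < β → α + β ≤ 1 →
      N.dir m ≠ α • N.dir c + β • N.dir b := by
    by_contra hcon
    push Not at hcon
    obtain ⟨m₀, hm₀⟩ := hcon
    classical
    set σ : ℕ → ℝ := fun m => planeDet (N.dir m) (N.dir b) + planeDet (N.dir c) (N.dir m) with hσ
    have hσ' : ∀ m α β, N.dir m = α • N.dir c + β • N.dir b →
        σ m = (α + β) * planeDet (N.dir c) (N.dir b) := by
      intro m α β h
      simp only [hσ, h]
      simp only [planeDet, Prod.fst_add, Prod.snd_add, Prod.smul_fst, Prod.smul_snd, smul_eq_mul]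
      ring
    obtain ⟨m, hmW, hmin⟩ := Finset.exists_min_image ((Finset.range n).filter fun m => 1 ≤ m ∧
      ∃ α β : ℝ, 0 < α ∧ 0 < β ∧ α + β ≤ 1 ∧ N.dir m = α • N.dir c + β • N.dir b) σ (by
        obtain ⟨h1, h2, α, β, h⟩ := hm₀
        exact ⟨m₀, Finset.mem_filter.2 ⟨Finset.mem_range.2 h2, h1, α, β, h⟩⟩)
    obtain ⟨hmn, hm1, α, β, hα, hβ, hsum, hm⟩ := Finset.mem_filter.1 hmW
    have hccw : CCW (N.dir c) (N.dir m) (N.dir b) := hm ▸ ccw_of_pos hdet hα hβ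
    have hv := hnv m hm1 (Finset.mem_range.1 hmn) hccw
    rw [← N.u_add_dir m] at hv
    obtain ⟨t, ht0, ht1, f, hf, hfn, hmem⟩ := N.exists_blocking_edge (hin _ hccw) hv
    rw [hm, smul_add, smul_smul, smul_smul] at hmem
    have hlt : t * (α + β) < α + β := by nlinarith
    obtain ⟨m', hm'1, hm'n, α', β', hα', hβ', hsum', hm'⟩ :=
      N.exists_vertex_in_triangle hc hcn hb hbn hvc hvb hdet.ne' hf hfn (mul_pos ht0 hα)
        (mul_pos ht0 hβ) (by linarith) hmem
    have := hmin m' (Finset.mem_filter.2 ⟨Finset.mem_range.2 hm'n, hm'1, α', β', hα', hβ',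
      by linarith, hm'⟩)
    rw [hσ' m α β hm, hσ' m' α' β' hm'] at this
    have := le_of_mul_le_mul_right this hdet
    linarith
  intro x hx
  obtain ⟨s, hs0, hs1, rfl⟩ := exists_smul_of_mem_segment hx
  rcases hs0.eq_or_lt with rfl | hs0
  · rw [zero_smul, add_zero]
    exact N.vertex_mem hcn
  rcases hs1.eq_or_lt with rfl | hs1
  · rw [one_smul, add_sub_cancel]
    exact N.vertex_mem hbn
  have e : N.u c + s • (N.u b - N.u c) = N.u 0 + ((1 - s) • N.dir c + s • N.dir b) := by
    simp only [dir]
    module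
  rw [e]
  by_contra hxP
  obtain ⟨t, ht0, ht1, f, hf, hfn, hmem⟩ := N.exists_blocking_edge
    (hin _ (ccw_of_pos hdet (by linarith) hs0)) fun h => hxP (h (right_mem_segment ℝ _ _))
  rw [smul_add, smul_smul, smul_smul] at hmem
  obtain ⟨m', hm'1, hm'n, α', β', hα', hβ', hsum', hm'⟩ :=
    N.exists_vertex_in_triangle hc hcn hb hbn hvc hvb hdet.ne' hf hfn
      (mul_pos ht0 (by linarith : 0 < 1 - s)) (mul_pos ht0 hs0) (by linarith) hmem
  exact hempty m' hm'1 hm'n α' β' hα' hβ' (by linarith) hm'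

end CyclicPolygon

/-- A segment in the wedge `0 ≤ x`, `0 ≤ y` that starts below the line `x + y = 1` and turns
towards the `x`-axis leaves the triangle through the `x`-axis or through this line. -/
lemma exists_exit_of_turn {z₁ z₂ g₁ g₂ : ℝ} (hz₂ : 0 < z₂) (hz : z₁ + z₂ < 1) (hz₁ : 0 ≤ z₁)
    (hκ : 0 < g₁ * z₂ - g₂ * z₁) (hg : ¬ (0 ≤ g₁ ∧ 0 < g₂ ∧ g₁ + g₂ ≤ 1)) :
    ∃ r, 0 < r ∧ r ≤ 1 ∧
      ((z₂ + r * (g₂ - z₂) = 0 ∧ 0 < z₁ + r * (g₁ - z₁) ∧ z₁ + r * (g₁ - z₁) ≤ 1) ∨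
      (1 < g₁ + g₂ ∧ 0 ≤ z₂ + r * (g₂ - z₂) ∧ 0 ≤ z₁ + r * (g₁ - z₁) ∧
        z₁ + r * (g₁ - z₁) + (z₂ + r * (g₂ - z₂)) = 1)) := by
  have hkey : ∀ r, 0 < r → 0 ≤ z₂ + r * (g₂ - z₂) → 0 < z₁ + r * (g₁ - z₁) := by
    intro r hr hr2
    have e : (z₁ + r * (g₁ - z₁)) * z₂ = (z₂ + r * (g₂ - z₂)) * z₁ + r * (g₁ * z₂ - g₂ * z₁) := by
      ring
    have : 0 < (z₁ + r * (g₁ - z₁)) * z₂ := by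
      rw [e]
      have := mul_pos hr hκ
      have := mul_nonneg hr2 hz₁
      linarith
    exact pos_of_mul_pos_left this hz₂.le
  by_cases hA : g₂ ≤ 0 ∧ z₂ * (g₁ + g₂) - g₂ * (z₁ + z₂) ≤ z₂ - g₂
  · obtain ⟨h1, h2⟩ := hA
    have hd : 0 < z₂ - g₂ := by linarith
    have e1 : z₂ + z₂ / (z₂ - g₂) * (g₂ - z₂) = 0 := by field_simp; ring
    have hr : 0 < z₂ / (z₂ - g₂) := by positivity
    refine ⟨z₂ / (z₂ - g₂), hr, by rw [div_le_one hd]; linarith, Or.inl ⟨e1, hkey _ hr e1.ge, ?_⟩⟩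
    have e2 : z₁ + z₂ / (z₂ - g₂) * (g₁ - z₁) =
        (z₂ * (g₁ + g₂) - g₂ * (z₁ + z₂)) / (z₂ - g₂) := by field_simp; ring
    rw [e2, div_le_one hd]
    exact h2
  · have hsum : 1 < g₁ + g₂ := by
      by_contra hc
      push Not at hc
      rcases le_or_gt g₂ 0 with h | h
      · refine hA ⟨h, ?_⟩
        nlinarith
      · refine hg ⟨?_, h, hc⟩
        have := hkey 1 one_pos (by linarith)
        linarith
    have hd : 0 < g₁ + g₂ - (z₁ + z₂) := by linarith
    set r := (1 - (z₁ + z₂)) / (g₁ + g₂ - (z₁ + z₂)) with hr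
    have hr0 : 0 < r := div_pos (by linarith) hd
    have hr1 : r ≤ 1 := by rw [hr, div_le_one hd]; linarith
    have hy : 0 ≤ z₂ + r * (g₂ - z₂) := by
      rcases le_or_gt g₂ 0 with h | h
      · have h2 : z₂ - g₂ < z₂ * (g₁ + g₂) - g₂ * (z₁ + z₂) := by
          by_contra hc
          exact hA ⟨h, not_lt.1 hc⟩
        have e : z₂ + r * (g₂ - z₂) = (z₂ * (g₁ + g₂) - g₂ * (z₁ + z₂) - (z₂ - g₂)) /
            (g₁ + g₂ - (z₁ + z₂)) := by rw [hr]; field_simp; ring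
        rw [e]
        exact div_nonneg (by linarith) hd.le
      · nlinarith
    refine ⟨r, hr0, hr1, Or.inr ⟨hsum, hy, (hkey r hr0 hy).le, ?_⟩⟩
    have e : z₁ + r * (g₁ - z₁) + (z₂ + r * (g₂ - z₂)) =
      (z₁ + z₂) + r * (g₁ + g₂ - (z₁ + z₂)) := by ring
    rw [e, hr, div_mul_cancel₀ _ hd.ne']
    ring

namespace CyclicPolygon

variable {n : ℕ} (N : CyclicPolygon n)

/-- A ray from vertex `0` that starts in the interior reaches the boundary. -/
lemma exists_first_exit {d : Plane} (hd : N.Inward d) :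
    ∃ T : ℝ, 0 < T ∧ N.u 0 + T • d ∈ frontier N.P ∧
      ∀ t : ℝ, 0 < t → t < T → N.u 0 + t • d ∈ interior N.P := by
  obtain ⟨δ, hδ, hint⟩ := hd
  have hd0 : d ≠ 0 := by
    rintro rfl
    have h := hint (δ / 2) (by linarith) (by linarith)
    rw [smul_zero, add_zero] at h
    exact N.not_mem_frontier_of_interior h
      (N.edge_subset_frontier N.zero_lt (left_mem_segment ℝ _ _))
  have hcont : Continuous fun t : ℝ => N.u 0 + t • d := by fun_prop
  obtain ⟨M, hM, hMP⟩ : ∃ M : ℝ, δ / 2 ≤ M ∧ N.u 0 + M • d ∉ N.P := by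
    obtain ⟨r, hr⟩ := N.compact.isBounded.subset_closedBall (N.u 0)
    have hn : 0 < ‖d‖ := norm_pos_iff.2 hd0
    refine ⟨max (δ / 2) ((|r| + 1) / ‖d‖), le_max_left _ _, fun h => ?_⟩
    have h1 := hr h
    rw [mem_closedBall_iff_norm, add_sub_cancel_left, norm_smul, Real.norm_eq_abs,
      abs_of_pos (lt_of_lt_of_le (by linarith) (le_max_left _ _))] at h1
    have h2 : (|r| + 1) / ‖d‖ * ‖d‖ ≤ max (δ / 2) ((|r| + 1) / ‖d‖) * ‖d‖ := by
      gcongr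
      exact le_max_right _ _
    rw [div_mul_cancel₀ _ hn.ne'] at h2
    linarith [le_abs_self r]
  have hstart : N.u 0 + (δ / 2) • d ∈ N.P :=
    interior_subset (hint (δ / 2) (by linarith) (by linarith))
  set K := {t : ℝ | t ∈ Set.Icc (δ / 2) M ∧ N.u 0 + t • d ∈ frontier N.P} with hK
  have hKc : IsCompact K := by
    have : K = Set.Icc (δ / 2) M ∩ (fun t : ℝ => N.u 0 + t • d) ⁻¹' frontier N.P := rfl
    rw [this]
    exact isCompact_Icc.inter_right (isClosed_frontier.preimage hcont)
  have hKn : K.Nonempty := by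
    by_contra hne
    have := N.subset_interior_of_disjoint_frontier
      (S := (fun t : ℝ => N.u 0 + t • d) '' Set.Icc (δ / 2) M)
      (isPreconnected_Icc.image _ hcont.continuousOn) (by
        rintro _ ⟨t, ht, rfl⟩ hfr
        exact hne ⟨t, ht, hfr⟩) ⟨δ / 2, ⟨le_rfl, hM⟩, rfl⟩ hstart
    exact hMP (interior_subset (this ⟨M, ⟨hM, le_rfl⟩, rfl⟩))
  obtain ⟨T, ⟨⟨hT1, hT2⟩, hT3⟩, hTmin⟩ := hKc.exists_isLeast hKn
  refine ⟨T, by linarith, hT3, fun t h0 h1 => ?_⟩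
  rcases lt_or_ge t (δ / 2) with h2 | h2
  · exact hint t h0 (by linarith)
  · refine N.subset_interior_of_disjoint_frontier
      (S := (fun t : ℝ => N.u 0 + t • d) '' Set.Ico (δ / 2) T)
      (isPreconnected_Ico.image _ hcont.continuousOn) ?_ ⟨δ / 2, ⟨le_rfl, by linarith⟩, rfl⟩ hstart
      ⟨t, ⟨h2, h1⟩, rfl⟩
    rintro _ ⟨t', ht', rfl⟩ hfr
    have := hTmin ⟨⟨ht'.1, ht'.2.le.trans hT2⟩, hfr⟩
    linarith [ht'.2]

/-- If a ray from vertex `0` first hits the boundary at the point `0 + X` in the relative interior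
of an edge, then some vertex on either side of the ray is visible. -/
lemma exists_visible_beside_ray {X : Plane} {e p : ℕ} (he : 1 ≤ e) (hen : e + 1 < n)
    (hp : p = e ∨ p = e + 1) (hX : N.u 0 + X ∈ N.edge e) (hXe : N.u 0 + X ≠ N.u e)
    (hXe' : N.u 0 + X ≠ N.u (e + 1))
    (hint : ∀ t : ℝ, 0 < t → t < 1 → N.u 0 + t • X ∈ interior N.P)
    (hin : ∀ α β : ℝ, 0 ≤ α → 0 < β → N.Inward (α • X + β • N.dir p)) :
    ∃ m, 1 ≤ m ∧ m < n ∧ Visible N.P (N.u 0) (N.u m) ∧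
      ∃ α β : ℝ, 0 ≤ α ∧ 0 < β ∧ N.dir m = α • X + β • N.dir p := by
  classical
  by_contra hcon
  push Not at hcon
  have hpn : 1 ≤ p ∧ p < n := by omega
  have hpe : N.u p ∈ N.edge e := by
    rcases hp with rfl | rfl
    · exact left_mem_segment ℝ _ _
    · exact right_mem_segment ℝ _ _
  have hD : planeDet X (N.dir p) ≠ 0 := by
    obtain ⟨s, _, _, hs⟩ := exists_smul_of_mem_segment hX
    have hX' : X = (1 - s) • N.dir e + s • N.dir (e + 1) := by
      rw [← add_right_inj (N.u 0), hs, dir, dir]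
      module
    have hne := N.dir_det_ne_zero he (by omega) (by omega) hen (by omega : e ≠ e + 1)
    have hs0 : s ≠ 0 := by
      rintro rfl
      exact hXe (by rw [hs]; simp)
    have hs1 : 1 - s ≠ 0 := by
      intro h
      obtain rfl : s = 1 := by linarith
      exact hXe' (by rw [hs]; simp)
    rcases hp with rfl | rfl
    · have : planeDet X (N.dir p) = -(s * planeDet (N.dir p) (N.dir (p + 1))) := by
        rw [hX', planeDet_swap, planeDet_add_right, planeDet_smul_right, planeDet_smul_right,
          planeDet_self]
        ring
      rw [this]
      exact neg_ne_zero.2 (mul_ne_zero hs0 hne)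
    · have : planeDet X (N.dir (e + 1)) = (1 - s) * planeDet (N.dir e) (N.dir (e + 1)) := by
        rw [hX', planeDet_swap, planeDet_add_right, planeDet_smul_right, planeDet_smul_right,
          planeDet_self, planeDet_swap]
        ring
      rw [this]
      exact mul_ne_zero hs1 hne
  set Q := N.dir p with hQ
  have huniq : ∀ α β α' β' : ℝ, α • X + β • Q = α' • X + β' • Q → α = α' ∧ β = β' := by
    intro α β α' β' h
    have e1 := congrArg (planeDet X) h
    have e2 := congrArg (planeDet Q) h
    simp only [planeDet_add_right, planeDet_smul_right, planeDet_self, mul_zero, zero_add,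
      add_zero, planeDet_swap Q X, mul_neg, neg_inj] at e1 e2
    exact ⟨mul_right_cancel₀ hD e2, mul_right_cancel₀ hD e1⟩
  set ρ : ℕ → ℝ := fun m => planeDet (N.dir m) Q / planeDet X (N.dir m) with hρ
  have hρ' : ∀ m α β, N.dir m = α • X + β • Q → ρ m = α / β := by
    intro m α β h
    have e1 : planeDet (N.dir m) Q = α * planeDet X Q := by
      rw [planeDet_swap, h, planeDet_add_right, planeDet_smul_right, planeDet_smul_right,
        planeDet_self, planeDet_swap]
      ring
    have e2 : planeDet X (N.dir m) = β * planeDet X Q := by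
      rw [h, planeDet_add_right, planeDet_smul_right, planeDet_smul_right, planeDet_self]
      ring
    simp only [hρ, e1, e2]
    exact mul_div_mul_right _ _ hD
  obtain ⟨w, hwW, hmax⟩ := Finset.exists_max_image ((Finset.range n).filter fun m => 1 ≤ m ∧
    ∃ α β : ℝ, 0 ≤ α ∧ 0 < β ∧ α + β ≤ 1 ∧ N.dir m = α • X + β • Q) ρ
    ⟨p, Finset.mem_filter.2 ⟨Finset.mem_range.2 hpn.2, hpn.1, 0, 1, le_rfl, one_pos, by norm_num,
      by rw [hQ]; module⟩⟩
  obtain ⟨hwn, hw1, α, β, hα, hβ, hsum, hw⟩ := Finset.mem_filter.1 hwW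
  rw [Finset.mem_range] at hwn
  have hv : ¬ Visible N.P (N.u 0) (N.u w) := fun h => hcon w hw1 hwn h α β hα hβ hw
  rw [← N.u_add_dir w] at hv
  obtain ⟨t, ht0, ht1, f, hf, hfn, hz⟩ := N.exists_blocking_edge
    (by rw [hw]; exact hin α β hα hβ) hv
  have hzm : ∀ m, 1 ≤ m → m < n → N.u 0 + t • N.dir w ≠ N.u m := by
    intro m hm hmn h
    by_cases hmw : w = m
    · subst hmw
      have e : t • N.dir w = N.dir w := by
        rw [← add_right_inj (N.u 0), h, N.u_add_dir]
      rw [hw, smul_add, smul_smul, smul_smul] at e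
      have := (huniq _ _ _ _ e).2
      nlinarith
    · refine N.ne_smul_dir hw1 hwn hm hmn hmw ht0.ne' (r' := 1) ?_
      rw [h, one_smul, N.u_add_dir]
  have hedge : ∀ a b : ℝ, N.u 0 + (a • X + b • Q) ∈ N.edge e → a + b = 1 := by
    intro a b h
    obtain ⟨s₁, _, _, hs₁⟩ := exists_smul_of_mem_segment h
    obtain ⟨s₂, _, _, hs₂⟩ := exists_smul_of_mem_segment hX
    rw [← N.u_add_dir p] at hpe
    obtain ⟨s₃, _, _, hs₃⟩ := exists_smul_of_mem_segment hpe
    have e1 : (a - 1) • X + b • Q = (s₁ - s₂) • (N.u (e + 1) - N.u e) := by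
      have : (a - 1) • X + b • Q = N.u 0 + (a • X + b • Q) - (N.u 0 + X) := by module
      rw [this, hs₁, hs₂]
      module
    have e2 : Q - X = (s₃ - s₂) • (N.u (e + 1) - N.u e) := by
      have : Q - X = N.u 0 + Q - (N.u 0 + X) := by module
      rw [this, hs₃, hs₂]
      module
    have e3 : planeDet (Q - X) ((a - 1) • X + b • Q) = 0 := by
      rw [e1, e2, planeDet_smul_right, planeDet_swap, planeDet_smul_right, planeDet_self]
      ring
    have e4 : planeDet (Q - X) ((a - 1) • X + b • Q) = (1 - (a + b)) * planeDet X Q := by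
      simp only [planeDet, Prod.fst_sub, Prod.snd_sub, Prod.fst_add, Prod.snd_add, Prod.smul_fst,
        Prod.smul_snd, smul_eq_mul]
      ring
    rw [e4, mul_eq_zero] at e3
    linarith [e3.resolve_right hD]
  have hz' : N.u 0 + ((t * α) • X + (t * β) • Q) ∈ N.edge f := by
    rw [hw, smul_add, smul_smul, smul_smul] at hz
    exact hz
  have htβ : 0 < t * β := mul_pos ht0 hβ
  have htα : 0 ≤ t * α := mul_nonneg ht0.le hα
  have htsum : t * α + t * β < 1 := by nlinarith
  have hfe : f ≠ e := by
    rintro rfl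
    linarith [hedge _ _ hz']
  obtain ⟨α₀, β₀, h0⟩ := exists_coords hD (N.dir f)
  obtain ⟨α₁, β₁, h1⟩ := exists_coords hD (N.dir (f + 1))
  have hκ0 : ∀ m α' β', 1 ≤ m → m < n → m ≠ w → N.dir m = α' • X + β' • Q →
      α' * (t * β) - β' * (t * α) ≠ 0 := by
    intro m α' β' hm hmn hmw h hc
    apply N.dir_det_ne_zero hm hmn hw1 hwn hmw
    have : planeDet (N.dir m) (N.dir w) = (α' * β - β' * α) * planeDet X Q := by
      rw [h, hw]
      simp only [planeDet, Prod.fst_add, Prod.snd_add, Prod.smul_fst,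
        Prod.smul_snd, smul_eq_mul]
      ring
    rw [this]
    have : t * (α' * β - β' * α) = 0 := by linarith
    rw [(mul_eq_zero.1 this).resolve_left ht0.ne', zero_mul]
  have hκw : ∀ α' β', N.dir w = α' • X + β' • Q → α' * (t * β) - β' * (t * α) = 0 := by
    intro α' β' h
    rw [hw] at h
    obtain ⟨rfl, rfl⟩ := huniq _ _ _ _ h
    ring
  have hlin : ∃ s : ℝ, 0 < s ∧ s < 1 ∧
      (1 - s) * (α₀ * (t * β) - β₀ * (t * α)) + s * (α₁ * (t * β) - β₁ * (t * α)) = 0 := by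
    obtain ⟨s, hs0, hs1, hs⟩ := exists_smul_of_mem_segment hz
    have hs0' : s ≠ 0 := by
      rintro rfl
      exact hzm f hf (by omega) (by rw [hs]; simp)
    have hs1' : s ≠ 1 := by
      rintro rfl
      exact hzm (f + 1) (by omega) hfn (by rw [hs]; simp)
    refine ⟨s, lt_of_le_of_ne hs0 (Ne.symm hs0'), lt_of_le_of_ne hs1 hs1', ?_⟩
    have e : (t * α) • X + (t * β) • Q =
        ((1 - s) * α₀ + s * α₁) • X + ((1 - s) * β₀ + s * β₁) • Q := by
      have e1 : t • N.dir w = (1 - s) • N.dir f + s • N.dir (f + 1) := by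
        rw [← add_right_inj (N.u 0), hs, dir, dir]
        module
      rw [h0, h1, hw] at e1
      calc _ = t • (α • X + β • Q) := by module
        _ = _ := e1
        _ = _ := by module
    obtain ⟨e1, e2⟩ := huniq _ _ _ _ e
    linear_combination (-(t * β)) * e1 + (t * α) * e2
  have hfinal : ∀ g h α' β' α'' β'', (g = f ∨ g = f + 1) → (h = f ∨ h = f + 1) →
      (N.u f = N.u g ∧ N.u (f + 1) = N.u h ∨ N.u f = N.u h ∧ N.u (f + 1) = N.u g) →
      N.dir g = α' • X + β' • Q → N.dir h = α'' • X + β'' • Q →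
      0 < α' * (t * β) - β' * (t * α) → α'' * (t * β) - β'' * (t * α) < 0 → False := by
    intro g h α' β' α'' β'' hg hh hgh hgdir hhdir hgκ hhκ
    have hgn : 1 ≤ g ∧ g < n := by omega
    have hge : N.u g ∈ N.edge f := by
      rcases hg with rfl | rfl
      · exact left_mem_segment ℝ _ _
      · exact right_mem_segment ℝ _ _
    rw [← N.u_add_dir g, hgdir] at hge
    obtain ⟨r, hr0, hr1, hr⟩ := exists_exit_of_turn htβ htsum htα hgκ (by
      rintro ⟨k1, k2, k3⟩
      have := hmax g (Finset.mem_filter.2 ⟨Finset.mem_range.2 hgn.2, hgn.1, α', β', k1, k2, k3,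
        hgdir⟩)
      rw [hρ' g α' β' hgdir, hρ' w α β hw, div_le_div_iff₀ k2 hβ] at this
      nlinarith)
    have hy := N.add_smul_sub_mem_edge hz' hge hr0.le hr1
    set y₁ := t * α + r * (α' - t * α) with hy₁
    set y₂ := t * β + r * (β' - t * β) with hy₂
    have hyeq : N.u 0 + ((t * α) • X + (t * β) • Q) + r • (N.u 0 + (α' • X + β' • Q) -
        (N.u 0 + ((t * α) • X + (t * β) • Q))) = N.u 0 + (y₁ • X + y₂ • Q) := by
      rw [hy₁, hy₂]
      module
    rw [hyeq] at hy
    rcases hr with ⟨k1, k2, k3⟩ | ⟨k1, k2, k3, k4⟩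
    · rw [k1, zero_smul, add_zero] at hy
      rcases k3.lt_or_eq with k3 | k3
      · exact N.not_mem_frontier_of_interior (hint _ k2 k3) (N.edge_subset_frontier (by omega) hy)
      · rw [k3, one_smul] at hy
        rcases N.eq_vertex_of_mem_edges (by omega) (by omega) hfe hy hX with k | k
        · exact hXe k
        · exact hXe' k
    · have hye : N.u 0 + (y₁ • X + y₂ • Q) ∈ N.edge e := by
        rw [← N.u_add_dir p] at hpe
        have := N.add_smul_sub_mem_edge hX hpe k2 (by linarith)
        convert this using 1
        have hy₁₂ : y₁ = 1 - y₂ := by linarith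
        rw [hy₁₂]
        module
      have hcase : N.u 0 + (y₁ • X + y₂ • Q) = N.u g ∨ N.u 0 + (y₁ • X + y₂ • Q) = N.u h := by
        have := N.eq_vertex_of_mem_edges (by omega) (by omega) hfe.symm hye hy
        rcases hgh with ⟨k5, k6⟩ | ⟨k5, k6⟩
        · rwa [k5, k6] at this
        · rw [k5, k6] at this
          exact this.symm
      rcases hcase with k | k
      · rw [← N.u_add_dir g, hgdir, add_right_inj] at k
        obtain ⟨k5, k6⟩ := huniq _ _ _ _ k
        linarith
      · rw [← N.u_add_dir h, hhdir, add_right_inj] at k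
        obtain ⟨k5, k6⟩ := huniq _ _ _ _ k
        have e : y₁ * (t * β) - y₂ * (t * α) = r * (α' * (t * β) - β' * (t * α)) := by
          rw [hy₁, hy₂]
          ring
        rw [← k5, ← k6, e] at hhκ
        nlinarith [mul_pos hr0 hgκ]
  obtain ⟨s, hs0, hs1, hs⟩ := hlin
  have hs1' : 0 < 1 - s := by linarith
  have hfw : f ≠ w := by
    rintro rfl
    rw [hκw α₀ β₀ h0, mul_zero, zero_add, mul_eq_zero] at hs
    exact hκ0 (f + 1) α₁ β₁ (by omega) hfn (by omega) h1 (hs.resolve_left hs0.ne')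
  have hfw' : f + 1 ≠ w := by
    rintro rfl
    rw [hκw α₁ β₁ h1, mul_zero, add_zero, mul_eq_zero] at hs
    exact hκ0 f α₀ β₀ hf (by omega) (by omega) h0 (hs.resolve_left hs1'.ne')
  rcases lt_or_gt_of_ne (hκ0 f α₀ β₀ hf (by omega) hfw h0) with k | k
  · have hneg : 0 < α₁ * (t * β) - β₁ * (t * α) := by
      by_contra hc
      nlinarith [mul_pos hs1' (neg_pos.2 k), mul_nonneg hs0.le (neg_nonneg.2 (not_lt.1 hc))]
    exact hfinal (f + 1) f α₁ β₁ α₀ β₀ (Or.inr rfl) (Or.inl rfl) (Or.inr ⟨rfl, rfl⟩) h1 h0 hneg k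
  · have hneg : α₁ * (t * β) - β₁ * (t * α) < 0 := by
      by_contra hc
      nlinarith [mul_pos hs1' k, mul_nonneg hs0.le (not_lt.1 hc)]
    exact hfinal f (f + 1) α₀ β₀ α₁ β₁ (Or.inl rfl) (Or.inr rfl) (Or.inl ⟨rfl, rfl⟩) h0 h1 k hneg

/-- If all directions between two visible vertices `c`, `b` are inward, then either these
vertices span a convex angle or some vertex in these directions is visible. -/
lemma det_pos_of_not_visible {c b : ℕ} (hc : 1 ≤ c) (hcn : c < n) (hb : 1 ≤ b) (hbn : b < n)
    (hcb : c ≠ b) (hin : ∀ d, CCW (N.dir c) d (N.dir b) → N.Inward d)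
    (hnv : ∀ m, 1 ≤ m → m < n → CCW (N.dir c) (N.dir m) (N.dir b) →
      ¬ Visible N.P (N.u 0) (N.u m)) : 0 < planeDet (N.dir c) (N.dir b) := by
  refine lt_of_not_ge fun hle => ?_
  have hdet : planeDet (N.dir c) (N.dir b) < 0 :=
    lt_of_le_of_ne hle (N.dir_det_ne_zero hc hcn hb hbn hcb)
  set C := N.dir c
  set B := N.dir b
  have hBC : 0 < planeDet B C := by rw [planeDet_swap]; linarith
  have hside : ∀ d, planeDet B d < 0 → CCW C d B := fun d hd =>
    Or.inr (Or.inl ⟨by rw [planeDet_swap]; linarith, hBC⟩)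
  obtain ⟨d, hd⟩ : ∃ d, planeDet B d < 0 := ⟨(-1 : ℝ) • C, by rw [planeDet_smul_right]; linarith⟩
  obtain ⟨T, hT, hfr, hint⟩ := N.exists_first_exit (hin d (hside d hd))
  obtain ⟨e, hen', hxe⟩ := (N.mem_frontier_iff _).1 hfr
  obtain ⟨he, hen⟩ := N.index_of_inward_mem_edge (hin d (hside d hd)) hT hen' hxe
  have hX : planeDet B (T • d) < 0 := by
    rw [planeDet_smul_right]
    exact mul_neg_of_pos_of_neg hT hd
  have hvis : Visible N.P (N.u 0) (N.u 0 + T • d) := by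
    intro x hx
    obtain ⟨s, hs0, hs1, rfl⟩ := exists_smul_of_mem_segment hx
    rw [add_sub_cancel_left, smul_smul]
    rcases hs0.eq_or_lt with rfl | hs0
    · rw [zero_mul, zero_smul, add_zero]
      exact N.vertex_mem N.zero_lt
    rcases hs1.eq_or_lt with rfl | hs1
    · rw [one_mul]
      exact N.isClosed.frontier_subset hfr
    · exact interior_subset (hint _ (mul_pos hs0 hT) (by nlinarith))
  have hvertex : ∀ m, 1 ≤ m → m < n → N.u 0 + T • d ≠ N.u m := by
    intro m hm hmn h
    refine hnv m hm hmn (hside _ ?_) (h ▸ hvis)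
    rw [dir, ← h, add_sub_cancel_left]
    exact hX
  obtain ⟨p, hp, hpB⟩ : ∃ p, (p = e ∨ p = e + 1) ∧ planeDet B (N.dir p) < 0 := by
    obtain ⟨s, hs0, hs1, hs⟩ := exists_smul_of_mem_segment hxe
    by_contra hcon
    push Not at hcon
    have h0 := hcon e (Or.inl rfl)
    have h1 := hcon (e + 1) (Or.inr rfl)
    have hX' : T • d = (1 - s) • N.dir e + s • N.dir (e + 1) := by
      rw [← add_right_inj (N.u 0), hs, dir, dir]
      module
    rw [hX', planeDet_add_right, planeDet_smul_right, planeDet_smul_right] at hX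
    nlinarith [mul_nonneg (sub_nonneg.2 hs1) h0, mul_nonneg hs0 h1]
  have hwedge : ∀ α β : ℝ, 0 ≤ α → 0 < β → CCW C (α • (T • d) + β • N.dir p) B := by
    intro α β hα hβ
    apply hside
    rw [planeDet_add_right, planeDet_smul_right α, planeDet_smul_right β]
    nlinarith [mul_nonneg hα (neg_nonneg.2 hX.le), mul_pos hβ (neg_pos.2 hpB)]
  obtain ⟨m, hm, hmn, hv, α, β, hα, hβ, h⟩ := N.exists_visible_beside_ray he hen hp hxe
    (hvertex e he (by omega)) (hvertex (e + 1) (by omega) hen) (fun t h0 h1 => by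
      rw [smul_smul]
      exact hint _ (mul_pos h0 hT) (by nlinarith)) fun α β hα hβ => hin _ (hwedge α β hα hβ)
  exact hnv m hm hmn (h ▸ hwedge α β hα hβ) hv

/-- Two visible vertices, between which no other vertex is visible, see each other. -/
theorem visible_of_consecutive_visible {c b : ℕ} (hc : 1 ≤ c) (hcb : c < b) (hbn : b < n)
    (hvc : Visible N.P (N.u 0) (N.u c)) (hvb : Visible N.P (N.u 0) (N.u b))
    (hmax : ∀ m, c < m → m < b → ¬ Visible N.P (N.u 0) (N.u m)) : Visible N.P (N.u c) (N.u b) := by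
  have hcn : c < n := hcb.trans hbn
  have hb : 1 ≤ b := by omega
  rcases N.isOrientation_or with h | h
  · have hin := fun d => h.inward_of_between (d := d) hc hcb hbn hvc hvb
    have hnv := fun m => h.not_visible_of_between (w := m) hc hcb hbn hvc hvb hmax
    exact N.segment_subset_of_convex hc hcn hb hbn hvc hvb hin (fun m h1 h2 => hnv m h1 h2)
      (N.det_pos_of_not_visible hc hcn hb hbn hcb.ne hin fun m h1 h2 => hnv m h1 h2)
  · have hin := fun d => h.inward_of_between (d := d) hc hcb hbn hvc hvb
    have hnv := fun m => h.not_visible_of_between (w := m) hc hcb hbn hvc hvb hmax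
    rw [Visible, segment_symm]
    exact N.segment_subset_of_convex hb hbn hc hcn hvb hvc hin (fun m h1 h2 => hnv m h1 h2)
      (N.det_pos_of_not_visible hb hbn hc hcn hcb.ne' hin fun m h1 h2 => hnv m h1 h2)

end CyclicPolygon

lemma collinear_of_planeDet_eq_zero {p q r : Plane} (hpq : p ≠ q)
    (h : planeDet (q - p) (r - p) = 0) : Collinear ℝ ({p, q, r} : Set Plane) := by
  rw [collinear_iff_of_mem (p₀ := p) (by simp)]
  refine ⟨q - p, ?_⟩
  have hr : ∃ t : ℝ, r = t • (q - p) + p := by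
    simp only [planeDet, Prod.fst_sub, Prod.snd_sub] at h
    by_cases h1 : q.1 - p.1 = 0
    · have h2 : q.2 - p.2 ≠ 0 := fun h2 =>
        hpq (Prod.ext (by linarith) (by linarith))
      refine ⟨(r.2 - p.2) / (q.2 - p.2), Prod.ext ?_ ?_⟩
      · rw [h1, zero_mul, zero_sub, neg_eq_zero, mul_eq_zero] at h
        simp only [Prod.fst_add, Prod.smul_fst, Prod.fst_sub, smul_eq_mul, h1, mul_zero]
        linarith [h.resolve_left h2]
      · simp only [Prod.snd_add, Prod.smul_snd, Prod.snd_sub, smul_eq_mul]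
        field_simp
        ring
    · refine ⟨(r.1 - p.1) / (q.1 - p.1), Prod.ext ?_ ?_⟩
      · simp only [Prod.fst_add, Prod.smul_fst, Prod.fst_sub, smul_eq_mul]
        field_simp
        ring
      · simp only [Prod.snd_add, Prod.smul_snd, Prod.snd_sub, smul_eq_mul]
        field_simp
        linarith
  rintro x (rfl | rfl | rfl)
  · exact ⟨0, by simp⟩
  · exact ⟨1, by simp⟩
  · simpa using hr

lemma add_natCast_injOn {n : ℕ} (i : ZMod n) {l m : ℕ} (hl : l < n) (hm : m < n)
    (h : i + (l : ZMod n) = i + (m : ZMod n)) : l = m := by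
  have := (ZMod.natCast_eq_natCast_iff' l m n).1 (add_left_cancel h)
  rwa [Nat.mod_eq_of_lt hl, Nat.mod_eq_of_lt hm] at this

/-- A simple polygon with its vertices listed starting from vertex `i`. -/
def SimplePolygon.toCyclicPolygon {n : ℕ} (SP : SimplePolygon n) (i : ZMod n) :
    CyclicPolygon n where
  three_le := SP.three_le
  u m := SP.v (i + (m : ZMod n))
  P := SP.P
  compact := SP.compact
  regular := SP.regular
  closing := by simp
  mem_frontier_iff x := by
    have : NeZero n := ⟨by have := SP.three_le; omega⟩
    rw [SP.frontier_eq, Set.mem_iUnion]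
    constructor
    · rintro ⟨j, hj⟩
      refine ⟨(j - i).val, ZMod.val_lt _, ?_⟩
      push_cast
      rw [ZMod.natCast_zmod_val]
      convert hj using 3 <;> ring
    · rintro ⟨m, _, hm⟩
      refine ⟨i + m, ?_⟩
      push_cast at hm
      rwa [← add_assoc] at hm
  det_ne_zero l m k hl hm hk hlm hlk hmk h := by
    refine SP.no_three_collinear (i + l) (i + m) (i + k) (fun h' => hlm ?_) (fun h' => hlk ?_)
      (fun h' => hmk ?_) (collinear_of_planeDet_eq_zero (fun h' => hlm ?_) h)
    · exact add_natCast_injOn i hl hm h'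
    · exact add_natCast_injOn i hl hk h'
    · exact add_natCast_injOn i hm hk h'
    · exact add_natCast_injOn i hl hm (SP.inj h')
  meet e f hef hfn x hxe hxf := by
    have hn := SP.three_le
    push_cast at hxe hxf
    rw [← add_assoc] at hxe hxf
    by_cases h1 : f = e + 1
    · left
      refine ⟨h1, ?_⟩
      subst h1
      push_cast at hxf ⊢
      rw [← add_assoc] at hxf ⊢
      have := SP.edges_consecutive (i + e)
      exact Set.mem_singleton_iff.1 (this ▸ ⟨hxe, hxf⟩)
    by_cases h2 : e = 0 ∧ f + 1 = n
    · right
      refine ⟨h2.1, h2.2, ?_⟩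
      obtain ⟨rfl, h2⟩ := h2
      have h3 : i + (f : ZMod n) + 1 = i := by
        have : ((f + 1 : ℕ) : ZMod n) = 0 := by rw [h2]; simp
        push_cast at this
        rw [add_assoc, this, add_zero]
      have := SP.edges_consecutive (i + f)
      rw [h3] at this hxf
      simp only [Nat.cast_zero, add_zero] at hxe ⊢
      exact Set.mem_singleton_iff.1 (this ▸ ⟨hxf, hxe⟩)
    · exfalso
      refine Set.disjoint_left.1 (SP.edges_disjoint (i + e) (i + f) ?_ ?_ ?_) hxe hxf
      · intro h
        have := add_natCast_injOn i (by omega) hfn h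
        omega
      · intro h
        have := add_natCast_injOn i (m := e + 1) hfn (by omega) (by push_cast; rw [h, add_assoc])
        omega
      · intro h
        rcases Nat.lt_or_ge (f + 1) n with h3 | h3
        · have := add_natCast_injOn i (l := e) (m := f + 1) (by omega) h3
            (by push_cast; rw [h, add_assoc])
          omega
        · have h4 : f + 1 = n := by omega
          have h5 : ((f + 1 : ℕ) : ZMod n) = 0 := by rw [h4]; simp
          have := add_natCast_injOn i (l := e) (m := 0) (by omega) (by omega) (by
            rw [h, add_assoc, Nat.cast_zero]
            push_cast at h5
            rw [h5])
          omega

/-- Let `j = i + k` with `2 ≤ k ≤ n - 1` and suppose `v i` is visible to `v j`. If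
`v' = v (i + t*)` is the last vertex of the chain `ch(v (i+1), v (j-1))` visible to
`v i` (with `t*` the largest `t ∈ {1, …, k-1}` such that `v (i+t)` is visible to `v i`),
then `v'` is visible to `v j`. -/
theorem last_visible_chain_vertex_visible {n : ℕ} (SP : SimplePolygon n)
    (i : ZMod n) (k : ℕ) (hk2 : 2 ≤ k) (hkn : k ≤ n - 1)
    (hij : Visible SP.P (SP.v i) (SP.v (i + (k : ZMod n))))
    (tstar : ℕ) (ht1 : 1 ≤ tstar) (ht2 : tstar ≤ k - 1)
    (htvis : Visible SP.P (SP.v (i + (tstar : ZMod n))) (SP.v i))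
    (htmax : ∀ t : ℕ, 1 ≤ t → t ≤ k - 1 →
      Visible SP.P (SP.v (i + (t : ZMod n))) (SP.v i) → t ≤ tstar) :
    Visible SP.P (SP.v (i + (tstar : ZMod n))) (SP.v (i + (k : ZMod n))) := by
  have hvis0 : ∀ t : ℕ, Visible SP.P (SP.v (i + (t : ZMod n))) (SP.v i) ↔
      Visible (SP.toCyclicPolygon i).P ((SP.toCyclicPolygon i).u 0)
        ((SP.toCyclicPolygon i).u t) := by
    intro t
    simp only [Visible, SimplePolygon.toCyclicPolygon, Nat.cast_zero, add_zero]
    rw [segment_symm]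
  have hn := SP.three_le
  refine (SP.toCyclicPolygon i).visible_of_consecutive_visible ht1 (by omega) (by omega)
    ((hvis0 _).1 htvis) ((hvis0 _).1 ?_) fun m h1 h2 hv => ?_
  · rwa [Visible, segment_symm]
  · have := htmax m (by omega) (by omega) ((hvis0 m).2 hv)
    omega
end

section
/- Let P be a simple polygon in the plane with vertices v_0, …, v_{n-1} in counterclockwise order (indices mod n), with no three distinct vertices collinear. Let i be an index and j = i + k (mod n) with 2 ≤ k ≤ n − 1, and suppose v_i is visible to v_j. Let t* be the largest t ∈ {1, …, k − 1} such that v_{i+t} is visible to v_i, and set v' = v_{i+t*}. Then the solid triangle conv{v_i, v', v_j} is entirely contained in P. -/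
open Set Filter Topology

/-- The signed area form on the plane. -/
def cross (p q : Plane) : ℝ := p.1 * q.2 - p.2 * q.1

/-- The signed angle under which the oriented segment from `a` to `b` is seen from `x`. -/
noncomputable def viewAngle (a b x : Plane) : ℝ :=
  Complex.arg ⟨(a.1 - x.1) * (b.1 - x.1) + (a.2 - x.2) * (b.2 - x.2),
    (a.1 - x.1) * (b.2 - x.2) - (a.2 - x.2) * (b.1 - x.1)⟩

theorem mem_segment_of_cross_eq_zero {a b x : Plane}
    (hc : (a.1 - x.1) * (b.2 - x.2) - (a.2 - x.2) * (b.1 - x.1) = 0)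
    (hd : (a.1 - x.1) * (b.1 - x.1) + (a.2 - x.2) * (b.2 - x.2) ≤ 0) :
    x ∈ segment ℝ a b := by
  by_cases hab : a = b
  · subst hab
    have h1 : a.1 - x.1 = 0 := by nlinarith [sq_nonneg (a.1 - x.1), sq_nonneg (a.2 - x.2)]
    have h2 : a.2 - x.2 = 0 := by nlinarith [sq_nonneg (a.1 - x.1), sq_nonneg (a.2 - x.2)]
    have : x = a := Prod.ext (by linarith) (by linarith)
    rw [this]
    exact left_mem_segment ℝ a a
  have hpos : 0 < (b.1 - a.1) ^ 2 + (b.2 - a.2) ^ 2 := by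
    by_contra! hle
    apply hab
    refine Prod.ext ?_ ?_
    · nlinarith [sq_nonneg (b.1 - a.1), sq_nonneg (b.2 - a.2)]
    · nlinarith [sq_nonneg (b.1 - a.1), sq_nonneg (b.2 - a.2)]
  set L := (b.1 - a.1) ^ 2 + (b.2 - a.2) ^ 2 with hL
  set N := (b.1 - a.1) * (x.1 - a.1) + (b.2 - a.2) * (x.2 - a.2) with hN
  rw [segment_eq_image']
  refine ⟨N / L, ⟨?_, ?_⟩, ?_⟩
  · apply div_nonneg _ hpos.le
    nlinarith [sq_nonneg (a.1 - x.1), sq_nonneg (a.2 - x.2)]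
  · rw [div_le_one hpos]
    nlinarith [sq_nonneg (b.1 - x.1), sq_nonneg (b.2 - x.2)]
  · have hL0 := hpos.ne'
    refine Prod.ext ?_ ?_
    · simp only [Prod.fst_add, Prod.smul_fst, Prod.fst_sub, smul_eq_mul]
      have : N * (b.1 - a.1) = L * (x.1 - a.1) := by
        rw [hN, hL]; linear_combination (b.2 - a.2) * hc
      field_simp
      linarith
    · simp only [Prod.snd_add, Prod.smul_snd, Prod.snd_sub, smul_eq_mul]
      have : N * (b.2 - a.2) = L * (x.2 - a.2) := by
        rw [hN, hL]; linear_combination (-(b.1 - a.1)) * hc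
      field_simp
      linarith

theorem continuousAt_viewAngle_s3 {a b x : Plane} (hx : x ∉ segment ℝ a b) :
    ContinuousAt (viewAngle a b) x := by
  unfold viewAngle
  have hmem : (⟨(a.1 - x.1) * (b.1 - x.1) + (a.2 - x.2) * (b.2 - x.2),
      (a.1 - x.1) * (b.2 - x.2) - (a.2 - x.2) * (b.1 - x.1)⟩ : ℂ) ∈ Complex.slitPlane := by
    rw [Complex.mem_slitPlane_iff]
    by_contra! h
    exact hx (mem_segment_of_cross_eq_zero h.2 h.1)
  refine (Complex.continuousAt_arg hmem).comp (f := fun x : Plane =>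
    (⟨(a.1 - x.1) * (b.1 - x.1) + (a.2 - x.2) * (b.2 - x.2),
      (a.1 - x.1) * (b.2 - x.2) - (a.2 - x.2) * (b.1 - x.1)⟩ : ℂ)) ?_
  refine Continuous.continuousAt ?_
  refine (Complex.equivRealProdCLM.symm.continuous.comp (f := fun x : Plane =>
    (((a.1 - x.1) * (b.1 - x.1) + (a.2 - x.2) * (b.2 - x.2),
      (a.1 - x.1) * (b.2 - x.2) - (a.2 - x.2) * (b.1 - x.1)) : ℝ × ℝ)) (by fun_prop)).congr ?_
  intro y
  apply Complex.ext <;> simp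

/-- The direction of a point seen from `x`, as a complex number. -/
def sight (x a : Plane) : ℂ := ⟨a.1 - x.1, a.2 - x.2⟩

theorem viewAngle_eq (a b x : Plane) :
    viewAngle a b x = Complex.arg (sight x b * (starRingEnd ℂ) (sight x a)) := by
  unfold viewAngle sight
  congr 1
  apply Complex.ext <;> simp <;> ring

theorem sight_ne_zero {x a : Plane} (h : x ≠ a) : sight x a ≠ 0 := by
  intro h0
  apply h
  have h1 := congrArg Complex.re h0
  have h2 := congrArg Complex.im h0
  simp only [sight, Complex.zero_re, Complex.zero_im] at h1 h2
  exact Prod.ext (by linarith) (by linarith)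

theorem viewAngle_coe {a b x : Plane} (ha : x ≠ a) (hb : x ≠ b) :
    (viewAngle a b x : Real.Angle) = (sight x b).arg - (sight x a).arg := by
  rw [viewAngle_eq, Complex.arg_mul_coe_angle (sight_ne_zero hb)
    (by simpa using sight_ne_zero ha), Complex.arg_conj_coe_angle, sub_eq_add_neg]

theorem viewAngle_eq_sub {a b x : Plane} (ha : x.1 < a.1) (hb : x.1 < b.1) :
    viewAngle a b x = (sight x b).arg - (sight x a).arg := by
  have key : ∀ p : Plane, x.1 < p.1 → |(sight x p).arg| < Real.pi / 2 := by
    intro p hp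
    rw [Complex.abs_arg_lt_pi_div_two_iff]
    left
    simp only [sight]
    linarith
  have hna : x ≠ a := by rintro rfl; exact lt_irrefl _ ha
  have hnb : x ≠ b := by rintro rfl; exact lt_irrefl _ hb
  have h1 := abs_lt.1 (key a ha)
  have h2 := abs_lt.1 (key b hb)
  have hconj : ((starRingEnd ℂ) (sight x a)).arg = -(sight x a).arg := by
    rw [Complex.arg_conj, if_neg]
    intro h
    have := Real.pi_pos
    linarith
  rw [viewAngle_eq, Complex.arg_mul (sight_ne_zero hnb) (by simpa using sight_ne_zero hna), hconj,
    sub_eq_add_neg]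
  rw [hconj]
  constructor <;> linarith

/-- The closed polygonal loop `a, u s, u (s + 1), …, u k, a`. -/
def loop (a : Plane) (u : ℕ → Plane) (s k : ℕ) : Set Plane :=
  segment ℝ a (u s) ∪ (⋃ m ∈ Finset.Ico s k, segment ℝ (u m) (u (m + 1))) ∪ segment ℝ (u k) a

/-- The total angle swept by the loop `a, u s, …, u k, a` as seen from `x`. -/
noncomputable def loopAngle (a : Plane) (u : ℕ → Plane) (s k : ℕ) (x : Plane) : ℝ :=
  viewAngle a (u s) x + ∑ m ∈ Finset.Ico s k, viewAngle (u m) (u (m + 1)) x + viewAngle (u k) a x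

theorem notMem_loop {a : Plane} {u : ℕ → Plane} {s k : ℕ} {x : Plane} :
    x ∉ loop a u s k ↔ x ∉ segment ℝ a (u s) ∧
      (∀ m, s ≤ m → m < k → x ∉ segment ℝ (u m) (u (m + 1))) ∧ x ∉ segment ℝ (u k) a := by
  simp only [loop, mem_union, mem_iUnion, Finset.mem_Ico, not_or, not_exists, and_assoc,
    exists_prop, not_and]

theorem continuousAt_loopAngle {a : Plane} {u : ℕ → Plane} {s k : ℕ} {x : Plane}
    (hx : x ∉ loop a u s k) : ContinuousAt (loopAngle a u s k) x := by
  obtain ⟨h1, h2, h3⟩ := notMem_loop.1 hx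
  unfold loopAngle
  refine ((continuousAt_viewAngle_s3 h1).add (tendsto_finsetSum _ fun m hm => ?_)).add
    (continuousAt_viewAngle_s3 h3)
  rw [Finset.mem_Ico] at hm
  exact continuousAt_viewAngle_s3 (h2 m hm.1 hm.2)

theorem exists_loopAngle_eq {a : Plane} {u : ℕ → Plane} {s k : ℕ} (hsk : s ≤ k) {x : Plane}
    (hx : x ∉ loop a u s k) : ∃ N : ℤ, loopAngle a u s k x = 2 * Real.pi * N := by
  obtain ⟨h1, h2, h3⟩ := notMem_loop.1 hx
  have ha : x ≠ a := by rintro rfl; exact h1 (left_mem_segment ℝ _ _)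
  have hs : x ≠ u s := by rintro rfl; exact h1 (right_mem_segment ℝ _ _)
  have hk : x ≠ u k := by rintro rfl; exact h3 (left_mem_segment ℝ _ _)
  have : ((loopAngle a u s k x : ℝ) : Real.Angle) = (0 : ℝ) := by
    unfold loopAngle
    rw [Real.Angle.coe_add, Real.Angle.coe_add, viewAngle_coe ha hs, viewAngle_coe hk ha]
    have hsum : ((∑ m ∈ Finset.Ico s k, viewAngle (u m) (u (m + 1)) x : ℝ) : Real.Angle)
        = (sight x (u k)).arg - (sight x (u s)).arg := by
      have hmap := map_sum Real.Angle.coeHom (fun m => viewAngle (u m) (u (m + 1)) x)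
        (Finset.Ico s k)
      simp only [Real.Angle.coe_coeHom] at hmap
      rw [hmap, ← Finset.sum_Ico_sub
        (fun m => ((sight x (u m)).arg : Real.Angle)) hsk]
      refine Finset.sum_congr rfl fun m hm => ?_
      rw [Finset.mem_Ico] at hm
      have := h2 m hm.1 hm.2
      rw [viewAngle_coe]
      · rintro rfl; exact this (left_mem_segment ℝ _ _)
      · rintro rfl; exact this (right_mem_segment ℝ _ _)
    rw [hsum, Real.Angle.coe_zero]
    abel
  obtain ⟨N, hN⟩ := Real.Angle.angle_eq_iff_two_pi_dvd_sub.1 this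
  exact ⟨N, by linarith⟩

theorem loopAngle_eq_zero {a : Plane} {u : ℕ → Plane} {s k : ℕ} (hsk : s ≤ k) {x : Plane}
    (ha : x.1 < a.1) (hu : ∀ m, x.1 < (u m).1) : loopAngle a u s k x = 0 := by
  unfold loopAngle
  have hsum : ∑ m ∈ Finset.Ico s k, viewAngle (u m) (u (m + 1)) x
      = (sight x (u k)).arg - (sight x (u s)).arg := by
    rw [← Finset.sum_Ico_sub (fun m => (sight x (u m)).arg) hsk]
    exact Finset.sum_congr rfl fun m _ => viewAngle_eq_sub (hu m) (hu (m + 1))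
  rw [hsum, viewAngle_eq_sub ha (hu s), viewAngle_eq_sub (hu k) ha]
  ring

theorem loopAngle_const {a : Plane} {u : ℕ → Plane} {s k : ℕ} (hsk : s ≤ k) {S : Set Plane}
    (hS : IsPreconnected S) (hd : ∀ x ∈ S, x ∉ loop a u s k) {x y : Plane} (hx : x ∈ S)
    (hy : y ∈ S) : loopAngle a u s k x = loopAngle a u s k y := by
  have : DiscreteTopology (range ((↑) : ℤ → ℝ)) :=
    Int.isClosedEmbedding_coe_real.isEmbedding.toHomeomorph.symm.isEmbedding.discreteTopology
  have hcont : ContinuousOn (fun x => loopAngle a u s k x / (2 * Real.pi)) S := fun z hz =>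
    ((continuousAt_loopAngle (hd z hz)).div_const _).continuousWithinAt
  have := hS.constant_of_mapsTo (T := range ((↑) : ℤ → ℝ)) ⟨this⟩ hcont (fun z hz => by
    obtain ⟨N, hN⟩ := exists_loopAngle_eq hsk (hd z hz)
    refine ⟨N, ?_⟩
    have := Real.pi_pos
    simp only
    rw [hN]
    field_simp) hx hy
  have hpi := Real.pi_pos
  field_simp at this
  exact this

/-- The loop angle takes different values on the two sides of the segment from `a` to `u s`. -/
theorem eventually_loopAngle_ne {a : Plane} {u : ℕ → Plane} {s k : ℕ} (hab : a ≠ u s)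
    {z e : Plane} (hz : z = (1 / 2 : ℝ) • (a + u s))
    (he : e = (a.2 - (u s).2, (u s).1 - a.1))
    (hK : ∀ m, s ≤ m → m < k → z ∉ segment ℝ (u m) (u (m + 1))) (hc : z ∉ segment ℝ (u k) a) :
    ∀ᶠ t in 𝓝 (0 : ℝ), 0 < t →
      loopAngle a u s k (z + t • e) ≠ loopAngle a u s k (z + (-t) • e) := by
  set b := u s with hb
  have hpos : 0 < (b.1 - a.1) ^ 2 + (b.2 - a.2) ^ 2 := by
    by_contra! hle
    apply hab
    refine Prod.ext ?_ ?_
    · nlinarith [sq_nonneg (b.1 - a.1), sq_nonneg (b.2 - a.2)]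
    · nlinarith [sq_nonneg (b.1 - a.1), sq_nonneg (b.2 - a.2)]
  set G : Plane → ℝ := fun x =>
    ∑ m ∈ Finset.Ico s k, viewAngle (u m) (u (m + 1)) x + viewAngle (u k) a x with hG
  have hGc : ContinuousAt G z := by
    refine (tendsto_finsetSum _ fun m hm => ?_).add (continuousAt_viewAngle_s3 hc)
    rw [Finset.mem_Ico] at hm
    exact continuousAt_viewAngle_s3 (hK m hm.1 hm.2)
  have hlim : Tendsto (fun t : ℝ => G (z + t • e) - G (z + (-t) • e)) (𝓝 0) (𝓝 0) := by
    have l1 : Tendsto (fun t : ℝ => z + t • e) (𝓝 0) (𝓝 z) := by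
      have : Continuous (fun t : ℝ => z + t • e) := by fun_prop
      simpa using this.tendsto 0
    have l2 : Tendsto (fun t : ℝ => z + (-t) • e) (𝓝 0) (𝓝 z) := by
      have : Continuous (fun t : ℝ => z + (-t) • e) := by fun_prop
      simpa using this.tendsto 0
    simpa using (hGc.tendsto.comp l1).sub (hGc.tendsto.comp l2)
  have hpi := Real.pi_pos
  have hsmall : ∀ᶠ t : ℝ in 𝓝 0, t < 1 / 2 := eventually_lt_nhds (by norm_num)
  filter_upwards [hlim.eventually (lt_mem_nhds (show -Real.pi < 0 by linarith)), hsmall]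
    with t ht hts ht0 heq
  have hloop : ∀ x, loopAngle a u s k x = viewAngle a b x + G x := fun x => by
    simp only [loopAngle, hG, hb]; ring
  have hre : ∀ r : ℝ, |r| < 1 / 2 → |viewAngle a b (z + r • e)| > Real.pi / 2 := by
    intro r hr
    by_contra! hle
    unfold viewAngle at hle
    rw [Complex.abs_arg_le_pi_div_two_iff] at hle
    subst hz he
    simp at hle
    have h4 : r ^ 2 < 1 / 4 := by
      have := sq_lt_sq' (abs_lt.1 hr).1 (abs_lt.1 hr).2
      linarith
    nlinarith
  have him : ∀ r : ℝ, (⟨(a.1 - (z + r • e).1) * (b.1 - (z + r • e).1) +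
        (a.2 - (z + r • e).2) * (b.2 - (z + r • e).2),
      (a.1 - (z + r • e).1) * (b.2 - (z + r • e).2) -
        (a.2 - (z + r • e).2) * (b.1 - (z + r • e).1)⟩ : ℂ).im
      = r * ((b.1 - a.1) ^ 2 + (b.2 - a.2) ^ 2) := by
    intro r
    subst hz he
    simp
    ring
  have hp : 0 ≤ viewAngle a b (z + t • e) := by
    unfold viewAngle
    rw [Complex.arg_nonneg_iff, him]
    positivity
  have hn : viewAngle a b (z + (-t) • e) < 0 := by
    unfold viewAngle
    rw [Complex.arg_neg_iff, him]
    nlinarith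
  have h1 := hre t (by rw [abs_of_pos ht0]; exact hts)
  have h2 := hre (-t) (by rw [abs_neg, abs_of_pos ht0]; exact hts)
  rw [abs_of_nonneg hp] at h1
  rw [abs_of_neg hn] at h2
  rw [hloop, hloop] at heq
  linarith

theorem convex_setOf_pos {f : Plane → ℝ}
    (hf : ∀ x y (a b : ℝ), a + b = 1 → f (a • x + b • y) = a * f x + b * f y) :
    Convex ℝ {y | 0 < f y} := by
  intro x hx y hy a b ha hb hab
  simp only [mem_ofPred_eq] at *
  rw [hf x y a b hab]
  rcases ha.eq_or_lt with rfl | ha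
  · have : b = 1 := by linarith
    subst this
    linarith
  · have := mul_pos ha hx
    have := mul_nonneg hb hy.le
    linarith

theorem IsPreconnected.subset_interior_or_compl {P S : Set Plane} (hP : IsClosed P)
    (hS : IsPreconnected S) (hd : ∀ x ∈ S, x ∉ frontier P) : S ⊆ interior P ∨ S ⊆ Pᶜ := by
  refine hS.subset_or_subset isOpen_interior hP.isOpen_compl ?_ ?_
  · exact disjoint_compl_right.mono_left interior_subset
  · intro x hx
    by_cases hxP : x ∈ P
    · left
      by_contra hn
      exact hd x hx ⟨subset_closure hxP, hn⟩
    · exact Or.inr hxP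

/-- If a neighbourhood with the frontier removed has two preconnected pieces, one of which must
lie inside, then the outside part of the neighbourhood is preconnected. -/
theorem isPreconnected_inter_compl {P B A₁ A₂ : Set Plane} (hP : IsClosed P) (hB : IsOpen B)
    {p : Plane} (hp : p ∈ B) (hpP : p ∈ closure (interior P)) (h₁ : IsPreconnected A₁)
    (h₂ : IsPreconnected A₂) (hB₁ : A₁ ⊆ B) (hB₂ : A₂ ⊆ B)
    (hd₁ : ∀ x ∈ A₁, x ∉ frontier P) (hd₂ : ∀ x ∈ A₂, x ∉ frontier P)
    (hcov : ∀ x ∈ B, x ∉ frontier P → x ∈ A₁ ∨ x ∈ A₂) : IsPreconnected (B ∩ Pᶜ) := by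
  have hout : ∀ x ∈ B ∩ Pᶜ, x ∈ A₁ ∨ x ∈ A₂ := fun x hx =>
    hcov x hx.1 fun hf => hx.2 (hP.frontier_subset hf)
  obtain ⟨q, hqB, hqP⟩ := mem_closure_iff.1 hpP B hB hp
  have hqf : q ∉ frontier P := fun h => h.2 hqP
  have hq := hcov q hqB hqf
  rcases h₁.subset_interior_or_compl hP hd₁ with k₁ | k₁ <;>
    rcases h₂.subset_interior_or_compl hP hd₂ with k₂ | k₂
  · convert isPreconnected_empty
    refine eq_empty_of_forall_notMem fun x hx => ?_
    rcases hout x hx with h | h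
    · exact hx.2 (interior_subset (k₁ h))
    · exact hx.2 (interior_subset (k₂ h))
  · convert h₂
    refine Subset.antisymm (fun x hx => ?_) (subset_inter hB₂ k₂)
    rcases hout x hx with h | h
    · exact absurd (interior_subset (k₁ h)) hx.2
    · exact h
  · convert h₁
    refine Subset.antisymm (fun x hx => ?_) (subset_inter hB₁ k₁)
    rcases hout x hx with h | h
    · exact h
    · exact absurd (interior_subset (k₂ h)) hx.2
  · rcases hq with h | h
    · exact absurd (interior_subset hqP) (k₁ h)
    · exact absurd (interior_subset hqP) (k₂ h)

/-- A compact set whose frontier is preconnected and whose complement is locally preconnected along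
the frontier has a preconnected complement. -/
theorem isPreconnected_compl_of_frontier {P : Set Plane} (hP : IsCompact P)
    (hPne : P.Nonempty) (hf : IsPreconnected (frontier P))
    (hloc : ∀ p ∈ frontier P, ∃ B, IsOpen B ∧ p ∈ B ∧ IsPreconnected (B ∩ Pᶜ)) :
    IsPreconnected Pᶜ := by
  have hopen : IsOpen Pᶜ := hP.isClosed.isOpen_compl
  have hreach : ∀ z ∈ Pᶜ, ∀ u v : Set Plane, IsOpen u → IsOpen v → Pᶜ ⊆ u ∪ v →
      Pᶜ ∩ (u ∩ v) = ∅ → z ∈ u → ∃ p ∈ frontier P, p ∈ closure (Pᶜ ∩ u) := by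
    intro z hz u v hu hv huv hdis hzu
    obtain ⟨p, hpP, hp⟩ := hP.exists_infDist_eq_dist hPne z
    have hsub : ∀ t : ℝ, 0 < t → t ≤ 1 → p + t • (z - p) ∈ Pᶜ := by
      intro t ht0 ht1 hmem
      have h1 := Metric.infDist_le_dist_of_mem (x := z) hmem
      rw [hp, dist_eq_norm, dist_eq_norm] at h1
      have h2 : z - (p + t • (z - p)) = (1 - t) • (z - p) := by module
      rw [h2, norm_smul, Real.norm_of_nonneg (by linarith)] at h1
      have h3 : 0 < ‖z - p‖ := by
        rw [norm_pos_iff, sub_ne_zero]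
        rintro rfl
        exact hz hpP
      nlinarith
    have hconn : IsPreconnected ((fun t : ℝ => p + t • (z - p)) '' Ioc 0 1) :=
      isPreconnected_Ioc.image _ (by fun_prop)
    have hin : (fun t : ℝ => p + t • (z - p)) '' Ioc 0 1 ⊆ Pᶜ := by
      rintro _ ⟨t, ht, rfl⟩
      exact hsub t ht.1 ht.2
    have hz' : z ∈ (fun t : ℝ => p + t • (z - p)) '' Ioc 0 1 :=
      ⟨1, by norm_num, by simp⟩
    have hall : (fun t : ℝ => p + t • (z - p)) '' Ioc 0 1 ⊆ u := by
      refine hconn.subset_left_of_subset_union (hopen.inter hu) (hopen.inter hv) ?_ ?_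
        ⟨z, hz', hz, hzu⟩ |>.trans inter_subset_right
      · rw [disjoint_iff_inter_eq_empty, ← inter_inter_distrib_left, hdis]
      · rw [← inter_union_distrib_left]
        exact subset_inter hin (hin.trans huv)
    have hpcl : p ∈ closure (Pᶜ ∩ u) := by
      have hlim : Tendsto (fun t : ℝ => p + t • (z - p)) (𝓝[>] 0) (𝓝 p) := by
        have : Continuous (fun t : ℝ => p + t • (z - p)) := by fun_prop
        simpa using (this.tendsto 0).mono_left nhdsWithin_le_nhds
      refine mem_closure_of_tendsto hlim ?_
      filter_upwards [Ioc_mem_nhdsGT (show (0 : ℝ) < 1 by norm_num)] with t ht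
      exact ⟨hsub t ht.1 ht.2, hall ⟨t, ht, rfl⟩⟩
    refine ⟨p, ?_, hpcl⟩
    rw [frontier_eq_closure_inter_closure]
    exact ⟨subset_closure hpP, closure_mono inter_subset_left hpcl⟩
  intro u v hu hv huv ⟨z, hz, hzu⟩ ⟨w, hw, hwv⟩
  by_contra hdis
  rw [not_nonempty_iff_eq_empty] at hdis
  have hdis' : Pᶜ ∩ (v ∩ u) = ∅ := by rwa [inter_comm v u]
  obtain ⟨p, hpf, hp⟩ := hreach z hz u v hu hv huv hdis hzu
  obtain ⟨q, hqf, hq⟩ := hreach w hw v u hv hu (by rwa [union_comm]) hdis' hwv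
  obtain ⟨r, hrf, hru, hrv⟩ := (isPreconnected_closed_iff.1 hf) (closure (Pᶜ ∩ u))
    (closure (Pᶜ ∩ v)) isClosed_closure isClosed_closure (by
      rw [← closure_union, ← inter_union_distrib_left, inter_eq_left.2 huv,
        frontier_eq_closure_inter_closure]
      exact inter_subset_right) ⟨p, hpf, hp⟩ ⟨q, hqf, hq⟩
  obtain ⟨B, hB, hrB, hBP⟩ := hloc r hrf
  obtain ⟨x, hxB, hxP, hxu⟩ := mem_closure_iff.1 hru B hB hrB
  obtain ⟨y, hyB, hyP, hyv⟩ := mem_closure_iff.1 hrv B hB hrB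
  obtain ⟨t, ⟨-, htP⟩, htuv⟩ := hBP u v hu hv (inter_subset_right.trans huv) ⟨x, ⟨hxB, hxP⟩, hxu⟩
    ⟨y, ⟨hyB, hyP⟩, hyv⟩
  exact (hdis ▸ (⟨htP, htuv⟩ : t ∈ Pᶜ ∩ (u ∩ v)) : t ∈ (∅ : Set Plane))

/-- Affine coordinates with origin `p` and axes `d₁`, `d₂`. -/
theorem exists_affine_coordinates (p : Plane) {d₁ d₂ : Plane} (hc : cross d₁ d₂ ≠ 0) :
    ∃ S T : Plane → ℝ, Continuous S ∧ Continuous T ∧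
      (∀ x y (a b : ℝ), a + b = 1 → S (a • x + b • y) = a * S x + b * S y) ∧
      (∀ x y (a b : ℝ), a + b = 1 → T (a • x + b • y) = a * T x + b * T y) ∧
      (∀ y, y = p + S y • d₁ + T y • d₂) ∧
      (∀ s t : ℝ, S (p + s • d₁ + t • d₂) = s) ∧ (∀ s t : ℝ, T (p + s • d₁ + t • d₂) = t) := by
  refine ⟨fun y => cross (y - p) d₂ / cross d₁ d₂, fun y => cross d₁ (y - p) / cross d₁ d₂,
    ?_, ?_, ?_, ?_, ?_, ?_, ?_⟩
  · simp only [cross]; fun_prop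
  · simp only [cross]; fun_prop
  · intro x y a b hab
    have : b = 1 - a := by linarith
    subst this
    simp [cross]
    ring
  · intro x y a b hab
    have : b = 1 - a := by linarith
    subst this
    simp [cross]
    ring
  · intro y
    refine Prod.ext ?_ ?_
    · simp only [Prod.fst_add, Prod.smul_fst, smul_eq_mul]
      field_simp
      simp only [cross, Prod.fst_sub, Prod.snd_sub]
      ring
    · simp only [Prod.snd_add, Prod.smul_snd, smul_eq_mul]
      field_simp
      simp only [cross, Prod.fst_sub, Prod.snd_sub]
      ring
  · intro s t
    simp only
    rw [div_eq_iff hc]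
    simp only [cross, Prod.fst_sub, Prod.snd_sub, Prod.fst_add, Prod.snd_add, Prod.smul_fst,
      Prod.smul_snd, smul_eq_mul]
    ring
  · intro s t
    simp only
    rw [div_eq_iff hc]
    simp only [cross, Prod.fst_sub, Prod.snd_sub, Prod.fst_add, Prod.snd_add, Prod.smul_fst,
      Prod.smul_snd, smul_eq_mul]
    ring

namespace SimplePolygon

variable {n : ℕ} (SP : SimplePolygon n)

theorem neZero {n : ℕ} (SP : SimplePolygon n) : NeZero n := ⟨by have := SP.three_le; omega⟩

theorem one_ne_zero {n : ℕ} (SP : SimplePolygon n) : (1 : ZMod n) ≠ 0 := by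
  have := SP.three_le
  have : Fact (1 < n) := ⟨by omega⟩
  exact _root_.one_ne_zero

theorem two_ne_zero {n : ℕ} (SP : SimplePolygon n) : (1 + 1 : ZMod n) ≠ 0 := by
  have h3 := SP.three_le
  intro h
  have h2 : ((2 : ℕ) : ZMod n) = 0 := by push_cast; rw [← h]; norm_num
  rw [ZMod.natCast_eq_zero_iff] at h2
  exact absurd (Nat.le_of_dvd (by norm_num) h2) (by omega)

theorem cross_ne_zero {α β γ : ZMod n} (h₁ : α ≠ β) (h₂ : α ≠ γ) (h₃ : β ≠ γ) :
    cross (SP.v β - SP.v α) (SP.v γ - SP.v α) ≠ 0 := by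
  intro h
  apply SP.no_three_collinear α β γ h₁ h₂ h₃
  have hne : SP.v β - SP.v α ≠ 0 := sub_ne_zero.2 fun h => h₁ (SP.inj h).symm
  rw [collinear_iff_of_mem (p₀ := SP.v α) (by simp)]
  refine ⟨SP.v β - SP.v α, ?_⟩
  have key : ∃ r : ℝ, SP.v γ - SP.v α = r • (SP.v β - SP.v α) := by
    generalize SP.v γ - SP.v α = q at *
    generalize SP.v β - SP.v α = p at *
    simp only [cross] at h
    by_cases hp : p.1 = 0
    · have hp2 : p.2 ≠ 0 := fun h2 => hne (Prod.ext hp h2)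
      refine ⟨q.2 / p.2, Prod.ext ?_ ?_⟩
      · simp only [Prod.smul_fst, smul_eq_mul]
        rw [hp] at h ⊢
        have : p.2 * q.1 = 0 := by linarith
        rcases mul_eq_zero.1 this with h' | h'
        · exact absurd h' hp2
        · simp [h']
      · simp only [Prod.smul_snd, smul_eq_mul]
        field_simp
    · refine ⟨q.1 / p.1, Prod.ext ?_ ?_⟩
      · simp only [Prod.smul_fst, smul_eq_mul]
        field_simp
      · simp only [Prod.smul_snd, smul_eq_mul]
        field_simp
        linarith
  obtain ⟨r, hr⟩ := key
  intro p hp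
  simp only [mem_insert_iff, mem_singleton_iff] at hp
  rcases hp with rfl | rfl | rfl
  · exact ⟨0, by simp⟩
  · exact ⟨1, by simp⟩
  · exact ⟨r, by rw [← hr]; simp⟩

theorem isClosed : IsClosed SP.P := SP.compact.isClosed

theorem segment_subset (m : ZMod n) : segment ℝ (SP.v m) (SP.v (m + 1)) ⊆ SP.P :=
  ((subset_iUnion (fun m => segment ℝ (SP.v m) (SP.v (m + 1))) m).trans SP.frontier_eq.ge).trans
    SP.isClosed.frontier_subset

theorem v_ne_succ (m : ZMod n) : SP.v m ≠ SP.v (m + 1) := fun h =>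
  SP.one_ne_zero (by simpa using SP.inj h)

theorem notMem_segment_of_mem_openSegment {l m : ZMod n} (hlm : l ≠ m) {z : Plane}
    (hz : z ∈ openSegment ℝ (SP.v m) (SP.v (m + 1))) :
    z ∉ segment ℝ (SP.v l) (SP.v (l + 1)) := by
  intro hl
  have hm := openSegment_subset_segment ℝ _ _ hz
  by_cases h1 : m = l + 1
  · subst h1
    have : z ∈ ({SP.v (l + 1)} : Set Plane) := SP.edges_consecutive l ▸ ⟨hl, hm⟩
    rw [mem_singleton_iff] at this
    subst this
    exact SP.v_ne_succ _ (left_mem_openSegment_iff.1 hz)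
  by_cases h2 : l = m + 1
  · subst h2
    have : z ∈ ({SP.v (m + 1)} : Set Plane) := SP.edges_consecutive m ▸ ⟨hm, hl⟩
    rw [mem_singleton_iff] at this
    subst this
    exact SP.v_ne_succ _ (right_mem_openSegment_iff.1 hz)
  · exact disjoint_left.1 (SP.edges_disjoint l m hlm h1 h2) hl hm

theorem v_notMem_segment {l m : ZMod n} (h₁ : l ≠ m) (h₂ : l + 1 ≠ m) :
    SP.v m ∉ segment ℝ (SP.v l) (SP.v (l + 1)) := by
  intro hl
  have hm : SP.v m ∈ segment ℝ (SP.v m) (SP.v (m + 1)) := left_mem_segment ℝ _ _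
  by_cases h3 : l = m + 1
  · subst h3
    have : SP.v m ∈ ({SP.v (m + 1)} : Set Plane) := SP.edges_consecutive m ▸ ⟨hm, hl⟩
    exact SP.v_ne_succ _ this
  · exact disjoint_left.1 (SP.edges_disjoint l m h₁ (Ne.symm h₂) h3) hl hm

theorem eventually_notMem_segment {s : Set (ZMod n)} {z : Plane}
    (hz : ∀ l ∉ s, z ∉ segment ℝ (SP.v l) (SP.v (l + 1))) :
    ∀ᶠ y in 𝓝 z, ∀ l ∉ s, y ∉ segment ℝ (SP.v l) (SP.v (l + 1)) := by
  have := SP.neZero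
  rw [eventually_all]
  intro l
  by_cases hl : l ∈ s
  · simp [hl]
  · have hcl : IsClosed (segment ℝ (SP.v l) (SP.v (l + 1))) := by
      rw [segment_eq_image']
      exact (isCompact_Icc.image (by fun_prop)).isClosed
    filter_upwards [hcl.isOpen_compl.mem_nhds (hz l hl)] with y hy _
    exact hy

theorem mem_frontier_iff {y : Plane} :
    y ∈ frontier SP.P ↔ ∃ m, y ∈ segment ℝ (SP.v m) (SP.v (m + 1)) := by
  rw [SP.frontier_eq, mem_iUnion]

theorem cross_eq_zero_of_mem_segment {a b z y : Plane} (hz : z ∈ segment ℝ a b)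
    (hy : y ∈ segment ℝ a b) : cross (b - a) (y - z) = 0 := by
  rw [segment_eq_image'] at hz hy
  obtain ⟨s, -, rfl⟩ := hz
  obtain ⟨t, -, rfl⟩ := hy
  simp [cross]
  ring

/-- Near an interior point of an edge the frontier is the line supporting the edge. -/
theorem exists_ball_inter_frontier {m : ZMod n} {z : Plane}
    (hz : z ∈ openSegment ℝ (SP.v m) (SP.v (m + 1))) :
    ∃ r > 0, ∀ y ∈ Metric.ball z r,
      (y ∈ frontier SP.P ↔ cross (SP.v (m + 1) - SP.v m) (y - z) = 0) := by
  have hev := SP.eventually_notMem_segment (s := {m}) (z := z) fun l hl =>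
    SP.notMem_segment_of_mem_openSegment hl hz
  set a := SP.v m with ha
  set b := SP.v (m + 1) with hb
  have hab : a ≠ b := SP.v_ne_succ m
  have hdot : (a.1 - z.1) * (b.1 - z.1) + (a.2 - z.2) * (b.2 - z.2) < 0 := by
    rw [openSegment_eq_image'] at hz
    obtain ⟨t, ht, rfl⟩ := hz
    have hpos : 0 < (b.1 - a.1) ^ 2 + (b.2 - a.2) ^ 2 := by
      by_contra! hle
      apply hab
      refine Prod.ext ?_ ?_
      · nlinarith [sq_nonneg (b.1 - a.1), sq_nonneg (b.2 - a.2)]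
      · nlinarith [sq_nonneg (b.1 - a.1), sq_nonneg (b.2 - a.2)]
    have := mul_pos (mul_pos ht.1 (sub_pos.2 ht.2)) hpos
    simp
    linarith
  have hev2 : ∀ᶠ y : Plane in 𝓝 z,
      (a.1 - y.1) * (b.1 - y.1) + (a.2 - y.2) * (b.2 - y.2) < 0 := by
    have : Continuous fun y : Plane => (a.1 - y.1) * (b.1 - y.1) + (a.2 - y.2) * (b.2 - y.2) := by
      fun_prop
    exact this.continuousAt.eventually (gt_mem_nhds hdot)
  obtain ⟨r, hr, hball⟩ := Metric.eventually_nhds_iff_ball.1 (hev.and hev2)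
  have hzs := openSegment_subset_segment ℝ _ _ hz
  refine ⟨r, hr, fun y hy => ?_⟩
  obtain ⟨h1, h2⟩ := hball y hy
  rw [SP.mem_frontier_iff]
  constructor
  · rintro ⟨l, hl⟩
    have : l = m := by
      by_contra hne
      exact h1 l hne hl
    subst this
    exact cross_eq_zero_of_mem_segment hzs hl
  · intro hc
    refine ⟨m, mem_segment_of_cross_eq_zero ?_ h2.le⟩
    have h3 := cross_eq_zero_of_mem_segment hzs (left_mem_segment ℝ a b)
    simp only [cross, Prod.fst_sub, Prod.snd_sub] at hc h3
    linarith

theorem mem_closure_interior {y : Plane} (hy : y ∈ SP.P) : y ∈ closure (interior SP.P) := by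
  rw [← SP.regular]
  exact hy

theorem convex_side (d z : Plane) (r : ℝ) :
    Convex ℝ ({y | 0 < cross d (y - z)} ∩ Metric.ball z r) := by
  refine (convex_setOf_pos fun x y a b hab => ?_).inter (convex_ball z r)
  have : b = 1 - a := by linarith
  subst this
  simp [cross]
  ring

theorem cross_neg_left (d y : Plane) : cross (-d) y = -cross d y := by
  simp [cross]
  ring

theorem exists_preconnected_of_mem_openSegment {m : ZMod n} {z : Plane}
    (hz : z ∈ openSegment ℝ (SP.v m) (SP.v (m + 1))) :
    ∃ B, IsOpen B ∧ z ∈ B ∧ IsPreconnected (B ∩ SP.Pᶜ) := by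
  obtain ⟨r, hr, h⟩ := SP.exists_ball_inter_frontier hz
  set d := SP.v (m + 1) - SP.v m
  refine ⟨Metric.ball z r, Metric.isOpen_ball, Metric.mem_ball_self hr,
    isPreconnected_inter_compl SP.isClosed Metric.isOpen_ball (Metric.mem_ball_self hr)
      (SP.mem_closure_interior (SP.segment_subset m (openSegment_subset_segment ℝ _ _ hz)))
      (convex_side d z r).isPreconnected (convex_side (-d) z r).isPreconnected
      inter_subset_right inter_subset_right ?_ ?_ ?_⟩
  · rintro x ⟨hx, hxB⟩ hf
    rw [h x hxB] at hf
    rw [mem_ofPred_eq, hf] at hx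
    exact lt_irrefl _ hx
  · rintro x ⟨hx, hxB⟩ hf
    rw [h x hxB] at hf
    rw [mem_ofPred_eq, cross_neg_left, hf] at hx
    simp at hx
  · intro x hxB hf
    rw [h x hxB] at hf
    rcases lt_or_gt_of_ne hf with h' | h'
    · right
      refine ⟨?_, hxB⟩
      rw [mem_ofPred_eq, cross_neg_left]
      linarith
    · exact Or.inl ⟨h', hxB⟩

/-- A segment inside the polygon cannot cross an edge transversally. -/
theorem false_of_segment_crosses {m : ZMod n} {a b z : Plane}
    (hz : z ∈ openSegment ℝ (SP.v m) (SP.v (m + 1))) (hab : segment ℝ a b ⊆ SP.P)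
    (hzab : z ∈ openSegment ℝ a b)
    (hc : cross (SP.v (m + 1) - SP.v m) (b - a) ≠ 0) : False := by
  obtain ⟨r, hr, h⟩ := SP.exists_ball_inter_frontier hz
  set d := SP.v (m + 1) - SP.v m
  have hzf : z ∈ frontier SP.P :=
    SP.mem_frontier_iff.2 ⟨m, openSegment_subset_segment ℝ _ _ hz⟩
  have hside : ∀ e : Plane, (∀ y, cross e y = cross d y) ∨ (∀ y, cross e y = -cross d y) →
      ({y | 0 < cross e (y - z)} ∩ Metric.ball z r) ⊆ interior SP.P := by
    intro e he
    have hez : ∀ y, cross e y = 0 ↔ cross d y = 0 := by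
      intro y
      rcases he with he | he <;> simp [he]
    refine ((convex_side e z r).isPreconnected.subset_interior_or_compl SP.isClosed
      ?_).resolve_right ?_
    · rintro x ⟨hx, hxB⟩ hf
      rw [h x hxB, ← hez] at hf
      rw [mem_ofPred_eq, hf] at hx
      exact lt_irrefl _ hx
    · intro hsub
      rw [openSegment_eq_image'] at hzab
      obtain ⟨t, ht, rfl⟩ := hzab
      have hc' : cross e (b - a) ≠ 0 := by rwa [Ne, hez]
      have hcr : ∀ τ : ℝ, cross e (a + τ • (b - a) - (a + t • (b - a)))
          = (τ - t) * cross e (b - a) := by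
        intro τ
        simp [cross]
        ring
      have hball : ∀ᶠ τ : ℝ in 𝓝 t, a + τ • (b - a) ∈ Metric.ball (a + t • (b - a)) r := by
        have : Continuous fun τ : ℝ => a + τ • (b - a) := by fun_prop
        exact this.continuousAt.eventually (Metric.ball_mem_nhds _ hr)
      have hev := hball.and (Ioo_mem_nhds ht.1 ht.2)
      have hin : ∀ τ ∈ Ioo (0 : ℝ) 1, a + τ • (b - a) ∈ SP.P := fun τ hτ =>
        hab (by rw [segment_eq_image']; exact ⟨τ, ⟨hτ.1.le, hτ.2.le⟩, rfl⟩)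
      rcases lt_or_gt_of_ne hc' with hlt | hgt
      · obtain ⟨τ, ⟨hτB, hτ⟩, hτt⟩ :=
          ((hev.filter_mono nhdsWithin_le_nhds).and
            (self_mem_nhdsWithin (a := t) (s := Iio t))).exists
        refine hsub ⟨?_, hτB⟩ (hin τ hτ)
        rw [mem_ofPred_eq, hcr]
        exact mul_pos_of_neg_of_neg (sub_neg.2 hτt) hlt
      · obtain ⟨τ, ⟨hτB, hτ⟩, hτt⟩ :=
          ((hev.filter_mono nhdsWithin_le_nhds).and
            (self_mem_nhdsWithin (a := t) (s := Ioi t))).exists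
        refine hsub ⟨?_, hτB⟩ (hin τ hτ)
        rw [mem_ofPred_eq, hcr]
        exact mul_pos (sub_pos.2 hτt) hgt
  apply hzf.2
  rw [mem_interior]
  refine ⟨Metric.ball z r, fun y hy => ?_, Metric.isOpen_ball, Metric.mem_ball_self hr⟩
  rcases lt_trichotomy (cross d (y - z)) 0 with h' | h' | h'
  · refine interior_subset (hside (-d) (Or.inr (cross_neg_left d)) ⟨?_, hy⟩)
    rw [mem_ofPred_eq, cross_neg_left]
    linarith
  · exact SP.isClosed.frontier_subset ((h y hy).2 h')
  · exact interior_subset (hside d (Or.inl fun _ => rfl) ⟨h', hy⟩)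

theorem exists_preconnected_of_vertex (m : ZMod n) :
    ∃ B, IsOpen B ∧ SP.v (m + 1) ∈ B ∧ IsPreconnected (B ∩ SP.Pᶜ) := by
  have hmm : m ≠ m + 1 + 1 := fun h => SP.two_ne_zero (by
    rw [add_assoc] at h; simpa using h)
  have hm1 : m + 1 ≠ m := by simpa using SP.one_ne_zero
  have hm2 : m + 1 ≠ m + 1 + 1 := by simpa using SP.one_ne_zero
  have hev := SP.eventually_notMem_segment (s := {m, m + 1}) (z := SP.v (m + 1)) fun l hl => by
    simp only [mem_insert_iff, mem_singleton_iff, not_or] at hl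
    exact SP.v_notMem_segment hl.2 fun h => hl.1 (by simpa using h)
  have hc := SP.cross_ne_zero hm1 hm2 hmm
  have hedge := SP.mem_closure_interior (SP.segment_subset (m + 1) (left_mem_segment ℝ _ _))
  set p := SP.v (m + 1) with hp
  set d₁ := SP.v m - p
  set d₂ := SP.v (m + 1 + 1) - p
  obtain ⟨S, T, hSc, hTc, hSaff, hTaff, hrep, hSrep, hTrep⟩ := exists_affine_coordinates p hc
  have hSp : S p = 0 := by simpa using hSrep 0 0
  have hTp : T p = 0 := by simpa using hTrep 0 0
  have e₁ : ∀ᶠ y in 𝓝 p, S y < 1 :=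
    hSc.continuousAt.eventually (gt_mem_nhds (by rw [hSp]; exact one_pos))
  have e₂ : ∀ᶠ y in 𝓝 p, T y < 1 :=
    hTc.continuousAt.eventually (gt_mem_nhds (by rw [hTp]; exact one_pos))
  obtain ⟨r, hr, hball⟩ := Metric.eventually_nhds_iff_ball.1 (hev.and (e₁.and e₂))
  have hfront : ∀ y ∈ Metric.ball p r, y ∈ frontier SP.P ↔
      (0 ≤ S y ∧ T y = 0) ∨ (S y = 0 ∧ 0 ≤ T y) := by
    intro y hy
    obtain ⟨h1, h2, h3⟩ := hball y hy
    rw [SP.mem_frontier_iff]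
    constructor
    · rintro ⟨l, hl⟩
      by_cases hlm : l = m
      · subst hlm
        rw [segment_symm, segment_eq_image'] at hl
        obtain ⟨t, ht, rfl⟩ := hl
        have e1 : S (p + t • d₁) = t := by simpa using hSrep t 0
        have e2 : T (p + t • d₁) = 0 := by simpa using hTrep t 0
        left
        exact ⟨ht.1.trans_eq e1.symm, e2⟩
      by_cases hlm1 : l = m + 1
      · subst hlm1
        rw [segment_eq_image'] at hl
        obtain ⟨t, ht, rfl⟩ := hl
        have e1 : S (p + t • d₂) = 0 := by simpa using hSrep 0 t
        have e2 : T (p + t • d₂) = t := by simpa using hTrep 0 t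
        right
        exact ⟨e1, ht.1.trans_eq e2.symm⟩
      · exact absurd hl (h1 l (by simp [hlm, hlm1]))
    · rintro (⟨hs, ht⟩ | ⟨hs, ht⟩)
      · refine ⟨m, ?_⟩
        rw [segment_symm, segment_eq_image']
        refine ⟨S y, ⟨hs, h2.le⟩, ?_⟩
        have := hrep y
        rw [ht] at this
        simpa using this.symm
      · refine ⟨m + 1, ?_⟩
        rw [segment_eq_image']
        refine ⟨T y, ⟨ht, h3.le⟩, ?_⟩
        have := hrep y
        rw [hs] at this
        simpa using this.symm
  have hSneg : Convex ℝ {y | 0 < -S y} := convex_setOf_pos fun x y a b hab => by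
    rw [hSaff x y a b hab]; ring
  have hTneg : Convex ℝ {y | 0 < -T y} := convex_setOf_pos fun x y a b hab => by
    rw [hTaff x y a b hab]; ring
  have hA₁ : IsPreconnected (({y | 0 < S y} ∩ {y | 0 < T y}) ∩ Metric.ball p r) :=
    (((convex_setOf_pos hSaff).inter (convex_setOf_pos hTaff)).inter
      (convex_ball p r)).isPreconnected
  have hA₂ : IsPreconnected (({y | 0 < -S y} ∩ Metric.ball p r) ∪
      ({y | 0 < -T y} ∩ Metric.ball p r)) := by
    have hlim : ∀ᶠ τ : ℝ in 𝓝[>] 0, p + (-τ) • d₁ + (-τ) • d₂ ∈ Metric.ball p r := by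
      have : Continuous fun τ : ℝ => p + (-τ) • d₁ + (-τ) • d₂ := by fun_prop
      refine (this.continuousAt.eventually (?_ : Metric.ball p r ∈ 𝓝 _)).filter_mono
        nhdsWithin_le_nhds
      simpa using Metric.ball_mem_nhds p hr
    obtain ⟨τ, hτB, hτ⟩ := (hlim.and self_mem_nhdsWithin).exists
    replace hτ : 0 < τ := hτ
    refine IsPreconnected.union (p + (-τ) • d₁ + (-τ) • d₂) ⟨?_, hτB⟩ ⟨?_, hτB⟩
      (hSneg.inter (convex_ball p r)).isPreconnected
      (hTneg.inter (convex_ball p r)).isPreconnected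
    · rw [mem_ofPred_eq, hSrep]; simpa using hτ
    · rw [mem_ofPred_eq, hTrep]; simpa using hτ
  refine ⟨Metric.ball p r, Metric.isOpen_ball, Metric.mem_ball_self hr,
    isPreconnected_inter_compl SP.isClosed Metric.isOpen_ball (Metric.mem_ball_self hr)
      hedge hA₁ hA₂ inter_subset_right
      (union_subset inter_subset_right inter_subset_right) ?_ ?_ ?_⟩
  · rintro x ⟨⟨hs, ht⟩, hxB⟩ hf
    rw [mem_ofPred_eq] at hs ht
    rcases (hfront x hxB).1 hf with ⟨h1, h2⟩ | ⟨h1, h2⟩ <;> linarith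
  · rintro x (⟨hs, hxB⟩ | ⟨hs, hxB⟩) hf <;> rw [mem_ofPred_eq] at hs <;>
      rcases (hfront x hxB).1 hf with ⟨h1, h2⟩ | ⟨h1, h2⟩ <;> linarith
  · intro x hxB hf
    rw [hfront x hxB] at hf
    by_cases hs : S x < 0
    · exact Or.inr (Or.inl ⟨by rw [mem_ofPred_eq]; linarith, hxB⟩)
    by_cases ht : T x < 0
    · exact Or.inr (Or.inr ⟨by rw [mem_ofPred_eq]; linarith, hxB⟩)
    push Not at hs ht hf
    left
    refine ⟨⟨lt_of_le_of_ne hs fun h => ?_, lt_of_le_of_ne ht fun h => ?_⟩, hxB⟩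
    · exact absurd (hf.2 h.symm) (not_lt.2 ht)
    · exact hf.1 hs h.symm

theorem isPreconnected_frontier : IsPreconnected (frontier SP.P) := by
  have := SP.neZero
  have h : frontier SP.P =
      ⋃ m : ℕ, segment ℝ (SP.v (m : ZMod n)) (SP.v ((m : ZMod n) + 1)) := by
    rw [SP.frontier_eq]
    exact ((ZMod.natCast_zmod_surjective (n := n)).iUnion_comp
      (fun m => segment ℝ (SP.v m) (SP.v (m + 1)))).symm
  rw [h]
  refine IsPreconnected.iUnion_of_chain (fun m => (convex_segment _ _).isPreconnected) fun m => ?_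
  refine ⟨SP.v (m + 1), right_mem_segment ℝ _ _, ?_⟩
  simp only [Nat.succ_eq_succ, Nat.succ_eq_add_one, Nat.cast_add, Nat.cast_one]
  exact left_mem_segment ℝ _ _

theorem isPreconnected_compl : IsPreconnected SP.Pᶜ := by
  refine isPreconnected_compl_of_frontier SP.compact
    ⟨SP.v 0, SP.segment_subset 0 (left_mem_segment ℝ _ _)⟩ SP.isPreconnected_frontier ?_
  intro p hp
  obtain ⟨m, hm⟩ := SP.mem_frontier_iff.1 hp
  rw [← insert_endpoints_openSegment] at hm
  rcases hm with rfl | rfl | hm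
  · have := SP.exists_preconnected_of_vertex (m - 1)
    rwa [sub_add_cancel] at this
  · exact SP.exists_preconnected_of_vertex m
  · exact SP.exists_preconnected_of_mem_openSegment hm

/-- A loop inside a simple polygon does not wind around any point outside the polygon. -/
theorem loopAngle_eq_zero_of_notMem {a : Plane} {u : ℕ → Plane} {s k : ℕ} (hsk : s ≤ k)
    (hu : ∀ m, u m ∈ SP.P) (ha : a ∈ SP.P) (hloop : loop a u s k ⊆ SP.P) {z : Plane}
    (hz : z ∉ SP.P) : loopAngle a u s k z = 0 := by
  obtain ⟨r, hr⟩ := SP.compact.isBounded.subset_closedBall (0 : Plane)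
  have hfst : ∀ p ∈ SP.P, -r - 1 < p.1 := by
    intro p hp
    have h1 := hr hp
    rw [mem_closedBall_zero_iff] at h1
    have h2 := (norm_fst_le p).trans h1
    rw [Real.norm_eq_abs] at h2
    linarith [(abs_le.1 h2).1]
  have hw : ((-r - 1, 0) : Plane) ∉ SP.P := fun h => lt_irrefl _ (hfst _ h)
  rw [loopAngle_const hsk SP.isPreconnected_compl (fun x hx hl => hx (hloop hl)) hz hw]
  exact loopAngle_eq_zero hsk (hfst a ha) fun m => hfst _ (hu m)

end SimplePolygon

/-- A segment meeting an open sector, with endpoints outside and avoiding two of the three sides,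
cannot exist. -/
theorem false_of_segment_meets_sector {S T : Plane → ℝ} (hSc : Continuous S) (hTc : Continuous T)
    (hS : ∀ x y (a b : ℝ), a + b = 1 → S (a • x + b • y) = a * S x + b * S y)
    (hT : ∀ x y (a b : ℝ), a + b = 1 → T (a • x + b • y) = a * T x + b * T y)
    {σ : ℝ} (hσ : 0 < σ) {g h z : Plane}
    (hg : ¬ (0 < S g ∧ S g ≤ 1 ∧ 0 ≤ T g ∧ T g < σ * S g))
    (hh : ¬ (0 < S h ∧ S h ≤ 1 ∧ 0 ≤ T h ∧ T h < σ * S h))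
    (h₁ : ∀ y ∈ segment ℝ g h, 0 < S y → S y < 1 → T y ≠ 0)
    (h₂ : ∀ y ∈ segment ℝ g h, S y = 1 → 0 ≤ T y → σ ≤ T y)
    (hz : z ∈ segment ℝ g h) (hz₀ : 0 < S z) (hz₁ : S z < 1) (hz₂ : 0 ≤ T z)
    (hz₃ : T z < σ * S z) : False := by
  have hTz : 0 < T z := lt_of_le_of_ne hz₂ (h₁ z hz hz₀ hz₁).symm
  have key : ∀ e ∈ segment ℝ g h, ¬ (0 < S e ∧ S e ≤ 1 ∧ 0 ≤ T e ∧ T e < σ * S e) →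
      σ * S e - T e ≤ 0 := by
    intro e he hne
    by_contra! hpos
    have hsub : segment ℝ z e ⊆ segment ℝ g h := (convex_segment g h).segment_subset hz he
    have hl : ∀ y ∈ segment ℝ z e, 0 < σ * S y - T y := by
      rintro y ⟨α, β, hα, hβ, hαβ, rfl⟩
      rw [hS _ _ _ _ hαβ, hT _ _ _ _ hαβ]
      rcases hα.eq_or_lt with rfl | hα
      · have : β = 1 := by linarith
        subst this
        linarith
      · nlinarith [mul_pos hα (sub_pos.2 hz₃), mul_nonneg hβ hpos.le]
    have he0 : min (T e) (1 - S e) ≤ 0 := by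
      by_contra! hmin
      rw [lt_min_iff] at hmin
      refine hne ⟨?_, by linarith, hmin.1.le, by linarith⟩
      by_contra! hSe
      nlinarith
    have hz0 : 0 ≤ min (T z) (1 - S z) := le_min hz₂ (by linarith)
    obtain ⟨y, hy, hy0⟩ := (convex_segment z e).isPreconnected.intermediate_value
      (right_mem_segment ℝ z e) (left_mem_segment ℝ z e)
      (f := fun y => min (T y) (1 - S y)) (by fun_prop) ⟨he0, hz0⟩
    have hly := hl y hy
    simp only at hy0
    rcases min_choice (T y) (1 - S y) with hc | hc
    · have hTy : T y = 0 := hc.symm.trans hy0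
      have hSy : 0 ≤ 1 - S y := hy0.symm.trans_le (min_le_right _ _)
      have hSy0 : 0 < S y := by
        by_contra! hn
        nlinarith
      rcases hSy.eq_or_lt with h0 | h0
      · have := h₂ y (hsub hy) (by linarith) hTy.ge
        linarith
      · exact h₁ y (hsub hy) hSy0 (by linarith) hTy
    · have hSy : S y = 1 := by linarith [hc.symm.trans hy0]
      have hTy : 0 ≤ T y := hy0.symm.trans_le (min_le_left _ _)
      have := h₂ y (hsub hy) hSy hTy
      rw [hSy] at hly
      linarith
  have kg := key g (left_mem_segment ℝ g h) hg
  have kh := key h (right_mem_segment ℝ g h) hh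
  obtain ⟨α, β, hα, hβ, hαβ, rfl⟩ := hz
  rw [hS _ _ _ _ hαβ, hT _ _ _ _ hαβ] at hz₃
  nlinarith [mul_nonneg hα (neg_nonneg.2 kg), mul_nonneg hβ (neg_nonneg.2 kh)]

theorem vertex_mem_loop {a : Plane} {u : ℕ → Plane} {s k l : ℕ} (hsk : s < k) (hsl : s ≤ l)
    (hlk : l ≤ k) : u l ∈ loop a u s k := by
  by_contra hn
  obtain ⟨-, h2, h3⟩ := notMem_loop.1 hn
  rcases hlk.eq_or_lt with rfl | h
  · exact h3 (left_mem_segment ℝ _ _)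
  · exact h2 l hsl h (left_mem_segment ℝ _ _)

/-- Rotating a ray from `a` that sees the interior point `a + X` of the edge `[u m, u (m + 1)]`
towards an endpoint `a + X + D` of that edge until it first meets a vertex `u l` of the loop
sweeps a triangle inside `P`. -/
theorem exists_swept_triangle {P : Set Plane} (hP : IsClosed P) {a : Plane} {u : ℕ → Plane}
    {s k m : ℕ} (hsk : s < k)
    (hR : ∀ z ∉ loop a u s k, loopAngle a u s k z ≠ 0 → z ∈ P)
    {X D : Plane} (hXD : cross X D ≠ 0)
    {l₀ : ℕ} (hsl₀ : s ≤ l₀) (hl₀k : l₀ ≤ k) (hl₀ : u l₀ = a + X + D)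
    (hline : ∀ y ∈ segment ℝ (u m) (u (m + 1)), ∃ δ : ℝ, y = a + X + δ • D)
    (hopen : ∀ δ : ℝ, 0 ≤ δ → δ < 1 → a + X + δ • D ∈ openSegment ℝ (u m) (u (m + 1)))
    (hsep : ∀ l, s ≤ l → l < k → l ≠ m → ∀ z ∈ openSegment ℝ (u m) (u (m + 1)),
      z ∉ segment ℝ (u l) (u (l + 1)))
    (hsep₁ : ∀ z ∈ openSegment ℝ (u m) (u (m + 1)), z ∉ segment ℝ a (u s))
    (hsep₂ : ∀ z ∈ openSegment ℝ (u m) (u (m + 1)), z ∉ segment ℝ a (u k))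
    (hne : ∀ l, s ≤ l → l ≤ k → a + X ≠ u l)
    (hray : ∀ A : ℝ, 0 < A → A < 1 → a + A • X ∉ loop a u s k)
    (hW : loopAngle a u s k (a + (1 / 2 : ℝ) • X) ≠ 0) :
    ∃ (l : ℕ) (σ r : ℝ), s ≤ l ∧ l ≤ k ∧ 0 < σ ∧ 0 < r ∧ r ≤ 1 ∧
      u l = a + r • X + (r * σ) • D ∧
      ∀ A δ : ℝ, 0 ≤ A → A ≤ 1 → 0 ≤ δ → δ ≤ σ * A → a + A • X + δ • D ∈ P := by
  obtain ⟨S, T, hSc, hTc, hSaff, hTaff, hrep, hSrep, hTrep⟩ := exists_affine_coordinates a hXD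
  have hSl₀ : S (u l₀) = 1 := by rw [hl₀]; simpa using hSrep 1 1
  have hTl₀ : T (u l₀) = 1 := by rw [hl₀]; simpa using hTrep 1 1
  classical
  obtain ⟨l, hl, hmin⟩ := Finset.exists_min_image
    ((Finset.Icc s k).filter fun l => 0 < S (u l) ∧ S (u l) ≤ 1 ∧ 0 ≤ T (u l))
    (fun l => T (u l) / S (u l))
    ⟨l₀, by simp [hsl₀, hl₀k, hSl₀, hTl₀]⟩
  simp only [Finset.mem_filter, Finset.mem_Icc] at hl hmin
  obtain ⟨⟨hsl, hlk⟩, hS0, hS1, hT0⟩ := hl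
  set σ := T (u l) / S (u l) with hσdef
  have hσ1 : σ ≤ 1 := by
    have := hmin l₀
      ⟨⟨hsl₀, hl₀k⟩, by rw [hSl₀]; exact one_pos, hSl₀.le, by rw [hTl₀]; exact zero_le_one⟩
    rwa [hSl₀, hTl₀, div_one] at this
  have hσ : 0 < σ := by
    refine div_pos (lt_of_le_of_ne hT0 fun h => ?_) hS0
    have hu := hrep (u l)
    rw [← h, zero_smul, add_zero] at hu
    rcases hS1.eq_or_lt with h1 | h1
    · rw [h1, one_smul] at hu
      exact hne l hsl hlk hu.symm
    · apply hray _ hS0 h1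
      rw [← hu]
      exact vertex_mem_loop hsk hsl hlk
  have hvert : ∀ j, s ≤ j → j ≤ k →
      ¬ (0 < S (u j) ∧ S (u j) ≤ 1 ∧ 0 ≤ T (u j) ∧ T (u j) < σ * S (u j)) := by
    rintro j hsj hjk ⟨h1, h2, h3, h4⟩
    have := hmin j ⟨⟨hsj, hjk⟩, h1, h2, h3⟩
    rw [le_div_iff₀ h1] at this
    linarith
  have ha : ¬ (0 < S a ∧ S a ≤ 1 ∧ 0 ≤ T a ∧ T a < σ * S a) := by
    have : S a = 0 := by simpa using hSrep 0 0
    rw [this]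
    exact fun h => lt_irrefl _ h.1
  have hside₁ : ∀ y ∈ loop a u s k, 0 < S y → S y < 1 → T y ≠ 0 := by
    intro y hy h1 h2 h3
    have hy' := hrep y
    rw [h3, zero_smul, add_zero] at hy'
    exact hray _ h1 h2 (hy' ▸ hy)
  have hside₂ : ∀ y, S y = 1 → 0 ≤ T y → T y < σ → y ∈ openSegment ℝ (u m) (u (m + 1)) := by
    intro y h1 h2 h3
    have hy' := hrep y
    rw [h1, one_smul] at hy'
    rw [hy']
    exact hopen _ h2 (h3.trans_le hσ1)
  have hoff : ∀ z, 0 < S z → S z < 1 → 0 ≤ T z → T z < σ * S z → z ∉ loop a u s k := by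
    intro z h1 h2 h3 h4
    rw [notMem_loop]
    refine ⟨fun hz => ?_, fun j hsj hjk hz => ?_, fun hz => ?_⟩
    · refine false_of_segment_meets_sector hSc hTc hSaff hTaff hσ ha (hvert s le_rfl hsk.le)
        (fun y hy => hside₁ y (Or.inl (Or.inl hy))) (fun y hy e1 e2 => ?_) hz h1 h2 h3 h4
      by_contra! hlt
      exact hsep₁ y (hside₂ y e1 e2 hlt) hy
    · by_cases hjm : j = m
      · subst hjm
        obtain ⟨δ, rfl⟩ := hline z hz
        have : S (a + X + δ • D) = 1 := by simpa using hSrep 1 δ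
        linarith
      · refine false_of_segment_meets_sector hSc hTc hSaff hTaff hσ (hvert j hsj hjk.le)
          (hvert (j + 1) (by omega) hjk) (fun y hy => hside₁ y (Or.inl (Or.inr ?_)))
          (fun y hy e1 e2 => ?_) hz h1 h2 h3 h4
        · simp only [mem_iUnion, Finset.mem_Ico]
          exact ⟨j, ⟨hsj, hjk⟩, hy⟩
        · by_contra! hlt
          exact hsep j hsj hjk hjm y (hside₂ y e1 e2 hlt) hy
    · refine false_of_segment_meets_sector hSc hTc hSaff hTaff hσ (hvert k hsk.le le_rfl) ha
        (fun y hy => hside₁ y (Or.inr hy)) (fun y hy e1 e2 => ?_) hz h1 h2 h3 h4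
      by_contra! hlt
      exact hsep₂ y (hside₂ y e1 e2 hlt) (segment_symm ℝ a (u k) ▸ hy)
  have hconv : Convex ℝ {z | 0 < S z ∧ S z < 1 ∧ 0 ≤ T z ∧ T z < σ * S z} := by
    rintro x ⟨x1, x2, x3, x4⟩ y ⟨y1, y2, y3, y4⟩ α β hα hβ hαβ
    rw [mem_ofPred_eq, hSaff _ _ _ _ hαβ, hTaff _ _ _ _ hαβ]
    have hβ' : β = 1 - α := by linarith
    rcases hα.eq_or_lt with rfl | hα
    · subst hβ'
      refine ⟨?_, ?_, ?_, ?_⟩ <;> linarith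
    · refine ⟨?_, ?_, ?_, ?_⟩
      · nlinarith [mul_pos hα x1, mul_nonneg hβ y1.le]
      · nlinarith [mul_pos hα (sub_pos.2 x2), mul_nonneg hβ (sub_pos.2 y2).le]
      · nlinarith [mul_nonneg hα.le x3, mul_nonneg hβ y3]
      · nlinarith [mul_pos hα (sub_pos.2 x4), mul_nonneg hβ (sub_pos.2 y4).le]
  have hin : ∀ A δ : ℝ, 0 < A → A < 1 → 0 ≤ δ → δ < σ * A → a + A • X + δ • D ∈ P := by
    intro A δ h1 h2 h3 h4
    have hmem : ∀ A δ : ℝ, 0 < A → A < 1 → 0 ≤ δ → δ < σ * A →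
        a + A • X + δ • D ∈ {z | 0 < S z ∧ S z < 1 ∧ 0 ≤ T z ∧ T z < σ * S z} := by
      intro A δ h1 h2 h3 h4
      rw [mem_ofPred_eq, hSrep, hTrep]
      exact ⟨h1, h2, h3, h4⟩
    have hm := hmem A δ h1 h2 h3 h4
    have hhalf := hmem (1 / 2) 0 (by norm_num) (by norm_num) le_rfl (by linarith)
    rw [zero_smul, add_zero] at hhalf
    refine hR _ (hoff _ hm.1 hm.2.1 hm.2.2.1 hm.2.2.2) ?_
    rwa [loopAngle_const hsk.le hconv.isPreconnected
      (fun z hz => hoff z hz.1 hz.2.1 hz.2.2.1 hz.2.2.2) hm hhalf]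
  refine ⟨l, σ, S (u l), hsl, hlk, hσ, hS0, hS1, ?_, ?_⟩
  · have : S (u l) * σ = T (u l) := by rw [hσdef]; field_simp
    rw [this]
    exact hrep (u l)
  · intro A δ h1 h2 h3 h4
    have hlim : Tendsto (fun τ : ℝ => a + ((1 - τ) * A + τ / 2) • X +
        ((1 - τ) * δ + τ * σ / 4) • D) (𝓝[>] 0) (𝓝 (a + A • X + δ • D)) := by
      have : Continuous fun τ : ℝ => a + ((1 - τ) * A + τ / 2) • X +
          ((1 - τ) * δ + τ * σ / 4) • D := by fun_prop
      simpa using (this.tendsto 0).mono_left nhdsWithin_le_nhds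
    refine hP.mem_of_tendsto hlim ?_
    filter_upwards [Ioc_mem_nhdsGT (show (0 : ℝ) < 1 by norm_num)] with τ hτ
    have hτ' : 0 ≤ 1 - τ := by linarith [hτ.2]
    have := hτ.1
    refine hin _ _ ?_ ?_ ?_ ?_
    · nlinarith [mul_nonneg hτ' h1]
    · nlinarith [mul_nonneg hτ' (sub_nonneg.2 h2)]
    · nlinarith [mul_nonneg hτ' h3, mul_pos this hσ]
    · nlinarith [mul_nonneg hτ' (sub_nonneg.2 h4), mul_pos this hσ]

/-- Some ray from `a` close to `[a, u s]` first meets the loop inside one of its far edges, running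
through points with nonzero loop angle up to there. -/
theorem exists_ray_first_hit {P : Set Plane} (hP : Bornology.IsBounded P) {a : Plane}
    {u : ℕ → Plane} {s k : ℕ} (hsk : s < k)
    (hR : ∀ z ∉ P, loopAngle a u s k z = 0) (hbc : cross (u s - a) (u k - a) ≠ 0)
    (hdis : ∀ m, s ≤ m → m < k → ∀ y ∈ segment ℝ a (u s), y ≠ u s →
      y ∉ segment ℝ (u m) (u (m + 1))) :
    ∃ (m : ℕ) (X : Plane), s ≤ m ∧ m < k ∧ a + X ∈ segment ℝ (u m) (u (m + 1)) ∧
      cross (u s - a) X ≠ 0 ∧ cross (u k - a) X ≠ 0 ∧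
      (∀ A : ℝ, 0 < A → A < 1 → a + A • X ∉ loop a u s k) ∧
      loopAngle a u s k (a + (1 / 2 : ℝ) • X) ≠ 0 := by
  have hab : a ≠ u s := by
    intro h
    apply hbc
    rw [← h]
    simp [cross]
  set z : Plane := (1 / 2 : ℝ) • (a + u s) with hz
  set e : Plane := (a.2 - (u s).2, (u s).1 - a.1) with he
  set K : Set Plane := ⋃ m ∈ Finset.Ico s k, segment ℝ (u m) (u (m + 1)) with hK
  have hKc : IsClosed K := by
    refine isClosed_biUnion_finset fun m _ => ?_
    rw [segment_eq_image']
    exact (isCompact_Icc.image (by fun_prop)).isClosed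
  have hKmem : ∀ y, y ∈ K ↔ ∃ m, s ≤ m ∧ m < k ∧ y ∈ segment ℝ (u m) (u (m + 1)) := by
    intro y
    simp only [hK, mem_iUnion, Finset.mem_Ico, exists_prop, and_assoc]
  have hnear : ∀ τ ∈ Icc (0 : ℝ) 1, a + τ • (z - a) ∉ K := by
    intro τ hτ hmem
    obtain ⟨m, hm1, hm2, hm3⟩ := (hKmem _).1 hmem
    have heq : a + τ • (z - a) = a + (τ / 2) • (u s - a) := by rw [hz]; module
    rw [heq] at hm3
    refine hdis m hm1 hm2 _ ?_ ?_ hm3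
    · rw [segment_eq_image']
      exact ⟨τ / 2, ⟨by linarith [hτ.1], by linarith [hτ.2]⟩, rfl⟩
    · intro h
      have h' : (1 - τ / 2) • (u s - a) = 0 := by
        rw [← sub_eq_zero] at h
        rw [← neg_eq_zero, ← h]
        module
      rcases smul_eq_zero.1 h' with h' | h'
      · linarith [hτ.2]
      · exact hab (sub_eq_zero.1 h').symm
  have hzK : z ∉ K := by simpa using hnear 1 (by norm_num)
  have hzc : cross (u k - a) (z - a) ≠ 0 := by
    intro h
    apply hbc
    rw [hz] at h
    simp [cross] at h ⊢
    linarith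
  have hzac : z ∉ segment ℝ (u k) a := by
    intro h
    apply hzc
    rw [segment_symm] at h
    exact SimplePolygon.cross_eq_zero_of_mem_segment (left_mem_segment ℝ a (u k)) h
  have hjump := eventually_loopAngle_ne (k := k) hab hz he
    (fun m h1 h2 h3 => hzK ((hKmem z).2 ⟨m, h1, h2, h3⟩)) hzac
  have hevK : ∀ᶠ t : ℝ in 𝓝 0, ∀ τ ∈ Icc (0 : ℝ) 1, a + τ • (z + t • e - a) ∉ K := by
    refine isCompact_Icc.eventually_forall_of_forall_eventually fun τ hτ => ?_
    have hc : Continuous fun q : ℝ × ℝ => a + q.2 • (z + q.1 • e - a) := by fun_prop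
    refine hc.continuousAt.eventually (hKc.isOpen_compl.mem_nhds ?_)
    simpa using hnear τ hτ
  have hevc : ∀ᶠ t : ℝ in 𝓝 0, cross (u k - a) (z + t • e - a) ≠ 0 := by
    have hc : Continuous fun t : ℝ => cross (u k - a) (z + t • e - a) := by
      simp only [cross]; fun_prop
    refine hc.continuousAt.eventually_ne ?_
    simpa using hzc
  have hgood := hevK.and hevc
  have hneg : Tendsto (fun t : ℝ => -t) (𝓝 0) (𝓝 0) := by
    simpa using (continuous_neg (G := ℝ)).tendsto 0
  obtain ⟨t, ⟨⟨hp, hn⟩, hj⟩, ht⟩ :=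
    ((((hgood.and (hneg.eventually hgood)).and hjump).filter_mono nhdsWithin_le_nhds).and
      (self_mem_nhdsWithin (a := (0 : ℝ)) (s := Ioi 0))).exists
  replace ht : 0 < t := ht
  have hpick : ∃ ρ : ℝ, ρ ≠ 0 ∧ (∀ τ ∈ Icc (0 : ℝ) 1, a + τ • (z + ρ • e - a) ∉ K) ∧
      cross (u k - a) (z + ρ • e - a) ≠ 0 ∧ loopAngle a u s k (z + ρ • e) ≠ 0 := by
    by_cases h0 : loopAngle a u s k (z + t • e) = 0
    · refine ⟨-t, by linarith, hn.1, hn.2, fun h => hj ht (h0.trans h.symm)⟩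
    · exact ⟨t, ht.ne', hp.1, hp.2, h0⟩
  obtain ⟨ρ, hρ, hρK, hρc, hρW⟩ := hpick
  set Y : Plane := z + ρ • e - a with hY
  have hYq : z + ρ • e = a + (1 : ℝ) • Y := by rw [hY]; module
  rw [hYq] at hρW
  have hYb : cross (u s - a) Y ≠ 0 := by
    have hval : cross (u s - a) Y = ρ * (((u s).1 - a.1) ^ 2 + ((u s).2 - a.2) ^ 2) := by
      rw [hY, hz, he]
      simp [cross]
      ring
    rw [hval]
    refine mul_ne_zero hρ fun h => hab (Prod.ext ?_ ?_)
    · nlinarith [sq_nonneg ((u s).1 - a.1), sq_nonneg ((u s).2 - a.2)]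
    · nlinarith [sq_nonneg ((u s).1 - a.1), sq_nonneg ((u s).2 - a.2)]
  have hsideoff : ∀ p : Plane, cross (p - a) Y ≠ 0 → ∀ r : ℝ, 0 < r →
      a + r • Y ∉ segment ℝ a p := by
    intro p hpY r hr hmem
    have := SimplePolygon.cross_eq_zero_of_mem_segment (left_mem_segment ℝ a p) hmem
    have hexp : cross (p - a) (a + r • Y - a) = r * cross (p - a) Y := by
      simp [cross]
      ring
    rw [hexp] at this
    exact (mul_ne_zero hr.ne' hpY) this
  have hoff : ∀ r : ℝ, 0 < r → a + r • Y ∉ K → a + r • Y ∉ loop a u s k := by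
    intro r hr hrK
    rw [notMem_loop]
    refine ⟨hsideoff _ hYb r hr, fun m h1 h2 h3 => hrK ((hKmem _).2 ⟨m, h1, h2, h3⟩), ?_⟩
    rw [segment_symm]
    exact hsideoff _ hρc r hr
  have hconst : ∀ (I : Set ℝ), IsPreconnected I → (1 : ℝ) ∈ I →
      (∀ r ∈ I, a + r • Y ∉ loop a u s k) → ∀ r ∈ I, loopAngle a u s k (a + r • Y) ≠ 0 := by
    intro I hI h1 hIoff r hr
    rw [loopAngle_const hsk.le (hI.image (fun r : ℝ => a + r • Y) (by fun_prop)) ?_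
      (mem_image_of_mem _ hr) (mem_image_of_mem _ h1)]
    · exact hρW
    · rintro _ ⟨r, hr, rfl⟩
      exact hIoff r hr
  set H : Set ℝ := {r | 0 ≤ r ∧ a + r • Y ∈ K} with hH
  have hHc : IsClosed H := by
    refine isClosed_Ici.inter (hKc.preimage (f := fun r : ℝ => a + r • Y) (by fun_prop))
  have hHb : BddBelow H := ⟨0, fun r hr => hr.1⟩
  have hHne : H.Nonempty := by
    by_contra hemp
    rw [not_nonempty_iff_eq_empty] at hemp
    have hall : ∀ r ∈ Ioi (0 : ℝ), a + r • Y ∉ loop a u s k := fun r hr =>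
      hoff r hr fun h => (hemp ▸ (⟨le_of_lt hr, h⟩ : r ∈ H) : r ∈ (∅ : Set ℝ))
    have hY0 : 0 < ‖Y‖ := by
      rw [norm_pos_iff]
      rintro h
      apply hYb
      rw [h]
      simp [cross]
    obtain ⟨M, hM⟩ := hP.subset_closedBall (0 : Plane)
    have hr0 : 0 < (|M| + ‖a‖ + 1) / ‖Y‖ := by positivity
    refine hconst _ isPreconnected_Ioi (by simp) hall _ hr0 (hR _ fun hmem => ?_)
    have h1 := hM hmem
    rw [mem_closedBall_zero_iff] at h1
    have h2 : ‖((|M| + ‖a‖ + 1) / ‖Y‖) • Y‖ = |M| + ‖a‖ + 1 := by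
      rw [norm_smul, Real.norm_of_nonneg hr0.le]
      field_simp
    have h3 := norm_sub_le (a + ((|M| + ‖a‖ + 1) / ‖Y‖) • Y) a
    rw [add_sub_cancel_left, h2] at h3
    linarith [le_abs_self M]
  have hr₀ := hHc.csInf_mem hHne hHb
  set r₀ := sInf H
  have h1r₀ : 1 < r₀ := by
    by_contra! hle
    exact hρK r₀ ⟨hr₀.1, hle⟩ hr₀.2
  have hbefore : ∀ r ∈ Ioo 0 r₀, a + r • Y ∉ loop a u s k := fun r hr =>
    hoff r hr.1 fun h => absurd (csInf_le hHb (⟨hr.1.le, h⟩ : r ∈ H)) (not_le.2 hr.2)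
  obtain ⟨m, hm1, hm2, hm3⟩ := (hKmem _).1 hr₀.2
  have hcross : ∀ d : Plane, cross d (r₀ • Y) = r₀ * cross d Y := by
    intro d
    simp [cross]
    ring
  have hr₀0 : r₀ ≠ 0 := by linarith
  refine ⟨m, r₀ • Y, hm1, hm2, hm3, ?_, ?_, ?_, ?_⟩
  · rw [hcross]
    exact mul_ne_zero hr₀0 hYb
  · rw [hcross]
    exact mul_ne_zero hr₀0 hρc
  · intro A hA0 hA1
    rw [smul_smul]
    exact hbefore _ ⟨by positivity, by nlinarith⟩
  · rw [smul_smul]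
    exact hconst _ isPreconnected_Ioo ⟨one_pos, h1r₀⟩ hbefore _ ⟨by linarith, by linarith⟩

namespace SimplePolygon

variable {n : ℕ} (SP : SimplePolygon n)

theorem natCast_ne {l m : ℕ} (hl : l < n) (hm : m < n) (h : l ≠ m) (i : ZMod n) :
    i + (l : ZMod n) ≠ i + (m : ZMod n) := by
  intro he
  rw [add_right_inj, ZMod.natCast_eq_natCast_iff', Nat.mod_eq_of_lt hl, Nat.mod_eq_of_lt hm] at he
  exact h he

theorem v_notMem_openSegment (l m : ZMod n) :
    SP.v l ∉ openSegment ℝ (SP.v m) (SP.v (m + 1)) := by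
  intro h
  have h1 : l = m := by
    by_contra hne
    exact SP.notMem_segment_of_mem_openSegment hne h (left_mem_segment ℝ _ _)
  have h2 : l - 1 = m := by
    by_contra hne
    refine SP.notMem_segment_of_mem_openSegment hne h ?_
    rw [sub_add_cancel]
    exact right_mem_segment ℝ _ _
  apply SP.one_ne_zero
  rw [← h1] at h2
  simpa using h2

/-- A visibility segment between two vertices misses the interior of every edge that does not
contain its first endpoint. -/
theorem notMem_segment_of_visible {α β m : ZMod n} (hvis : Visible SP.P (SP.v α) (SP.v β))
    (hm : α ≠ m) (hm' : α ≠ m + 1) {z : Plane}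
    (hz : z ∈ openSegment ℝ (SP.v m) (SP.v (m + 1))) : z ∉ segment ℝ (SP.v α) (SP.v β) := by
  intro hzs
  rw [← insert_endpoints_openSegment] at hzs
  rcases hzs with rfl | rfl | hzo
  · exact SP.v_notMem_openSegment _ _ hz
  · exact SP.v_notMem_openSegment _ _ hz
  refine SP.false_of_segment_crosses hz hvis hzo fun hc => ?_
  have hne := SP.cross_ne_zero (α := m) (β := m + 1) (γ := α)
    (by simpa using SP.one_ne_zero) hm.symm hm'.symm
  have h1 := cross_eq_zero_of_mem_segment (left_mem_segment ℝ _ _)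
    (openSegment_subset_segment ℝ _ _ hz)
  rw [openSegment_eq_image'] at hzo
  obtain ⟨τ, -, rfl⟩ := hzo
  apply hne
  have : cross (SP.v (m + 1) - SP.v m) (SP.v α + τ • (SP.v β - SP.v α) - SP.v m) =
      cross (SP.v (m + 1) - SP.v m) (SP.v α - SP.v m) +
      τ * cross (SP.v (m + 1) - SP.v m) (SP.v β - SP.v α) := by
    simp [cross]
    ring
  rw [this, hc, mul_zero, add_zero] at h1
  exact h1

theorem v_notMem_segment_of_ne {α β γ : ZMod n} (hαβ : α ≠ β) (hαγ : α ≠ γ) (hβγ : β ≠ γ) :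
    SP.v γ ∉ segment ℝ (SP.v α) (SP.v β) := fun h =>
  SP.cross_ne_zero hαβ hαγ hβγ
    (cross_eq_zero_of_mem_segment (left_mem_segment ℝ _ _) h)

end SimplePolygon

/-- Let `j = i + k` with `2 ≤ k ≤ n - 1` and suppose `v i` is visible to `v j`. If
`v' = v (i + t*)` is the last vertex of the chain `ch(v (i+1), v (j-1))` visible to
`v i` (with `t*` the largest `t ∈ {1, …, k-1}` such that `v (i+t)` is visible to `v i`),
then the solid triangle `conv {v i, v', v j}` is entirely contained in `P`. -/
theorem triangle_of_last_visible_subset {n : ℕ} (SP : SimplePolygon n)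
    (i : ZMod n) (k : ℕ) (hk2 : 2 ≤ k) (hkn : k ≤ n - 1)
    (hij : Visible SP.P (SP.v i) (SP.v (i + (k : ZMod n))))
    (tstar : ℕ) (ht1 : 1 ≤ tstar) (ht2 : tstar ≤ k - 1)
    (htvis : Visible SP.P (SP.v (i + (tstar : ZMod n))) (SP.v i))
    (htmax : ∀ t : ℕ, 1 ≤ t → t ≤ k - 1 →
      Visible SP.P (SP.v (i + (t : ZMod n))) (SP.v i) → t ≤ tstar) :
    convexHull ℝ
      ({SP.v i, SP.v (i + (tstar : ZMod n)), SP.v (i + (k : ZMod n))} : Set Plane)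
      ⊆ SP.P := by
  have := SP.neZero
  have hkn' : k < n := by have := SP.three_le; omega
  have hn0 : 0 < n := by omega
  set u : ℕ → Plane := fun m => SP.v (i + (m : ZMod n)) with hu
  set s := tstar
  have hsk : s < k := by omega
  have hu1 : ∀ m, u (m + 1) = SP.v (i + (m : ZMod n) + 1) := fun m => by
    simp only [hu, Nat.cast_add, Nat.cast_one, add_assoc]
  have hedge : ∀ m, segment ℝ (u m) (u (m + 1)) ⊆ SP.P := fun m => by
    rw [hu1]; exact SP.segment_subset _
  have hne : ∀ {l m : ℕ}, l < n → m < n → l ≠ m → i + (l : ZMod n) ≠ i + (m : ZMod n) :=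
    fun hl hm h => SimplePolygon.natCast_ne hl hm h i
  have hne0 : ∀ {m : ℕ}, 0 < m → m < n → i ≠ i + (m : ZMod n) := fun h0 hm => by
    simpa using hne hn0 hm h0.ne
  set a := SP.v i
  have huP : ∀ m, u m ∈ SP.P := fun m => hedge m (left_mem_segment ℝ _ _)
  have hvs : segment ℝ a (u s) ⊆ SP.P := by
    rw [segment_symm]; exact htvis
  have hvk : segment ℝ a (u k) ⊆ SP.P := hij
  have haP : a ∈ SP.P := hvs (left_mem_segment ℝ _ _)
  have hlast : ∀ l, s ≤ l → l ≤ k → segment ℝ a (u l) ⊆ SP.P → l = s ∨ l = k := by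
    intro l h1 h2 h3
    by_contra! hn
    have := htmax l (by omega) (by omega) (by rw [Visible, segment_symm]; exact h3)
    omega
  have hloop : loop a u s k ⊆ SP.P :=
    union_subset (union_subset hvs (iUnion₂_subset fun m _ => hedge m))
      (by rw [segment_symm]; exact hvk)
  have hzero : ∀ z ∉ SP.P, loopAngle a u s k z = 0 := fun z hz =>
    SP.loopAngle_eq_zero_of_notMem hsk.le huP haP hloop hz
  have hcr : ∀ {l m : ℕ}, 0 < l → l < n → 0 < m → m < n → l ≠ m →
      cross (u l - a) (u m - a) ≠ 0 := fun h1 h2 h3 h4 h5 =>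
    SP.cross_ne_zero (hne0 h1 h2) (hne0 h3 h4) (hne h2 h4 h5)
  have hmiss : ∀ e, segment ℝ a (u e) ⊆ SP.P → ∀ m, s ≤ m → m < k →
      ∀ z ∈ openSegment ℝ (u m) (u (m + 1)), z ∉ segment ℝ a (u e) := by
    intro e he m h1 h2 z hz
    rw [hu1] at hz
    refine SP.notMem_segment_of_visible he (hne0 (by omega) (by omega)) ?_ hz
    have := hne0 (m := m + 1) (by omega) (by omega)
    rwa [Nat.cast_add, Nat.cast_one, ← add_assoc] at this
  have hvertmiss : ∀ l, s ≤ l → l ≤ k → u l ∈ segment ℝ a (u s) → u l = u s := by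
    intro l h1 h2 h3
    by_contra hn
    have hls : l ≠ s := by rintro rfl; exact hn rfl
    exact SP.v_notMem_segment_of_ne (hne0 (by omega) (by omega)) (hne0 (by omega) (by omega))
      (hne (by omega) (by omega) hls.symm) h3
  obtain ⟨m, X, hsm, hmk, hx, hXs, hXk, hray, hW⟩ := exists_ray_first_hit SP.compact.isBounded hsk
    hzero (hcr (by omega) (by omega) (by omega) hkn' hsk.ne) (by
      intro m h1 h2 y hy hys hym
      rw [← insert_endpoints_openSegment] at hym
      rcases hym with rfl | rfl | hym
      · exact hys (hvertmiss m h1 h2.le hy)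
      · exact hys (hvertmiss (m + 1) (by omega) h2 hy)
      · exact hmiss s hvs m h1 h2 y hym hy)
  have hR : ∀ z ∉ loop a u s k, loopAngle a u s k z ≠ 0 → z ∈ SP.P := fun z _ hz => by
    by_contra hn
    exact hz (hzero z hn)
  have hXP : ∀ A : ℝ, 0 < A → A < 1 → a + A • X ∈ SP.P := by
    intro A h0 h1
    refine hR _ (hray A h0 h1) ?_
    rwa [loopAngle_const hsk.le
      (isPreconnected_Ioo.image (fun r : ℝ => a + r • X) (by fun_prop) : IsPreconnected
        ((fun r : ℝ => a + r • X) '' Ioo 0 1)) (by rintro _ ⟨r, hr, rfl⟩; exact hray r hr.1 hr.2)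
      (mem_image_of_mem _ ⟨h0, h1⟩)
      (mem_image_of_mem (fun r : ℝ => a + r • X) (by norm_num : (1 / 2 : ℝ) ∈ Ioo 0 1))]
  have hvx : segment ℝ a (a + X) ⊆ SP.P := by
    rw [segment_eq_image']
    rintro _ ⟨t, ht, rfl⟩
    simp only [add_sub_cancel_left]
    rcases ht.1.eq_or_lt with rfl | h0
    · simpa using haP
    rcases ht.2.eq_or_lt with rfl | h1
    · simpa using hedge m hx
    exact hXP t h0 h1
  have hxne : ∀ l, s ≤ l → l ≤ k → a + X ≠ u l := by
    intro l h1 h2 h3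
    have hX : X = u l - a := by rw [← h3]; abel
    rcases hlast l h1 h2 (h3 ▸ hvx) with rfl | rfl
    · exact hXs (by rw [hX]; simp only [cross]; ring)
    · exact hXk (by rw [hX]; simp only [cross]; ring)
  have hxo : a + X ∈ openSegment ℝ (u m) (u (m + 1)) := by
    rw [← insert_endpoints_openSegment] at hx
    rcases hx with h | h | h
    · exact absurd h (hxne m hsm hmk.le)
    · exact absurd h (hxne (m + 1) (by omega) hmk)
    · exact h
  have hx' := hxo
  rw [openSegment_eq_image'] at hx'
  obtain ⟨t, ⟨ht0, ht1'⟩, htx⟩ := hx'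
  set d := u (m + 1) - u m with hd
  have hXd : cross X d ≠ 0 := by
    have h1 := hcr (l := m) (m := m + 1) (by omega) (by omega) (by omega) (by omega) (by omega)
    have hX : X = u m - a + t • d := by
      rw [← add_right_inj a, ← htx]
      simp only
      abel
    have h2 : cross X d = cross (u m - a) (u (m + 1) - a) := by
      rw [hX, hd]
      simp [cross]
      ring
    rwa [h2]
  have hsep : ∀ l, s ≤ l → l < k → l ≠ m → ∀ z ∈ openSegment ℝ (u m) (u (m + 1)),
      z ∉ segment ℝ (u l) (u (l + 1)) := by
    intro l h1 h2 h3 z hz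
    rw [hu1] at hz ⊢
    exact SP.notMem_segment_of_mem_openSegment (hne (by omega) (by omega) h3) hz
  have hsweep : ∀ (c : ℝ) (l₀ : ℕ), c ≠ 0 → s ≤ l₀ → l₀ ≤ k → u l₀ = a + X + c • d →
      0 ≤ t + c → t + c ≤ 1 →
      ∃ (l : ℕ) (σ r : ℝ), (l = s ∨ l = k) ∧ 0 < σ ∧ 0 < r ∧ r ≤ 1 ∧
        u l = a + r • X + (r * σ * c) • d ∧
        ∀ A δ : ℝ, 0 ≤ A → A ≤ 1 → 0 ≤ δ → δ ≤ σ * A → a + A • X + (δ * c) • d ∈ SP.P := by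
    intro c l₀ hc hsl₀ hl₀k hl₀ hc0 hc1
    obtain ⟨l, σ, r, h1, h2, h3, h4, h5, h6, h7⟩ := exists_swept_triangle (D := c • d) SP.isClosed
      hsk hR (by
        have : cross X (c • d) = c * cross X d := by
          simp [cross]
          ring
        rw [this]
        exact mul_ne_zero hc hXd) hsl₀ hl₀k hl₀ (by
        intro y hy
        rw [segment_eq_image'] at hy
        obtain ⟨τ, -, rfl⟩ := hy
        refine ⟨(τ - t) / c, ?_⟩
        rw [← htx, smul_smul, div_mul_cancel₀ _ hc]
        module) (by
        intro δ hδ0 hδ1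
        rw [openSegment_eq_image']
        refine ⟨t + δ * c, ⟨?_, ?_⟩, ?_⟩
        · nlinarith
        · nlinarith
        · rw [← htx]
          module) hsep (hmiss s hvs m hsm hmk) (hmiss k hvk m hsm hmk) hxne hray hW
    refine ⟨l, σ, r, hlast l h1 h2 ?_, h3, h4, h5, by rw [h6, smul_smul], fun A δ a1 a2 a3 a4 => ?_⟩
    · rw [segment_eq_image', h6]
      rintro _ ⟨τ, ⟨hτ0, hτ1⟩, rfl⟩
      convert h7 (τ * r) (τ * (r * σ)) (by positivity) (by nlinarith) (by positivity)
        (by nlinarith) using 1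
      module
    · rw [mul_smul]
      exact h7 A δ a1 a2 a3 a4
  obtain ⟨l₁, σ₁, r₁, hl₁, hσ₁, hr₁, hr₁', hul₁, hP₁⟩ := hsweep (-t) m (by linarith) hsm hmk.le
    (by rw [← htx]; module) (by linarith) (by linarith)
  obtain ⟨l₂, σ₂, r₂, hl₂, hσ₂, hr₂, hr₂', hul₂, hP₂⟩ := hsweep (1 - t) (m + 1) (by linarith)
    (by omega) hmk (by rw [← htx, hd]; module) (by linarith) (by linarith)
  have ht1'' : 0 < 1 - t := by linarith
  have hl₁₂ : l₁ ≠ l₂ := by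
    rintro rfl
    have hX : ∀ r c : ℝ, cross X (a + r • X + c • d - a) = c * cross X d := by
      intro r c
      simp [cross]
      ring
    have h1 := hX r₁ (r₁ * σ₁ * -t)
    have h2 := hX r₂ (r₂ * σ₂ * (1 - t))
    rw [← hul₁] at h1
    rw [← hul₂, h1] at h2
    have h3 := mul_right_cancel₀ hXd h2
    have h4 : 0 < r₁ * σ₁ * t := by positivity
    have h5 : 0 < r₂ * σ₂ * (1 - t) := by positivity
    linarith
  set W : Set Plane := {p | ∃ A δ : ℝ, 0 ≤ A ∧ A ≤ 1 ∧ -(σ₁ * t * A) ≤ δ ∧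
    δ ≤ σ₂ * (1 - t) * A ∧ p = a + A • X + δ • d}
  have hWconv : Convex ℝ W := by
    rintro _ ⟨A, δ, e1, e2, e3, e4, rfl⟩ _ ⟨A', δ', f1, f2, f3, f4, rfl⟩ α β hα hβ hαβ
    refine ⟨α * A + β * A', α * δ + β * δ', by positivity, ?_, ?_, ?_, ?_⟩
    · nlinarith
    · nlinarith [mul_le_mul_of_nonneg_left e3 hα, mul_le_mul_of_nonneg_left f3 hβ]
    · nlinarith [mul_le_mul_of_nonneg_left e4 hα, mul_le_mul_of_nonneg_left f4 hβ]
    · have : β = 1 - α := by linarith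
      subst this
      module
  have hWP : W ⊆ SP.P := by
    rintro _ ⟨A, δ, e1, e2, e3, e4, rfl⟩
    rcases le_total 0 δ with h | h
    · have := hP₂ A (δ / (1 - t)) e1 e2 (by positivity)
        (by rw [div_le_iff₀ ht1'']; linarith)
      rwa [div_mul_cancel₀ _ ht1''.ne'] at this
    · have := hP₁ A (-δ / t) e1 e2 (div_nonneg (by linarith) ht0.le)
        (by rw [div_le_iff₀ ht0]; linarith)
      rwa [mul_neg, div_mul_cancel₀ _ ht0.ne', neg_neg] at this
  have haW : a ∈ W := ⟨0, 0, le_rfl, zero_le_one, by simp, by simp, by simp⟩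
  have h₁W : u l₁ ∈ W := by
    refine ⟨r₁, r₁ * σ₁ * -t, hr₁.le, hr₁', by linarith, ?_, hul₁⟩
    have : 0 ≤ σ₂ * (1 - t) * r₁ := by positivity
    have : 0 ≤ r₁ * σ₁ * t := by positivity
    linarith
  have h₂W : u l₂ ∈ W := by
    refine ⟨r₂, r₂ * σ₂ * (1 - t), hr₂.le, hr₂', ?_, by linarith, hul₂⟩
    have : 0 ≤ σ₁ * t * r₂ := by positivity
    have : 0 ≤ r₂ * σ₂ * (1 - t) := by positivity
    linarith
  have hsW : u s ∈ W := by
    rcases hl₁ with rfl | rfl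
    · exact h₁W
    · rcases hl₂ with rfl | rfl
      · exact h₂W
      · exact absurd rfl hl₁₂
  have hkW : u k ∈ W := by
    rcases hl₁ with rfl | rfl
    · rcases hl₂ with rfl | rfl
      · exact absurd rfl hl₁₂
      · exact h₂W
    · exact h₁W
  refine (convexHull_min ?_ hWconv).trans hWP
  rintro p (rfl | rfl | rfl)
  · exact haW
  · exact hsW
  · exact hkW
end
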